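/- Let k ≥ 3 and s ≥ 5k² be integers with s not divisible by k, and fix F_s, E_s, φ and Φ as in the context. For all α > 0 and γ > 0 there exist θ₀ > 0 and n₀ such that for all 0 ≤ θ ≤ θ₀ and n ≥ n₀: Φ(n, 1/2 + 1/(2s) + γ, θ) ≤ α. That is, every (1/2 + 1/(2s) + γ, θ)-dense k-graph H on n vertices has an {F_s, E_s}-tiling 𝒯 with φ(𝒯) ≤ α. -/

import Mathlib

set_option autoImplicit false

open Finset

section Defs

variable {V : Type} [Fintype V] [DecidableEq V]

/-- `E` is the edge set of a `k`-uniform hypergraph on `V`. -/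
def IsKGraph (k : ℕ) (E : Finset (Finset V)) : Prop := ∀ e ∈ E, e.card = k

/-- The degree of a vertex set `S`: the number of edges containing `S`. -/
def degS (E : Finset (Finset V)) (S : Finset V) : ℕ := (E.filter fun e => S ⊆ e).card

/-- `C` is the (cyclically ordered) vertex list of a copy of a tight cycle:
the vertices are distinct and every `k` cyclically consecutive vertices form an edge. -/
def IsTightCycleList (k : ℕ) (E : Finset (Finset V)) (C : List V) : Prop :=
  C.Nodup ∧ ∀ i < C.length, (((C ++ C).drop i).take k).toFinset ∈ E

/-- `H` has a `C_s^k`-covering: every vertex lies in a copy of the tight cycle on `s` vertices. -/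
def HasCsCovering (k s : ℕ) (E : Finset (Finset V)) : Prop :=
  ∀ v : V, ∃ C : List V, C.length = s ∧ IsTightCycleList k E C ∧ v ∈ C

/-- `H` contains a copy of `C_s^k`. -/
def HasCsCopy (k s : ℕ) (E : Finset (Finset V)) : Prop :=
  ∃ C : List V, C.length = s ∧ IsTightCycleList k E C

/-- `A` is the vertex set of a copy of `C_s^k` in `H`. -/
def SpansCs (k s : ℕ) (E : Finset (Finset V)) (A : Finset V) : Prop :=
  ∃ C : List V, C.length = s ∧ IsTightCycleList k E C ∧ C.toFinset = A

/-- a `C_s^k`-tiling: a set of pairwise disjoint vertex sets of copies of `C_s^k`. -/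
def IsCsTiling (k s : ℕ) (E : Finset (Finset V)) (T : Finset (Finset V)) : Prop :=
  (T : Set (Finset V)).PairwiseDisjoint id ∧ ∀ A ∈ T, SpansCs k s E A

/-- a perfect `C_s^k`-tiling of the induced subgraph on `U`. -/
def HasPerfectCsTilingOn (k s : ℕ) (E : Finset (Finset V)) (U : Finset V) : Prop :=
  ∃ T : Finset (Finset V), IsCsTiling k s E T ∧ T.biUnion id = U

/-- a perfect `C_s^k`-tiling of `H`. -/
def HasPerfectCsTiling (k s : ℕ) (E : Finset (Finset V)) : Prop :=
  HasPerfectCsTilingOn k s E Finset.univ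

/-- the pair `(k,s)` is admissible if `gcd k s = 1` or `k / gcd k s` is even. -/
def AdmissiblePair (k s : ℕ) : Prop := Nat.gcd k s = 1 ∨ Even (k / Nat.gcd k s)

/-- The `k`-graph `H₀^k(A,B)`: edges are the `k`-subsets `e` of `A ∪ B`
with `|e ∩ A| ≢ k (mod 2)`. -/
def H0edges (k : ℕ) (A B : Finset V) : Finset (Finset V) :=
  ((A ∪ B).powersetCard k).filter fun e => ¬ (e ∩ A).card % 2 = k % 2

/-- `P` is (the vertex list of) a tight path: distinct vertices, every `k`
consecutive vertices form an edge. -/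
def IsTightPath (k : ℕ) (E : Finset (Finset V)) (P : List V) : Prop :=
  P.Nodup ∧ ∀ i, i + k ≤ P.length → ((P.drop i).take k).toFinset ∈ E

/-- `P = v₁ ⋯ v_ℓ` has start of type `σ` w.r.t. classes `Vc`: `v_i ∈ V_{σ(i)}`
for `1 ≤ i ≤ k-1` (0-indexed below). -/
def hasStartType (k : ℕ) (Vc : Fin k → Finset V) (P : List V) (σ : Equiv.Perm (Fin k)) : Prop :=
  k ≤ P.length + 1 ∧ ∀ j : Fin k, (j : ℕ) + 1 < k → ∀ v ∈ P[(j : ℕ)]?, v ∈ Vc (σ j)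

/-- `P = v₁ ⋯ v_ℓ` has end of type `σ` w.r.t. classes `Vc`: `v_{ℓ-k+i} ∈ V_{σ(i)}`
for `2 ≤ i ≤ k` (0-indexed below). -/
def hasEndType (k : ℕ) (Vc : Fin k → Finset V) (P : List V) (σ : Equiv.Perm (Fin k)) : Prop :=
  k ≤ P.length + 1 ∧ ∀ j : Fin k, (j : ℕ) ≠ 0 →
    ∀ v ∈ P[(P.length + (j : ℕ) - k)]?, v ∈ Vc (σ j)

/-- `Vc` are the classes of a complete `(k,k)`-graph in `H`: nonempty, pairwise disjoint,
and every transversal is an edge. -/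
def IsCompletePartite (k : ℕ) (E : Finset (Finset V)) (Vc : Fin k → Finset V) : Prop :=
  (∀ i, (Vc i).Nonempty) ∧ (∀ i j, i ≠ j → Disjoint (Vc i) (Vc j)) ∧
  ∀ g : Fin k → V, (∀ i, g i ∈ Vc i) → Finset.image g Finset.univ ∈ E

/-- the cyclic permutation `τ = (1 2 ⋯ k)` (0-indexed: `j ↦ j + 1 mod k`). -/
def cyc (k : ℕ) : Equiv.Perm (Fin k) := finRotate k

/-- `W` is a `G`-gadget for the complete `(k,k)`-graph with classes `Vc` avoiding `S`. -/
def IsGadget (k : ℕ) (E : Finset (Finset V)) (Vc : Fin k → Finset V)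
    (G : SimpleGraph (Fin k)) (S : Finset V) (W : Fin k → Fin k → Finset V) : Prop :=
  (∀ i j, G.Adj i j → W i j = W j i) ∧
  (∀ i j, G.Adj i j →
    (W i j).card = 2 * k - 1 ∧
    (W i j \ Finset.univ.biUnion Vc).card = 1 ∧
    Disjoint (W i j) S ∧
    (∀ i' : Fin k, (W i j ∩ Vc i').card = if i' = i ∨ i' = j then 1 else 2) ∧
    (∀ σ : Equiv.Perm (Fin k), (∃ z : Fin k, (z : ℕ) = 0 ∧ (σ z = i ∨ σ z = j)) →
      ∃ Q : List V, IsTightPath k E Q ∧ Q.toFinset = W i j ∧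
        hasStartType k Vc Q (σ * cyc k) ∧ hasEndType k Vc Q (Equiv.swap i j * σ))) ∧
  (∀ i j i' j', G.Adj i j → G.Adj i' j' → ({i, j} : Finset (Fin k)) ≠ {i', j'} →
    Disjoint (W i j) (W i' j'))

open Classical in
/-- the set of vertices `w_{ij}`, `ij ∈ E(G)`, of a gadget `W`. -/
noncomputable def gadgetVerts (k : ℕ) (Vc : Fin k → Finset V)
    (G : SimpleGraph (Fin k)) (W : Fin k → Fin k → Finset V) : Finset V :=
  (Finset.univ.filter fun p : Fin k × Fin k => G.Adj p.1 p.2).biUnion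
    fun p => W p.1 p.2 \ Finset.univ.biUnion Vc

/-- the graph on `[k]` consisting of the paths given by the lists in `L`. -/
def pathsGraph (k : ℕ) (L : List (List (Fin k))) : SimpleGraph (Fin k) :=
  SimpleGraph.fromEdgeSet {e | ∃ l ∈ L, ∃ p ∈ l.zip l.tail, e = s(p.1, p.2)}

/-- `G` is a vertex-disjoint union of paths. -/
def IsUnionOfPaths (k : ℕ) (G : SimpleGraph (Fin k)) : Prop :=
  ∃ L : List (List (Fin k)), (∀ l ∈ L, l.Nodup) ∧
    L.Pairwise (fun l₁ l₂ => ∀ a ∈ l₁, ∀ b ∈ l₂, a ≠ b) ∧ G = pathsGraph k L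

/-- `m(σ)` (1-indexed), read off from the normalized cycle decomposition `L` of `σ`:
the last element of the last cycle, or `1` if `L` is empty. -/
def mOf (k : ℕ) (L : List (List (Fin k))) : ℕ :=
  ((L.getLast?.bind List.getLast?).map (fun x => (x : ℕ) + 1)).getD 1

/-- `L` is the normalized cycle decomposition of `σ`: disjoint cycles of length ≥ 2,
each cycle listed ending with its minimal element, the cycles ordered by increasing
last elements. -/
def IsNormCycleDecomp (k : ℕ) (σ : Equiv.Perm (Fin k)) (L : List (List (Fin k))) : Prop :=
  (∀ l ∈ L, 2 ≤ l.length ∧ l.Nodup) ∧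
  L.Pairwise (fun l₁ l₂ => ∀ a ∈ l₁, ∀ b ∈ l₂, a ≠ b) ∧
  σ = (L.map List.formPerm).prod ∧
  (∀ l ∈ L, ∀ a ∈ l.getLast?, ∀ b ∈ l, a ≤ b) ∧
  L.Pairwise (fun l₁ l₂ => ∀ a ∈ l₁.getLast?, ∀ b ∈ l₂.getLast?, a < b)

/-- `H` is `(μ, θ)`-dense. -/
def IsDense (k : ℕ) (μ θ : ℝ) (E : Finset (Finset V)) : Prop :=
  ∃ 𝒮 : Finset (Finset V), (∀ S ∈ 𝒮, S.card = k - 1) ∧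
    (𝒮.card : ℝ) ≤ θ * ((Fintype.card V).choose (k - 1)) ∧
    ∀ S : Finset V, S.card = k - 1 → S ∉ 𝒮 →
      μ * ((Fintype.card V : ℝ) - k + 1) ≤ (degS E S : ℝ)

/-- `H` is strongly `(μ, θ)`-dense. -/
def IsStronglyDense (k : ℕ) (μ θ : ℝ) (E : Finset (Finset V)) : Prop :=
  IsDense k μ θ E ∧ ∀ e ∈ E, ∀ X ⊆ e, X.card = k - 1 →
    μ * ((Fintype.card V : ℝ) - k + 1) ≤ (degS E X : ℝ)

/-- the vertex set of `F(K,G)` inside the ambient type: all core vertices, plus one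
pendant vertex for each edge of `G`. -/
def FsVertexSet (k : ℕ) (a : Fin k → ℕ) (G : SimpleGraph (Fin k)) :
    Set ((Σ i : Fin k, Fin (a i)) ⊕ Sym2 (Fin k)) :=
  Set.range Sum.inl ∪ Sum.inr '' G.edgeSet

/-- the edges of `F(K,G)`, where `K = K^k(a)`: all transversals of the classes, plus,
for each edge `ij` of `G`, all `k`-sets consisting of the pendant vertex `w_{ij}` and one
vertex from each class other than `i` (resp. other than `j`). -/
def FKGedges (k : ℕ) (a : Fin k → ℕ) (G : SimpleGraph (Fin k)) :
    Set (Finset ((Σ i : Fin k, Fin (a i)) ⊕ Sym2 (Fin k))) :=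
  {e | (∃ g : ∀ i, Fin (a i), e = Finset.univ.image fun i => Sum.inl ⟨i, g i⟩) ∨
    (∃ i j, G.Adj i j ∧ ∃ g : ∀ i', Fin (a i'),
      e = insert (Sum.inr s(i, j)) ((Finset.univ.erase i).image fun i' => Sum.inl ⟨i', g i'⟩))}

/-- `F(K^k(a), G)` contains a spanning copy of the tight cycle `C_s^k`. -/
def FsHasSpanningCs (k s : ℕ) (a : Fin k → ℕ) (G : SimpleGraph (Fin k)) : Prop :=
  ∃ C : List ((Σ i : Fin k, Fin (a i)) ⊕ Sym2 (Fin k)),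
    C.Nodup ∧ C.length = s ∧ (↑C.toFinset : Set _) = FsVertexSet k a G ∧
    ∀ i < C.length, (((C ++ C).drop i).take k).toFinset ∈ FKGedges k a G

/-- `A` is the vertex set of a copy of `K^k(t)` in `H`. -/
def SpansEsCopy (k t : ℕ) (E : Finset (Finset V)) (A : Finset V) : Prop :=
  ∃ f : Fin k × Fin t → V, Function.Injective f ∧ Finset.univ.image f = A ∧
    ∀ g : Fin k → Fin t, (Finset.univ.image fun i => f (i, g i)) ∈ E

/-- `A` is the vertex set of a copy of `F_s = F(K^k(a), G)` in `H`. -/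
def SpansFsCopy (k : ℕ) (a : Fin k → ℕ) (G : SimpleGraph (Fin k))
    (E : Finset (Finset V)) (A : Finset V) : Prop :=
  ∃ f : ((Σ i : Fin k, Fin (a i)) ⊕ Sym2 (Fin k)) → V,
    Set.InjOn f (FsVertexSet k a G) ∧ f '' FsVertexSet k a G = ↑A ∧
    ∀ e ∈ FKGedges k a G, e.image f ∈ E

/-- `(TF, TE)` is an `{F_s, E_s}`-tiling of `H`, given as the families of vertex sets of
the copies of `F_s` and of `E_s = K^k(max_i a_i)`. -/
def IsFETiling (k : ℕ) (a : Fin k → ℕ) (G : SimpleGraph (Fin k))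
    (E : Finset (Finset V)) (TF TE : Finset (Finset V)) : Prop :=
  ((↑(TF ∪ TE) : Set (Finset V)).PairwiseDisjoint id) ∧
  (∀ A ∈ TF, SpansFsCopy k a G E A) ∧
  (∀ A ∈ TE, SpansEsCopy k (Finset.univ.sup a) E A)

/-- `φ(𝒯) = (n - s(|ℱ_𝒯| + (3/5)|ℰ_𝒯|))/n`. -/
noncomputable def phiTiling (s : ℕ) (TF TE : Finset (Finset V)) : ℝ :=
  ((Fintype.card V : ℝ) - s * ((TF.card : ℝ) + (3 / 5) * (TE.card : ℝ))) / (Fintype.card V : ℝ)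

/-- `φ(H)`: the minimum of `φ(𝒯)` over all `{F_s, E_s}`-tilings of `H`. -/
noncomputable def phiMin (k s : ℕ) (a : Fin k → ℕ) (G : SimpleGraph (Fin k))
    (E : Finset (Finset V)) : ℝ :=
  sInf {x | ∃ TF TE : Finset (Finset V), IsFETiling k a G E TF TE ∧ x = phiTiling s TF TE}

/-- `Φ(n, μ, θ)`: the maximum of `φ(H)` over all `(μ,θ)`-dense `k`-graphs `H` on `n` vertices. -/
noncomputable def PhiMax (k s : ℕ) (a : Fin k → ℕ) (G : SimpleGraph (Fin k))
    (n : ℕ) (μ θ : ℝ) : ℝ :=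
  sSup {x | ∃ E : Finset (Finset (Fin n)), IsKGraph k E ∧ IsDense k μ θ E ∧
    x = phiMin k s a G E}

end Defs

namespace PhiSmall

/-- A reverse Markov inequality for a function bounded by `B`. -/
lemma markov {Ω : Type*} (S : Finset Ω) (f : Ω → ℝ) (B c δ : ℝ) (hB : 0 < B) (hc : 0 ≤ c)
    (hf : ∀ ω ∈ S, f ω ≤ B) (hsum : (c + δ) * B * #S ≤ ∑ ω ∈ S, f ω) :
    δ * #S ≤ #{ω ∈ S | c * B ≤ f ω} := by
  classical
  have h1 : ∑ ω ∈ S, f ω = ∑ ω ∈ S with c * B ≤ f ω, f ω + ∑ ω ∈ S with ¬ c * B ≤ f ω, f ω :=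
    (sum_filter_add_sum_filter_not _ _ _).symm
  have h2 : ∑ ω ∈ S with c * B ≤ f ω, f ω ≤ #{ω ∈ S | c * B ≤ f ω} • B :=
    sum_le_card_nsmul _ _ _ fun ω hω => hf ω (mem_filter.1 hω).1
  have h3 : ∑ ω ∈ S with ¬ c * B ≤ f ω, f ω ≤ #{ω ∈ S | ¬ c * B ≤ f ω} • (c * B) :=
    sum_le_card_nsmul _ _ _ fun ω hω => (not_le.1 (mem_filter.1 hω).2).le
  have h4 : (#{ω ∈ S | ¬ c * B ≤ f ω} : ℝ) ≤ #S := by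
    exact_mod_cast card_le_card (filter_subset _ _)
  rw [nsmul_eq_mul] at h2 h3
  have h5 : (#{ω ∈ S | ¬ c * B ≤ f ω} : ℝ) * (c * B) ≤ #S * (c * B) :=
    mul_le_mul_of_nonneg_right h4 (by positivity)
  have h6 : δ * #S * B ≤ #{ω ∈ S | c * B ≤ f ω} * B := by nlinarith
  exact le_of_mul_le_mul_right h6 hB

lemma pigeonhole {Ω C : Type*} [DecidableEq C] (S : Finset Ω) (T : Finset C) (col : Ω → C)
    (hcol : ∀ ω ∈ S, col ω ∈ T) (hS : S.Nonempty) :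
    ∃ c ∈ T, (#S : ℝ) / #T ≤ #{ω ∈ S | col ω = c} := by
  have hT : T.Nonempty := ⟨_, hcol _ hS.choose_spec⟩
  have hTp : (0 : ℝ) < #T := by exact_mod_cast card_pos.2 hT
  by_contra! h
  have h1 : (#S : ℝ) = ∑ c ∈ T, (#{ω ∈ S | col ω = c} : ℝ) := by
    exact_mod_cast card_eq_sum_card_fiberwise hcol
  have h2 : ∑ c ∈ T, (#{ω ∈ S | col ω = c} : ℝ) < ∑ c ∈ T, (#S : ℝ) / #T :=
    sum_lt_sum_of_nonempty hT h
  rw [sum_const, nsmul_eq_mul, mul_div_cancel₀ _ hTp.ne'] at h2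
  linarith

set_option maxHeartbeats 400000 in
lemma exists_box_fin (r b : ℕ) : ∀ d : ℝ, 0 < d → ∃ n₀ : ℕ, ∀ {V : Type} [DecidableEq V]
    (P : Fin r → Finset V) (R : Finset (Fin r → V)), (∀ i, n₀ ≤ #(P i)) →
    R ⊆ Fintype.piFinset P → d * ∏ i, (#(P i) : ℝ) ≤ #R →
    ∃ K : Fin r → Finset V, (∀ i, K i ⊆ P i) ∧ (∀ i, #(K i) = b) ∧
      ∀ x : Fin r → V, (∀ i, x i ∈ K i) → x ∈ R := by
  induction r with
  | zero =>
    intro d hd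
    refine ⟨0, fun P R _ _ hR => ?_⟩
    simp only [univ_eq_empty, prod_empty, mul_one] at hR
    have : 0 < #R := by
      have : (0 : ℝ) < #R := by linarith
      exact_mod_cast this
    obtain ⟨x, hx⟩ := card_pos.1 this
    exact ⟨fun i => i.elim0, fun i => i.elim0, fun i => i.elim0, fun y _ => by
      rwa [Subsingleton.elim y x]⟩
  | succ r ih =>
    intro d hd
    obtain ⟨q, hq⟩ := exists_nat_ge (max (4 * b / d) (b + 1))
    have hq1 : 4 * b / d ≤ q := le_trans (le_max_left _ _) hq
    have hq2 : b + 1 ≤ q := by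
      have := le_trans (le_max_right _ _) hq
      exact_mod_cast this
    have hchoose : 0 < q.choose b := Nat.choose_pos (by omega)
    obtain ⟨n₁, hn₁⟩ := ih (d / 4 / q.choose b) (by positivity)
    obtain ⟨n₂, hn₂⟩ := exists_nat_ge (q / (d / 2))
    refine ⟨max 1 (max n₁ n₂), fun {V} _ P R hP hRP hR => ?_⟩
    have hPpos : ∀ i, (0 : ℝ) < #(P i) := fun i => by
      have := hP i
      have : 0 < #(P i) := by omega
      exact_mod_cast this
    set X : ℝ := ∏ i : Fin r, (#(P i.succ) : ℝ) with hX
    have hXpos : 0 < X := prod_pos fun i _ => hPpos _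
    set T := Fintype.piFinset fun i : Fin r => P i.succ with hT
    have hTcard : (#T : ℝ) = X := by
      rw [hT, Fintype.card_piFinset]; push_cast; rfl
    let N : V → Finset (Fin r → V) := fun v => {x ∈ T | (Fin.cons v x : Fin (r+1) → V) ∈ R}
    have hNle : ∀ v, (#(N v) : ℝ) ≤ X := fun v => by
      rw [← hTcard]; exact_mod_cast card_le_card (filter_subset _ _)
    have hsum : (#R : ℝ) ≤ ∑ v ∈ P 0, (#(N v) : ℝ) := by
      have : #R ≤ #((P 0).sigma N) := by
        refine card_le_card_of_injOn (fun x => ⟨x 0, Fin.tail x⟩) ?_ ?_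
        · intro x hx
          have hxP := Fintype.mem_piFinset.1 (hRP hx)
          simp only [coe_sigma, Set.mem_sigma_iff, mem_coe, N, mem_filter, hT,
            Fintype.mem_piFinset, Fin.cons_self_tail]
          exact ⟨hxP 0, fun i => hxP _, hx⟩
        · intro x _ y _ hxy
          simp only [Sigma.mk.injEq, heq_eq_eq] at hxy
          rw [← Fin.cons_self_tail x, ← Fin.cons_self_tail y, hxy.1, hxy.2]
      rw [card_sigma] at this
      exact_mod_cast this
    have hheavy := markov (P 0) (fun v => (#(N v) : ℝ)) X (d/2) (d/2) hXpos (by positivity)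
      (fun v _ => hNle v) (by
        rw [Fin.prod_univ_succ] at hR
        nlinarith)
    set Hv := {v ∈ P 0 | d / 2 * X ≤ #(N v)} with hHv
    have hqH : q ≤ #Hv := by
      have h1 : (n₂ : ℝ) ≤ #(P 0) := by
        have := hP 0
        exact_mod_cast (by omega : n₂ ≤ #(P 0))
      have h2 : (q : ℝ) ≤ d / 2 * #(P 0) := by
        have := hn₂.trans h1
        rwa [div_le_iff₀' (by positivity)] at this
      exact_mod_cast h2.trans hheavy
    obtain ⟨Q, hQH, hQc⟩ := exists_subset_card_eq hqH
    have hqpos : (0 : ℝ) < q := by exact_mod_cast (by omega : 0 < q)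
    let f : (Fin r → V) → Finset V := fun x => {v ∈ Q | (Fin.cons v x : Fin (r+1) → V) ∈ R}
    have hdc : ∑ x ∈ T, (#(f x) : ℝ) = ∑ v ∈ Q, (#(N v) : ℝ) := by
      have := sum_card_bipartiteAbove_eq_sum_card_bipartiteBelow (s := T) (t := Q)
        (fun (x : Fin r → V) v => (Fin.cons v x : Fin (r+1) → V) ∈ R)
      simp only [bipartiteAbove, bipartiteBelow] at this
      exact_mod_cast this
    have hQsum : (q : ℝ) * (d / 2 * X) ≤ ∑ v ∈ Q, (#(N v) : ℝ) := by
      rw [← hQc, ← nsmul_eq_mul]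
      exact card_nsmul_le_sum _ _ _ fun v hv => (mem_filter.1 (hQH hv)).2
    have hT2 := markov T (fun x => (#(f x) : ℝ)) q (d/4) (d/4) hqpos (by positivity)
      (fun x _ => by rw [← hQc]; exact_mod_cast card_le_card (filter_subset _ _)) (by
        rw [hdc, hTcard]; nlinarith)
    set T₂ := {x ∈ T | d / 4 * q ≤ #(f x)} with hT₂
    have hfb : ∀ x ∈ T₂, b ≤ #(f x) := fun x hx => by
      have h1 := (mem_filter.1 hx).2
      rw [div_le_iff₀ hd] at hq1
      have : (b : ℝ) ≤ #(f x) := by linarith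
      exact_mod_cast this
    have hch : ∀ x, ∃ K : Finset V, x ∈ T₂ → K ⊆ f x ∧ #K = b := fun x => by
      by_cases hx : x ∈ T₂
      · obtain ⟨K, h1, h2⟩ := exists_subset_card_eq (hfb x hx)
        exact ⟨K, fun _ => ⟨h1, h2⟩⟩
      · exact ⟨∅, fun h => absurd h hx⟩
    choose col hcol using hch
    have hT₂pos : (0 : ℝ) < #T₂ := by
      refine lt_of_lt_of_le ?_ hT2
      rw [hTcard]
      exact mul_pos (by linarith) hXpos
    obtain ⟨K₀, hK₀, hfib⟩ := pigeonhole T₂ (Q.powersetCard b) col (fun x hx => by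
      rw [mem_powersetCard]
      exact ⟨(hcol x hx).1.trans (filter_subset _ _), (hcol x hx).2⟩)
      (card_pos.1 (by exact_mod_cast hT₂pos))
    rw [mem_powersetCard] at hK₀
    rw [card_powersetCard, hQc] at hfib
    obtain ⟨K, hK1, hK2, hK3⟩ := hn₁ (fun i => P i.succ) {x ∈ T₂ | col x = K₀}
      (fun i => by have := hP i.succ; omega)
      (((filter_subset _ _).trans (filter_subset _ _))) (by
        refine le_trans ?_ hfib
        rw [← hX, ← hTcard, div_mul_eq_mul_div]
        gcongr)
    refine ⟨Fin.cons K₀ K, ?_, ?_, ?_⟩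
    · intro i
      refine Fin.cases ?_ (fun j => ?_) i
      · simpa using hK₀.1.trans (hQH.trans (filter_subset _ _))
      · simpa using hK1 j
    · intro i
      refine Fin.cases ?_ (fun j => ?_) i
      · simpa using hK₀.2
      · simpa using hK2 j
    · intro x hx
      have h1 := hK3 (Fin.tail x) fun i => by simpa [Fin.tail] using hx i.succ
      rw [mem_filter] at h1
      have h2 := (hcol _ h1.1).1
      rw [h1.2] at h2
      have h3 := (mem_filter.1 (h2 (by simpa using hx 0))).2
      rwa [Fin.cons_self_tail] at h3

lemma exists_box (I : Type) [Fintype I] [DecidableEq I] (b : ℕ) (d : ℝ) (hd : 0 < d) :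
    ∃ n₀ : ℕ, ∀ {V : Type} [DecidableEq V]
    (P : I → Finset V) (R : Finset (I → V)), (∀ i, n₀ ≤ #(P i)) →
    R ⊆ Fintype.piFinset P → d * ∏ i, (#(P i) : ℝ) ≤ #R →
    ∃ K : I → Finset V, (∀ i, K i ⊆ P i) ∧ (∀ i, #(K i) = b) ∧
      ∀ x : I → V, (∀ i, x i ∈ K i) → x ∈ R := by
  obtain ⟨n₀, h⟩ := exists_box_fin (Fintype.card I) b d hd
  refine ⟨n₀, fun {V} _ P R hP hRP hR => ?_⟩
  let e := Fintype.equivFin I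
  let F : (I → V) ↪ (Fin (Fintype.card I) → V) :=
    ⟨fun x j => x (e.symm j), fun x y hxy => by
      ext i; simpa using congrFun hxy (e i)⟩
  obtain ⟨K, h1, h2, h3⟩ := h (fun j => P (e.symm j)) (R.map F) (fun j => hP _) (by
    intro y hy
    obtain ⟨x, hx, rfl⟩ := mem_map.1 hy
    have := Fintype.mem_piFinset.1 (hRP hx)
    exact Fintype.mem_piFinset.2 fun j => this _) (by
    rw [card_map, Equiv.prod_comp e.symm (fun i => (#(P i) : ℝ))]
    exact hR)
  refine ⟨fun i => K (e i), fun i => by simpa using h1 (e i), fun i => h2 _, fun x hx => ?_⟩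
  have := h3 (F x) fun j => by
    have := hx (e.symm j)
    simp only [e.apply_symm_apply] at this
    exact this
  obtain ⟨x', hx', hxx⟩ := mem_map.1 this
  rwa [← F.injective hxx]

lemma mul_div_mul_cancel_aux (c d X : ℝ) (hc : 0 < c) : c * (d / (2 * c) * X) = d / 2 * X := by
  field_simp

set_option maxHeartbeats 400000 in
/-- Many boxes, pairwise disjoint in every coordinate, inside a dense relation. -/
lemma exists_boxes (I : Type) [Fintype I] [DecidableEq I] [Nonempty I] (b : ℕ) (d : ℝ)
    (hd : 0 < d) (hd1 : d ≤ 1) :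
    ∃ n₀ : ℕ, ∀ {V : Type} [DecidableEq V]
    (P : I → Finset V) (R : Finset (I → V)), (∀ i, n₀ ≤ #(P i)) →
    R ⊆ Fintype.piFinset P → d * ∏ i, (#(P i) : ℝ) ≤ #R →
    ∀ y : ℕ, (∀ i, (y * b : ℝ) ≤ d / (2 * Fintype.card I) * #(P i)) →
    ∃ K : ℕ → I → Finset V, (∀ j < y, ∀ i, K j i ⊆ P i) ∧ (∀ j < y, ∀ i, #(K j i) = b) ∧
      (∀ j < y, ∀ j' < y, j ≠ j' → ∀ i, Disjoint (K j i) (K j' i)) ∧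
      ∀ j < y, ∀ x : I → V, (∀ i, x i ∈ K j i) → x ∈ R := by
  obtain ⟨n₀, h⟩ := exists_box I b (d / 2) (by positivity)
  refine ⟨2 * n₀, fun {V} _ P R hP hRP hR y => ?_⟩
  have hI : (1 : ℝ) ≤ Fintype.card I := by exact_mod_cast Fintype.card_pos
  induction y with
  | zero => exact fun _ => ⟨fun _ _ => ∅, by simp⟩
  | succ y ih =>
    intro hy
    obtain ⟨K, h1, h2, h3, h4⟩ := ih fun i => le_trans (by push_cast; nlinarith) (hy i)
    let used : I → Finset V := fun i => (range y).biUnion fun j => K j i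
    have hused : ∀ i, (#(used i) : ℝ) ≤ d / (2 * Fintype.card I) * #(P i) := fun i => by
      have : #(used i) ≤ y * b := by
        have := card_biUnion_le_card_mul (range y) (fun j => K j i) b
          fun j hj => (h2 j (mem_range.1 hj) i).le
        simpa using this
      refine le_trans ?_ (hy i)
      have h' : (#(used i) : ℝ) ≤ y * b := by exact_mod_cast this
      push_cast
      nlinarith
    have husedP : ∀ i, used i ⊆ P i := fun i => biUnion_subset.2 fun j hj =>
      h1 j (mem_range.1 hj) i
    have hfrac : d / (2 * Fintype.card I) ≤ 1 / 2 := by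
      rw [div_le_div_iff₀ (by positivity) (by norm_num)]; nlinarith
    have hcard : ∀ i, (#(P i \ used i) : ℝ) = #(P i) - #(used i) := fun i => by
      rw [card_sdiff_of_subset (husedP i), Nat.cast_sub (card_le_card (husedP i))]
    let R' := {x ∈ R | ∀ i, x i ∉ used i}
    have hbad : (#{x ∈ R | ¬ ∀ i, x i ∉ used i} : ℝ) ≤ d / 2 * ∏ i, (#(P i) : ℝ) := by
      have hsub : {x ∈ R | ¬ ∀ i, x i ∉ used i} ⊆
          univ.biUnion fun i => Fintype.piFinset (Function.update P i (used i)) := by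
        intro x hx
        simp only [mem_filter, not_forall, not_not] at hx
        obtain ⟨hxR, i, hi⟩ := hx
        have hxP := Fintype.mem_piFinset.1 (hRP hxR)
        refine mem_biUnion.2 ⟨i, mem_univ _, Fintype.mem_piFinset.2 fun j => ?_⟩
        by_cases hji : j = i
        · subst hji; simpa using hi
        · simpa [hji] using hxP j
      have hone : ∀ i, (#(Fintype.piFinset (Function.update P i (used i))) : ℝ) ≤
          d / (2 * Fintype.card I) * ∏ i, (#(P i) : ℝ) := fun i => by
        rw [Fintype.card_piFinset]
        push_cast
        rw [← mul_prod_erase univ _ (mem_univ i), ← mul_prod_erase univ _ (mem_univ i),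
          Function.update_self, ← mul_assoc]
        rw [prod_congr rfl fun j hj => by
          rw [Function.update_of_ne (ne_of_mem_erase hj)]]
        exact mul_le_mul_of_nonneg_right (hused i) (prod_nonneg fun _ _ => by positivity)
      calc (#{x ∈ R | ¬ ∀ i, x i ∉ used i} : ℝ)
          ≤ ∑ i, (#(Fintype.piFinset (Function.update P i (used i))) : ℝ) := by
            exact_mod_cast (card_le_card hsub).trans card_biUnion_le
        _ ≤ ∑ i : I, d / (2 * Fintype.card I) * ∏ i, (#(P i) : ℝ) := sum_le_sum fun i _ => hone i
        _ = d / 2 * ∏ i, (#(P i) : ℝ) := by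
            rw [sum_const, card_univ, nsmul_eq_mul, mul_div_mul_cancel_aux _ _ _ (by positivity)]
    have hsplit : (#R' : ℝ) + #{x ∈ R | ¬ ∀ i, x i ∉ used i} = #R := by
      exact_mod_cast card_filter_add_card_filter_not (s := R) (fun x => ∀ i, x i ∉ used i)
    have hprod : ∏ i, (#(P i \ used i) : ℝ) ≤ ∏ i, (#(P i) : ℝ) :=
      prod_le_prod (fun _ _ => by positivity) fun i _ => by
        exact_mod_cast card_le_card sdiff_subset
    obtain ⟨K', g1, g2, g3⟩ := h (fun i => P i \ used i) R' (fun i => by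
        have h' : (2 * n₀ : ℝ) ≤ #(P i) := by exact_mod_cast hP i
        have h'' : (n₀ : ℝ) ≤ #(P i \ used i) := by
          rw [hcard]; nlinarith [hused i]
        exact_mod_cast h'') (fun x hx => by
        obtain ⟨hxR, hxu⟩ := mem_filter.1 hx
        exact Fintype.mem_piFinset.2 fun i =>
          mem_sdiff.2 ⟨Fintype.mem_piFinset.1 (hRP hxR) i, hxu i⟩) (by nlinarith)
    have hKK : ∀ j < y, ∀ i, Disjoint (K j i) (K' i) := fun j hj i => by
      refine disjoint_of_subset_right (g1 i) (disjoint_of_subset_left ?_ disjoint_sdiff)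
      exact subset_biUnion_of_mem (fun j => K j i) (mem_range.2 hj)
    refine ⟨fun j => if j < y then K j else K', ?_, ?_, ?_, ?_⟩
    · intro j _ i
      dsimp only
      split_ifs with hj
      · exact h1 j hj i
      · exact (g1 i).trans sdiff_subset
    · intro j _ i
      dsimp only
      split_ifs with hj
      · exact h2 j hj i
      · exact g2 i
    · intro j hj j' hj' hjj i
      dsimp only
      split_ifs with h5 h6 h6
      · exact h3 j h5 j' h6 hjj i
      · exact hKK j h5 i
      · exact (hKK j' h6 i).symm
      · omega
    · intro j _ x
      dsimp only
      split_ifs with hj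
      · exact h4 j hj x
      · exact fun hx => (mem_filter.1 (g3 x hx)).1

/-- Counting a relation given by independent choices in sets depending on the first coordinates. -/
lemma card_dependent {V α β : Type} [DecidableEq V] [Fintype α] [Fintype β] [DecidableEq α]
    [DecidableEq β]
    (Ω : Finset (α → V)) (P : β → Finset V) (W : (α → V) → β → Finset V) (ε : ℝ) (hε : 0 ≤ ε)
    (hW : ∀ v ∈ Ω, ∀ b, ε * #(P b) ≤ #(W v b ∩ P b))
    (PA : α → Finset V) (hΩ : Ω ⊆ Fintype.piFinset PA) :
    ε ^ Fintype.card β * (#Ω * ∏ b, (#(P b) : ℝ)) ≤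
      #{x ∈ Fintype.piFinset (Sum.elim PA P) | (fun i => x (Sum.inl i)) ∈ Ω ∧
        ∀ b, x (Sum.inr b) ∈ W (fun i => x (Sum.inl i)) b} := by
  have h1 : #(Ω.sigma fun v => Fintype.piFinset fun b => W v b ∩ P b) ≤
      #{x ∈ Fintype.piFinset (Sum.elim PA P) | (fun i => x (Sum.inl i)) ∈ Ω ∧
        ∀ b, x (Sum.inr b) ∈ W (fun i => x (Sum.inl i)) b} := by
    refine card_le_card_of_injOn (fun z => Sum.elim z.1 z.2) ?_ ?_
    · rintro ⟨v, w⟩ h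
      simp only [coe_sigma, Set.mem_sigma_iff, mem_coe, Fintype.mem_piFinset, mem_inter] at h
      simp only [coe_filter, Set.mem_ofPred_eq, Fintype.mem_piFinset, Sum.elim_inl, Sum.elim_inr]
      refine ⟨?_, h.1, fun b => (h.2 b).1⟩
      rintro (i | b)
      · exact Fintype.mem_piFinset.1 (hΩ h.1) i
      · exact (h.2 b).2
    · rintro ⟨v, w⟩ - ⟨v', w'⟩ - h
      have e1 : v = v' := funext fun i => congrFun h (Sum.inl i)
      have e2 : w = w' := funext fun i => congrFun h (Sum.inr i)
      rw [e1, e2]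
  rw [card_sigma] at h1
  refine le_trans ?_ (Nat.cast_le.2 h1)
  push_cast
  calc ε ^ Fintype.card β * (#Ω * ∏ b, (#(P b) : ℝ))
      = ∑ v ∈ Ω, ∏ b, (ε * #(P b)) := by
        rw [sum_const, prod_mul_distrib, prod_const, card_univ, nsmul_eq_mul]; ring
    _ ≤ ∑ v ∈ Ω, ∏ b, (#(W v b ∩ P b) : ℝ) := sum_le_sum fun v hv =>
        prod_le_prod (fun _ _ => by positivity) fun b _ => hW v hv b
    _ = _ := by
        refine sum_congr rfl fun v _ => ?_
        rw [Fintype.card_piFinset]; push_cast; rfl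

lemma exists_two_chains {α : Type} [DecidableEq α] (r : α → α → Prop) (hr : ∀ x y, r x y → r y x)
    (h3 : ∀ x y z, x ≠ y → y ≠ z → x ≠ z → r x y ∨ r y z ∨ r x z) (s : Finset α) :
    ∃ p q : List α, p.IsChain r ∧ q.IsChain r ∧ (p ++ q).Nodup ∧ ∀ x, x ∈ p ++ q ↔ x ∈ s := by
  induction s using Finset.induction_on with
  | empty => exact ⟨[], [], by simp⟩
  | insert v s hv ih =>
    obtain ⟨p, q, hp, hq, hn, hm⟩ := ih
    have hvn : v ∉ p ++ q := fun h => hv ((hm v).1 h)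
    have key : (v :: (p ++ q)).Nodup := List.nodup_cons.2 ⟨hvn, hn⟩
    have key2 : (p ++ v :: q).Nodup := by
      rw [List.nodup_middle]; exact key
    have mem1 : ∀ x, x ∈ v :: (p ++ q) ↔ x ∈ insert v s := fun x => by
      rw [List.mem_cons, hm, mem_insert]
    have mem2 : ∀ x, x ∈ p ++ v :: q ↔ x ∈ insert v s := fun x => by
      rw [← mem1]; simp only [List.mem_append, List.mem_cons]; tauto
    match p, q with
    | [], q => exact ⟨[v], q, by simp, hq, key, mem1⟩
    | p, [] => exact ⟨p, [v], hp, by simp, key2, mem2⟩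
    | x :: p', y :: q' =>
      by_cases h1 : r v x
      · exact ⟨v :: x :: p', y :: q', List.isChain_cons_cons.2 ⟨h1, hp⟩, hq, key, mem1⟩
      by_cases h2 : r v y
      · exact ⟨x :: p', v :: y :: q', hp, List.isChain_cons_cons.2 ⟨h2, hq⟩, key2, mem2⟩
      have hxy : r x y := by
        have hvx : v ≠ x := fun h => hvn (by simp [h])
        have hvy : v ≠ y := fun h => hvn (by simp [h])
        have hxy : x ≠ y := by
          rintro rfl
          simp at hn
        rcases h3 v x y hvx hxy hvy with h | h | h
        · exact absurd h h1
        · exact h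
        · exact absurd h h2
      have hperm : ((x :: p').reverse ++ y :: q') ++ [v] |>.Perm (v :: (x :: p' ++ y :: q')) := by
        refine (List.perm_append_singleton _ _).trans (List.Perm.cons _ ?_)
        exact (List.reverse_perm _).append_right _
      refine ⟨(x :: p').reverse ++ y :: q', [v], ?_, by simp, (hperm.nodup_iff).2 key, fun z => ?_⟩
      · rw [List.isChain_append]
        refine ⟨?_, hq, ?_⟩
        · rw [List.isChain_reverse]
          exact hp.imp fun a b h => hr _ _ h
        · simpa using hxy
      · rw [hperm.mem_iff]; exact mem1 z

/-- A full list without repetition, as a bijection. -/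
lemma exists_equiv_of_list {k : ℕ} (m : List (Fin k)) (hn : m.Nodup) (hm : ∀ x, x ∈ m) :
    ∃ (hl : m.length = k) (σ : Fin k ≃ Fin k), ∀ i, σ i = m[(i : ℕ)]'(by rw [hl]; exact i.2) := by
  have hl : m.length = k := by
    have h1 := List.toFinset_card_of_nodup hn
    have h2 : m.toFinset = univ := by ext x; simp [hm]
    rw [h2] at h1; simpa using h1.symm
  refine ⟨hl, (finCongr hl.symm).trans (hn.getEquivOfForallMemList m hm), fun i => ?_⟩
  simp

/-- A graph on `Fin k` with independence number at most two has an ordering of the vertices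
with at most one non-adjacent pair of neighbours. -/
lemma exists_ordering {k : ℕ} (r : Fin k → Fin k → Prop) (hr : ∀ x y, r x y → r y x)
    (h3 : ∀ x y z, x ≠ y → y ≠ z → x ≠ z → r x y ∨ r y z ∨ r x z) :
    ∃ (σ : Fin k ≃ Fin k) (e : ℕ), ∀ i : ℕ, ∀ h : i + 1 < k, i ≠ e →
      r (σ ⟨i, by omega⟩) (σ ⟨i + 1, h⟩) := by
  obtain ⟨p, q, hp, hq, hn, hm⟩ := exists_two_chains r hr h3 univ
  obtain ⟨hl, σ, hσ⟩ := exists_equiv_of_list (p ++ q) hn fun x => (hm x).2 (mem_univ _)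
  rw [List.isChain_iff_getElem] at hp hq
  rw [List.length_append] at hl
  refine ⟨σ, p.length - 1, fun i h hi => ?_⟩
  rw [hσ, hσ]
  simp only
  by_cases h1 : i + 1 < p.length
  · rw [List.getElem_append_left (by omega), List.getElem_append_left (by omega)]
    exact hp i h1
  · rw [List.getElem_append_right (by omega), List.getElem_append_right (by omega)]
    have := hq (i - p.length) (by omega)
    convert this using 2
    omega

/-- The combinatorial data of `F(K, G)` for `G` a union of paths: class sizes, and pendant
vertices attached at positions of a linear order of the classes. -/
structure Patt (k : ℕ) (L : Type) [Fintype L] where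
  a : Fin k → ℕ
  M : ℕ
  s : ℕ
  p : L → Fin k
  q : L → Fin k
  ord : Fin k ≃ Fin k
  pos : L → ℕ
  hk : 3 ≤ k
  hL : Fintype.card L ≤ k - 1
  a_le : ∀ i, a i ≤ M
  le_a : ∀ i, M ≤ a i + 1
  hM : 5 * k ≤ M
  hs : s = Fintype.card L + ∑ i, a i
  pos_inj : Function.Injective pos
  pos_lt : ∀ l, pos l + 1 < k
  p_eq : ∀ l, p l = ord ⟨pos l, (Nat.lt_succ_self _).trans (pos_lt l)⟩
  q_eq : ∀ l, q l = ord ⟨pos l + 1, pos_lt l⟩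

lemma Patt.exists_assignment {k : ℕ} {L : Type} [Fintype L] (P : Patt k L)
    (r : Fin k → Fin k → Prop) (hr : ∀ x y, r x y → r y x)
    (h3 : ∀ x y z, x ≠ y → y ≠ z → x ≠ z → r x y ∨ r y z ∨ r x z) :
    ∃ (σ : Fin k ≃ Fin k) (o : Option L), ∀ l, some l ≠ o → r (σ (P.p l)) (σ (P.q l)) := by
  classical
  obtain ⟨σ, e, h⟩ := exists_ordering r hr h3
  have key : ∀ l, P.pos l ≠ e → r ((P.ord.symm.trans σ) (P.p l)) ((P.ord.symm.trans σ) (P.q l)) :=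
    fun l hl => by
      rw [P.p_eq, P.q_eq]
      simpa using h (P.pos l) (P.pos_lt l) hl
  by_cases he : ∃ l, P.pos l = e
  · obtain ⟨l₀, hl₀⟩ := he
    refine ⟨P.ord.symm.trans σ, some l₀, fun l hl => key l fun h' => hl ?_⟩
    rw [P.pos_inj (h'.trans hl₀.symm)]
  · push Not at he
    exact ⟨P.ord.symm.trans σ, none, fun l _ => key l (he l)⟩

lemma exists_append_of_mem_zip_tail {α : Type} (x y : α) : ∀ l : List α, (x, y) ∈ l.zip l.tail →
    ∃ s t, l = s ++ x :: y :: t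
  | [], h => by simp at h
  | [a], h => by simp at h
  | a :: b :: l, h => by
    rw [List.tail_cons, List.zip_cons_cons, List.mem_cons] at h
    rcases h with h | h
    · obtain ⟨rfl, rfl⟩ := Prod.mk.inj h
      exact ⟨[], l, rfl⟩
    · obtain ⟨s, t, hst⟩ := exists_append_of_mem_zip_tail x y (b :: l) h
      exact ⟨a :: s, t, by rw [hst]; rfl⟩

lemma exists_order_of_paths {k : ℕ} (G : SimpleGraph (Fin k)) (hG : IsUnionOfPaths k G) :
    ∃ ord : Fin k ≃ Fin k, ∀ e ∈ G.edgeSet, ∃ (i : ℕ) (hi : i + 1 < k),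
      e = s(ord ⟨i, by omega⟩, ord ⟨i + 1, hi⟩) := by
  obtain ⟨L, hL1, hL2, rfl⟩ := hG
  have hf : L.flatten.Nodup := by
    rw [List.nodup_flatten]
    refine ⟨hL1, hL2.imp fun h => ?_⟩
    intro a ha hb
    exact h a ha a hb rfl
  let m := L.flatten ++ (List.finRange k).filter (fun x => x ∉ L.flatten)
  have hmn : m.Nodup := by
    refine List.nodup_append.2 ⟨hf, (List.nodup_finRange k).filter _, ?_⟩
    rintro a ha b hb rfl
    simp at hb
    simp at ha
    obtain ⟨l, h1, h2⟩ := ha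
    exact hb l h1 h2
  have hmm : ∀ x, x ∈ m := fun x => by
    by_cases h : x ∈ L.flatten
    · exact List.mem_append_left _ h
    · exact List.mem_append_right _ (List.mem_filter.2 ⟨List.mem_finRange _, by simpa using h⟩)
  obtain ⟨hl, σ, hσ⟩ := exists_equiv_of_list m hmn hmm
  refine ⟨σ, fun e he => ?_⟩
  rw [pathsGraph, SimpleGraph.edgeSet_fromEdgeSet] at he
  obtain ⟨⟨l, hlL, ⟨x, y⟩, hxy, rfl⟩, -⟩ := he
  obtain ⟨s, t, hst⟩ := exists_append_of_mem_zip_tail x y l hxy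
  obtain ⟨L₁, L₂, hLL⟩ := List.append_of_mem hlL
  obtain ⟨s', t', hm'⟩ : ∃ s' t', m = s' ++ x :: y :: t' := by
    let s' := L₁.flatten ++ s
    refine ⟨s', t ++ (L₂.flatten ++ (List.finRange k).filter
      (fun x => x ∉ L.flatten)), ?_⟩
    have : L.flatten = L₁.flatten ++ (s ++ x :: y :: t) ++ L₂.flatten := by
      rw [hLL, hst]; simp
    have h2 : ∀ z, L.flatten ++ z = s' ++ x :: y :: (t ++ (L₂.flatten ++ z)) := fun z => by
      rw [this]; simp [s']
    exact h2 _
  have hlen : s'.length + 1 < k := by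
    have h := congrArg List.length hm'
    rw [hl] at h
    simp at h
    omega
  refine ⟨s'.length, hlen, ?_⟩
  rw [hσ, hσ]
  simp [hm']

lemma exists_patt (k s : ℕ) (hk : 3 ≤ k) (hs : 5 * k ^ 2 ≤ s)
    (G : SimpleGraph (Fin k)) (a : Fin k → ℕ) (ℓ : ℕ)
    (hG : IsUnionOfPaths k G) (hEG : G.edgeSet.ncard = ℓ) (hℓk : ℓ ≤ k - 1)
    (hab : ∀ i j, |(a i : ℤ) - (a j : ℤ)| ≤ 1)
    (hsum : ℓ + ∑ i, a i = s) [Fintype G.edgeSet] :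
    ∃ P : Patt k G.edgeSet, P.a = a ∧ P.s = s ∧ P.M = univ.sup a ∧
      ∀ e : G.edgeSet, (e : Sym2 (Fin k)) = s(P.p e, P.q e) := by
  obtain ⟨ord, hord⟩ := exists_order_of_paths G hG
  choose pos hpos hpe using fun e : G.edgeSet => hord e e.2
  have : Nonempty (Fin k) := ⟨⟨0, by omega⟩⟩
  obtain ⟨i₀, -, hi₀⟩ := exists_mem_eq_sup univ univ_nonempty a
  have hcard : Fintype.card G.edgeSet = ℓ := by
    rw [← hEG, Set.ncard_eq_toFinset_card', Set.toFinset_card]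
  have hle : ∀ i, a i ≤ univ.sup a := fun i => le_sup (mem_univ i)
  refine ⟨⟨a, univ.sup a, s, fun e => ord ⟨pos e, by have := hpos e; omega⟩,
    fun e => ord ⟨pos e + 1, hpos e⟩, ord, pos, hk, by omega, hle, fun i => ?_, ?_,
    by omega, ?_, hpos, fun _ => rfl, fun _ => rfl⟩, rfl, rfl, rfl, hpe⟩
  · have := abs_le.1 (hab i₀ i)
    rw [hi₀]; omega
  · have h1 : ∑ i, a i ≤ k * univ.sup a := by
      have := sum_le_card_nsmul univ a _ fun i _ => hle i
      simpa using this
    by_contra! hc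
    have h2 : k * univ.sup a ≤ k * (5 * k - 1) := Nat.mul_le_mul_left _ (by omega)
    have h3 : k * (5 * k - 1) = 5 * k ^ 2 - k := by
      rw [Nat.mul_sub]; ring_nf
    have h4 : k ≤ 5 * k ^ 2 := by nlinarith
    omega
  · intro e e' h
    apply Subtype.ext
    rw [hpe e, hpe e']
    simp only [h]

section Tiles

variable {k : ℕ} {L : Type} [Fintype L] (P : Patt k L) {V : Type} [DecidableEq V]
  (E E' : Finset (Finset V))

/-- Disjoint classes spanning a blow-up of `F(K, G)`, the core edges being in `E'` and the
pendant edges in `E`. -/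
def HostF (Q : Fin k ⊕ L → Finset V) : Prop :=
  (∀ c c', c ≠ c' → Disjoint (Q c) (Q c')) ∧
  (∀ x : Fin k → V, (∀ i, x i ∈ Q (Sum.inl i)) → univ.image x ∈ E') ∧
  ∀ l, ∀ x : Fin k → V, ∀ w, (∀ i, x i ∈ Q (Sum.inl i)) → w ∈ Q (Sum.inr l) →
    insert w ((univ.erase (P.p l)).image x) ∈ E ∧ insert w ((univ.erase (P.q l)).image x) ∈ E

/-- Disjoint classes of a complete `k`-partite subgraph of `E'`. -/
def HostE (B : Fin k → Finset V) : Prop :=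
  (∀ c c', c ≠ c' → Disjoint (B c) (B c')) ∧
  ∀ x : Fin k → V, (∀ i, x i ∈ B i) → univ.image x ∈ E'

def TileF (t : ℕ) (S : Finset V) : Prop :=
  ∃ Q : Fin k ⊕ L → Finset V, HostF P E E' Q ∧ (∀ i, #(Q (Sum.inl i)) = P.a i * t) ∧
    (∀ l, #(Q (Sum.inr l)) = t) ∧ univ.biUnion Q = S

def TileE (t : ℕ) (S : Finset V) : Prop :=
  ∃ B : Fin k → Finset V, HostE E' B ∧ (∀ i, #(B i) = P.M * t) ∧ univ.biUnion B = S

/-- `S` is the vertex set of a tile of scale `t` and weight `v`. -/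
def Tile (t : ℕ) (S : Finset V) (v : ℝ) : Prop :=
  (TileF P E E' t S ∧ v = P.s * t) ∨ (TileE P E' t S ∧ v = 3 / 5 * (P.s * t))

/-- Some tiling of scale `t` inside `R` has total weight at least `x`. -/
def Ach (t : ℕ) (R : Finset V) (x : ℝ) : Prop :=
  ∃ (ι : Type) (_ : Fintype ι) (reg : ι → Finset V) (val : ι → ℝ),
    (∀ i, Tile P E E' t (reg i) (val i)) ∧ (∀ i j, i ≠ j → Disjoint (reg i) (reg j)) ∧
    (∀ i, reg i ⊆ R) ∧ x ≤ ∑ i, val i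

variable {P E E'}

lemma HostF.mono {Q Q' : Fin k ⊕ L → Finset V} (h : HostF P E E' Q) (hQ : ∀ c, Q' c ⊆ Q c) :
    HostF P E E' Q' :=
  ⟨fun c c' hc => disjoint_of_subset_left (hQ c) (disjoint_of_subset_right (hQ c') (h.1 c c' hc)),
    fun x hx => h.2.1 x fun i => hQ _ (hx i),
    fun l x w hx hw => h.2.2 l x w (fun i => hQ _ (hx i)) (hQ _ hw)⟩

lemma HostE.mono {B B' : Fin k → Finset V} (h : HostE E' B) (hB : ∀ c, B' c ⊆ B c) :
    HostE E' B' :=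
  ⟨fun c c' hc => disjoint_of_subset_left (hB c) (disjoint_of_subset_right (hB c') (h.1 c c' hc)),
    fun x hx => h.2 x fun i => hB _ (hx i)⟩

lemma HostF.hostE {Q : Fin k ⊕ L → Finset V} (h : HostF P E E' Q) :
    HostE E' fun i => Q (Sum.inl i) :=
  ⟨fun _ _ hc => h.1 _ _ fun h' => hc (Sum.inl_injective h'), h.2.1⟩

lemma Ach.nil (t : ℕ) (R : Finset V) {x : ℝ} (hx : x ≤ 0) : Ach P E E' t R x :=
  ⟨Empty, inferInstance, fun i => i.elim, fun i => i.elim, fun i => i.elim, fun i => i.elim,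
    fun i => i.elim, by simpa using hx⟩

lemma Ach.mono {t : ℕ} {R R' : Finset V} {x x' : ℝ} (h : Ach P E E' t R x) (hR : R ⊆ R')
    (hx : x' ≤ x) : Ach P E E' t R' x' := by
  obtain ⟨ι, _, reg, val, h1, h2, h3, h4⟩ := h
  exact ⟨ι, _, reg, val, h1, h2, fun i => (h3 i).trans hR, hx.trans h4⟩

lemma Ach.of_tile {t : ℕ} {R : Finset V} {x : ℝ} (h : Tile P E E' t R x) : Ach P E E' t R x :=
  ⟨Unit, inferInstance, fun _ => R, fun _ => x, fun _ => h, fun i j hij => (hij rfl).elim,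
    fun _ => Subset.rfl, by simp⟩

lemma Ach.union {t : ℕ} {R R' : Finset V} {x x' : ℝ} (h : Ach P E E' t R x)
    (h' : Ach P E E' t R' x') (hd : Disjoint R R') : Ach P E E' t (R ∪ R') (x + x') := by
  obtain ⟨ι, _, reg, val, h1, h2, h3, h4⟩ := h
  obtain ⟨ι', _, reg', val', h1', h2', h3', h4'⟩ := h'
  refine ⟨ι ⊕ ι', inferInstance, Sum.elim reg reg', Sum.elim val val', ?_, ?_, ?_, ?_⟩
  · rintro (i | i)
    · exact h1 i
    · exact h1' i
  · rintro (i | i) (j | j) hij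
    · exact h2 i j fun h => hij (by rw [h])
    · exact disjoint_of_subset_left (h3 i) (disjoint_of_subset_right (h3' j) hd)
    · exact (disjoint_of_subset_left (h3 j) (disjoint_of_subset_right (h3' i) hd)).symm
    · exact h2' i j fun h => hij (by rw [h])
  · rintro (i | i)
    · exact (h3 i).trans subset_union_left
    · exact (h3' i).trans subset_union_right
  · simp only [Fintype.sum_sum_type, Sum.elim_inl, Sum.elim_inr]
    linarith

lemma Ach.biUnion {t : ℕ} {J : Type} [DecidableEq J] (s : Finset J) (R : J → Finset V) (x : J → ℝ)
    (h : ∀ j ∈ s, Ach P E E' t (R j) (x j))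
    (hd : ∀ i ∈ s, ∀ j ∈ s, i ≠ j → Disjoint (R i) (R j)) :
    Ach P E E' t (s.biUnion R) (∑ j ∈ s, x j) := by
  induction s using Finset.induction_on with
  | empty => exact Ach.nil _ _ (by simp)
  | insert a s ha ih =>
    rw [biUnion_insert, sum_insert ha]
    refine (h a (mem_insert_self _ _)).union (ih (fun j hj => h j (mem_insert_of_mem hj))
      fun i hi j hj => hd i (mem_insert_of_mem hi) j (mem_insert_of_mem hj)) ?_
    rw [disjoint_biUnion_right]
    exact fun j hj => hd a (mem_insert_self _ _) j (mem_insert_of_mem hj) fun h => ha (h ▸ hj)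

lemma ach_hostE (t q : ℕ) : ∀ (B : Fin k → Finset V), HostE E' B →
    (∀ i, P.M * t * q ≤ #(B i)) →
    Ach P E E' t (univ.biUnion B) (3 / 5 * (P.s * t) * q) := by
  induction q with
  | zero => exact fun B _ _ => Ach.nil _ _ (by simp)
  | succ q ih =>
    intro B hB hc
    have : ∀ i, ∃ T ⊆ B i, #T = P.M * t := fun i =>
      exists_subset_card_eq (le_trans (by rw [Nat.mul_succ]; omega) (hc i))
    choose T hT1 hT2 using this
    have h1 := ih (fun i => B i \ T i) (hB.mono fun i => sdiff_subset) fun i => by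
      rw [card_sdiff_of_subset (hT1 i), hT2]
      have := hc i
      rw [Nat.mul_succ] at this
      omega
    have h2 : Ach P E E' t (univ.biUnion T) (3 / 5 * (P.s * t)) :=
      Ach.of_tile (Or.inr ⟨⟨T, hB.mono hT1, hT2, rfl⟩, rfl⟩)
    refine (h1.union h2 ?_).mono ?_ (by push_cast; linarith)
    · simp only [disjoint_biUnion_left, disjoint_biUnion_right]
      intro i _ j _
      by_cases hij : i = j
      · subst hij; exact sdiff_disjoint
      · exact disjoint_of_subset_left sdiff_subset
          (disjoint_of_subset_right (hT1 _) (hB.1 _ _ (by tauto)))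
    · exact union_subset (biUnion_mono fun i _ => sdiff_subset) (biUnion_mono fun i _ => hT1 i)

lemma ach_hostF (t q p : ℕ) : ∀ (Q : Fin k ⊕ L → Finset V), HostF P E E' Q →
    (∀ i, P.a i * t * p + P.M * t * q ≤ #(Q (Sum.inl i))) → (∀ l, t * p ≤ #(Q (Sum.inr l))) →
    Ach P E E' t (univ.biUnion Q) ((P.s * t) * (p + 3 / 5 * q)) := by
  induction p with
  | zero =>
    intro Q hQ hc _
    refine (ach_hostE t q _ hQ.hostE fun i => by simpa using hc i).mono ?_ (by push_cast; linarith)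
    exact biUnion_subset.2 fun i _ => subset_biUnion_of_mem Q (mem_univ _)
  | succ p ih =>
    intro Q hQ hc hd
    have : ∀ c, ∃ T ⊆ Q c, #T = Sum.elim (fun i => P.a i * t) (fun _ => t) c := by
      rintro (i | l)
      · exact exists_subset_card_eq (le_trans (by rw [Nat.mul_succ]; simp; omega) (hc i))
      · exact exists_subset_card_eq (le_trans (by rw [Nat.mul_succ]; simp) (hd l))
    choose T hT1 hT2 using this
    have h1 := ih (fun i => Q i \ T i) (hQ.mono fun i => sdiff_subset) (fun i => by
      rw [card_sdiff_of_subset (hT1 _), hT2]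
      have := hc i
      rw [Nat.mul_succ] at this
      simp only [Sum.elim_inl]
      omega) (fun l => by
      rw [card_sdiff_of_subset (hT1 _), hT2]
      have := hd l
      rw [Nat.mul_succ] at this
      simp only [Sum.elim_inr]
      omega)
    have h2 : Ach P E E' t (univ.biUnion T) (P.s * t) :=
      Ach.of_tile (Or.inl ⟨⟨T, hQ.mono hT1, fun i => hT2 _, fun l => hT2 _, rfl⟩, rfl⟩)
    refine (h1.union h2 ?_).mono ?_ (by push_cast; linarith)
    · simp only [disjoint_biUnion_left, disjoint_biUnion_right]
      intro i _ j _
      by_cases hij : i = j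
      · subst hij; exact sdiff_disjoint
      · exact disjoint_of_subset_left sdiff_subset
          (disjoint_of_subset_right (hT1 _) (hQ.1 _ _ (by tauto)))
    · exact union_subset (biUnion_mono fun i _ => sdiff_subset) (biUnion_mono fun i _ => hT1 i)

lemma TileF.card_eq {t : ℕ} {S : Finset V} (h : TileF P E E' t S) : #S = P.s * t := by
  obtain ⟨Q, hQ, h1, h2, rfl⟩ := h
  rw [card_biUnion fun c _ c' _ hc => hQ.1 c c' hc, Fintype.sum_sum_type]
  simp only [h1, h2, P.hs]
  rw [← sum_mul, sum_const, card_univ, smul_eq_mul]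
  ring

lemma TileE.card_eq {t : ℕ} {S : Finset V} (h : TileE P E' t S) : #S = k * P.M * t := by
  obtain ⟨B, hB, h1, rfl⟩ := h
  rw [card_biUnion fun c _ c' _ hc => hB.1 c c' hc]
  simp only [h1, sum_const, card_univ, Fintype.card_fin, smul_eq_mul]
  ring

lemma TileF.split {t' m : ℕ} {S : Finset V} (h : TileF P E E' (t' * m) S) :
    Ach P E E' t' S (P.s * (t' * m : ℕ)) := by
  obtain ⟨Q, hQ, h1, h2, rfl⟩ := h
  refine (ach_hostF t' 0 m Q hQ (fun i => ?_) (fun l => ?_)).mono Subset.rfl ?_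
  · rw [h1, mul_assoc]; simp
  · rw [h2]
  · push_cast; linarith

lemma TileE.split {t' m : ℕ} {S : Finset V} (h : TileE P E' (t' * m) S) :
    Ach P E E' t' S (3 / 5 * (P.s * (t' * m : ℕ))) := by
  obtain ⟨B, hB, h1, rfl⟩ := h
  refine (ach_hostE t' m B hB (fun i => ?_)).mono Subset.rfl ?_
  · rw [h1, mul_assoc]
  · push_cast; linarith

end Tiles

namespace Patt

variable {k : ℕ} {L : Type} [Fintype L] (P : Patt k L)

lemma s_le : P.s ≤ 2 * k * P.M := by
  have h1 : ∑ i, P.a i ≤ k * P.M := by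
    have := sum_le_card_nsmul univ P.a _ fun i _ => P.a_le i
    simpa using this
  have := P.hL; have := P.hs; have := P.hM; have := P.hk
  have h2 : k * 1 ≤ k * P.M := Nat.mul_le_mul_left _ (by omega)
  rw [mul_assoc]
  omega

lemma le_s : k * (P.M - 1) + Fintype.card L ≤ P.s := by
  have h1 : k * (P.M - 1) ≤ ∑ i, P.a i := by
    have := card_nsmul_le_sum univ P.a (P.M - 1) fun i _ => by have := P.le_a i; omega
    simpa using this
  have := P.hs
  omega

lemma M_ge : 15 ≤ P.M := by
  have := P.hM; have := P.hk; omega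

lemma s_pos : 0 < P.s := by
  have h := P.le_s; have := P.M_ge; have := P.hk
  have : 3 * 14 ≤ k * (P.M - 1) := Nat.mul_le_mul (by omega) (by omega)
  omega

end Patt

section Sources

variable {k : ℕ} {L : Type} [Fintype L] (P : Patt k L) {V : Type} [DecidableEq V]
  (E E' : Finset (Finset V))

/-- A tile, or an unstructured cluster of weight `0`. -/
def Part (t : ℕ) (S : Finset V) (v : ℝ) : Prop :=
  Tile P E E' t S v ∨ (#S = t ∧ v = 0)

/-- The number of vertices taken from a source in one exchange step, in units of the scale. -/
def Patt.N {k : ℕ} {L : Type} [Fintype L] (P : Patt k L) : ℕ := 2 * P.M * (P.M - 1)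

/-- From the cells `P₁`, `P₂` of the part `S` of weight `v`, one can take `N y` scale units of
vertices, `h y` of them in `P₁`, leaving a part of weight at least `v - cost y`. -/
def Src (t' : ℕ) (S : Finset V) (v cost : ℝ) (P₁ P₂ : Finset V) : Prop :=
  P₁ ⊆ S ∧ P₂ ⊆ S ∧ ∃ h ≤ P.N, (h = P.N ∨ Disjoint P₁ P₂) ∧ ∀ (y : ℕ) (K₁ K₂ : Finset V),
    K₁ ⊆ P₁ → K₂ ⊆ P₂ → #K₁ = y * h * t' → #K₂ = y * (P.N - h) * t' →
    Ach P E E' t' (S \ (K₁ ∪ K₂)) (v - cost * (P.s * t') * y)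

variable {P E E'}

lemma Src.mono_cost {t' : ℕ} {S : Finset V} {v c c' : ℝ} {P₁ P₂ : Finset V}
    (h : Src P E E' t' S v c P₁ P₂) (hc : c ≤ c') : Src P E E' t' S v c' P₁ P₂ := by
  obtain ⟨h1, h2, n, hn, h3, h4⟩ := h
  refine ⟨h1, h2, n, hn, h3, fun y K₁ K₂ a b c d => (h4 y K₁ K₂ a b c d).mono Subset.rfl ?_⟩
  gcongr

lemma ach_sdiff_hostE {t' q : ℕ} {B : Fin k → Finset V} (hB : HostE E' B) (K : Finset V)
    (h : ∀ i, P.M * t' * q + #(B i ∩ K) ≤ #(B i)) :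
    Ach P E E' t' (univ.biUnion B \ K) (3 / 5 * (P.s * t') * q) := by
  refine (ach_hostE t' q (fun i => B i \ K) (hB.mono fun _ => sdiff_subset) fun i => ?_).mono ?_
    le_rfl
  · have := card_sdiff_add_card_inter (B i) K
    have := h i
    omega
  · exact biUnion_subset.2 fun i _ => sdiff_subset_sdiff
      (subset_biUnion_of_mem B (mem_univ _)) Subset.rfl

lemma ach_sdiff_hostF {t' p q : ℕ} {Q : Fin k ⊕ L → Finset V} (hQ : HostF P E E' Q)
    (K : Finset V)
    (h : ∀ i, P.a i * t' * p + P.M * t' * q + #(Q (Sum.inl i) ∩ K) ≤ #(Q (Sum.inl i)))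
    (h' : ∀ l, t' * p + #(Q (Sum.inr l) ∩ K) ≤ #(Q (Sum.inr l))) :
    Ach P E E' t' (univ.biUnion Q \ K) (P.s * t' * (p + 3 / 5 * q)) := by
  refine (ach_hostF t' q p (fun i => Q i \ K) (hQ.mono fun _ => sdiff_subset) (fun i => ?_)
    fun l => ?_).mono ?_ le_rfl
  · have := card_sdiff_add_card_inter (Q (Sum.inl i)) K
    have := h i
    omega
  · have := card_sdiff_add_card_inter (Q (Sum.inr l)) K
    have := h' l
    omega
  · exact biUnion_subset.2 fun i _ => sdiff_subset_sdiff
      (subset_biUnion_of_mem Q (mem_univ _)) Subset.rfl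

lemma card_inter_union_le {C : Type} [DecidableEq C] {Q : C → Finset V}
    (hQ : ∀ c c', c ≠ c' → Disjoint (Q c) (Q c')) {K₁ K₂ : Finset V} {c₁ c₂ : C}
    (h1 : K₁ ⊆ Q c₁) (h2 : K₂ ⊆ Q c₂) (c : C) :
    #(Q c ∩ (K₁ ∪ K₂)) ≤ (if c = c₁ then #K₁ else 0) + (if c = c₂ then #K₂ else 0) := by
  have key : ∀ (K : Finset V) (d : C), K ⊆ Q d → #(Q c ∩ K) ≤ if c = d then #K else 0 := by
    intro K d hK
    split_ifs with hcd
    · exact card_le_card inter_subset_right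
    · rw [disjoint_iff_inter_eq_empty.1 (disjoint_of_subset_right hK (hQ c d hcd))]; simp
  rw [inter_union_distrib_left]
  exact (card_union_le _ _).trans (add_le_add (key _ _ h1) (key _ _ h2))

lemma src_cluster (t' : ℕ) (S : Finset V) : Src P E E' t' S 0 0 S S :=
  ⟨Subset.rfl, Subset.rfl, P.N, le_rfl, Or.inl rfl, fun y K₁ K₂ _ _ _ _ =>
    Ach.nil _ _ (by simp)⟩

lemma src_classE {t' m : ℕ} {B : Fin k → Finset V} (hB : HostE E' B)
    (hc : ∀ i, #(B i) = P.M * (t' * m)) (i : Fin k) :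
    Src P E E' t' (univ.biUnion B) (3 / 5 * (P.s * (t' * m : ℕ))) (2 * P.M) (B i) (B i) := by
  refine ⟨subset_biUnion_of_mem _ (mem_univ _), subset_biUnion_of_mem _ (mem_univ _), P.N, le_rfl,
    Or.inl rfl, fun y K₁ K₂ h1 h2 c1 c2 => ?_⟩
  have hM := P.M_ge
  by_cases hm : 2 * (P.M - 1) * y ≤ m
  · obtain ⟨q, rfl⟩ := Nat.exists_eq_add_of_le hm
    refine (ach_sdiff_hostE (q := q) hB (K₁ ∪ K₂) fun j => ?_).mono Subset.rfl ?_
    · refine (Nat.add_le_add_left (card_inter_union_le hB.1 h1 h2 j) _).trans ?_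
      rw [c1, c2, hc, Nat.sub_self, mul_zero, zero_mul, ite_self, add_zero]
      split_ifs
      · apply le_of_eq; rw [Patt.N]; ring
      · rw [add_zero, mul_assoc]
        exact Nat.mul_le_mul_left _ (Nat.mul_le_mul_left _ (by omega))
    · have h1M : ((P.M - 1 : ℕ) : ℝ) ≤ P.M := by exact_mod_cast Nat.sub_le _ _
      have h2 : ((P.M - 1 : ℕ) : ℝ) * (P.s * t' * y) ≤ P.M * (P.s * t' * y) :=
        mul_le_mul_of_nonneg_right h1M (by positivity)
      have h3 : (0 : ℝ) ≤ P.M * (P.s * t' * y) := by positivity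
      push_cast
      linarith
  · apply Ach.nil
    have h1 : (m : ℝ) ≤ 2 * P.M * y := by
      have : m ≤ 2 * P.M * y := (not_le.1 hm).le.trans
        (Nat.mul_le_mul_right _ (Nat.mul_le_mul_left _ (Nat.sub_le _ _)))
      exact_mod_cast this
    have h2 : (m : ℝ) * (P.s * t') ≤ 2 * P.M * y * (P.s * t') :=
      mul_le_mul_of_nonneg_right h1 (by positivity)
    have h3 : (0 : ℝ) ≤ m * (P.s * t') := by positivity
    push_cast
    linarith

lemma src_pairE {t' m : ℕ} {B : Fin k → Finset V} (hB : HostE E' B)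
    (hc : ∀ i, #(B i) = P.M * (t' * m)) (i i' : Fin k) (hi : i ≠ i') :
    Src P E E' t' (univ.biUnion B) (3 / 5 * (P.s * (t' * m : ℕ))) P.M (B i) (B i') := by
  refine ⟨subset_biUnion_of_mem _ (mem_univ _), subset_biUnion_of_mem _ (mem_univ _),
    P.M * (P.M - 1), ?_, Or.inr (hB.1 _ _ hi), fun y K₁ K₂ h1 h2 c1 c2 => ?_⟩
  · rw [Patt.N, mul_assoc]; omega
  have hM := P.M_ge
  by_cases hm : (P.M - 1) * y ≤ m
  · obtain ⟨q, rfl⟩ := Nat.exists_eq_add_of_le hm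
    refine (ach_sdiff_hostE (q := q) hB (K₁ ∪ K₂) fun j => ?_).mono Subset.rfl ?_
    · refine (Nat.add_le_add_left (card_inter_union_le hB.1 h1 h2 j) _).trans ?_
      have hN : P.N - P.M * (P.M - 1) = P.M * (P.M - 1) := by
        rw [Patt.N, mul_assoc]; omega
      rw [c1, c2, hc, hN]
      have e : P.M * (t' * ((P.M - 1) * y + q)) = P.M * t' * q + y * (P.M * (P.M - 1)) * t' := by
        ring
      rw [e]
      split_ifs with h3 h4
      · exact absurd (h3.symm.trans h4) hi
      all_goals omega
    · have h1M : ((P.M - 1 : ℕ) : ℝ) ≤ P.M := by exact_mod_cast Nat.sub_le _ _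
      have h2 : ((P.M - 1 : ℕ) : ℝ) * (P.s * t' * y) ≤ P.M * (P.s * t' * y) :=
        mul_le_mul_of_nonneg_right h1M (by positivity)
      have h3 : (0 : ℝ) ≤ P.M * (P.s * t' * y) := by positivity
      push_cast
      linarith
  · apply Ach.nil
    have h1 : (m : ℝ) ≤ P.M * y := by
      have : m ≤ P.M * y := (not_le.1 hm).le.trans (Nat.mul_le_mul_right _ (Nat.sub_le _ _))
      exact_mod_cast this
    have h2 : (m : ℝ) * (P.s * t') ≤ P.M * y * (P.s * t') :=
      mul_le_mul_of_nonneg_right h1 (by positivity)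
    have h3 : (0 : ℝ) ≤ m * (P.s * t') := by positivity
    push_cast
    linarith

lemma src_coreF [DecidableEq L] {t' m : ℕ} {Q : Fin k ⊕ L → Finset V} (hQ : HostF P E E' Q)
    (hc : ∀ i, #(Q (Sum.inl i)) = P.a i * (t' * m)) (hd : ∀ l, #(Q (Sum.inr l)) = t' * m)
    (i : Fin k) :
    Src P E E' t' (univ.biUnion Q) (P.s * (t' * m : ℕ)) (2 * P.M) (Q (Sum.inl i))
      (Q (Sum.inl i)) := by
  refine ⟨subset_biUnion_of_mem _ (mem_univ _), subset_biUnion_of_mem _ (mem_univ _), P.N, le_rfl,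
    Or.inl rfl, fun y K₁ K₂ h1 h2 c1 c2 => ?_⟩
  by_cases hm : 2 * P.M * y ≤ m
  · obtain ⟨p, rfl⟩ := Nat.exists_eq_add_of_le hm
    refine (ach_sdiff_hostF (p := p) (q := 0) hQ (K₁ ∪ K₂) (fun j => ?_) fun l => ?_).mono
      Subset.rfl ?_
    · refine (Nat.add_le_add_left (card_inter_union_le hQ.1 h1 h2 _) _).trans ?_
      rw [c1, c2, hc, Nat.sub_self]
      simp only [mul_zero, zero_mul, ite_self, add_zero]
      have h3 : P.M - 1 ≤ P.a j := by have := P.le_a j; omega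
      have h4 := Nat.mul_le_mul_right (2 * P.M * y * t') h3
      have e1 : P.a j * (t' * (2 * P.M * y + p)) =
        P.a j * t' * p + P.a j * (2 * P.M * y * t') := by ring
      have e2 : y * P.N * t' = (P.M - 1) * (2 * P.M * y * t') := by rw [Patt.N]; ring
      rw [e1, e2]
      split_ifs <;> omega
    · refine (Nat.add_le_add_left (card_inter_union_le hQ.1 h1 h2 _) _).trans ?_
      simp only [reduceCtorEq, if_false, hd]
      exact Nat.mul_le_mul_left _ (by omega)
    · push_cast
      linarith
  · apply Ach.nil
    have h1 : (m : ℝ) ≤ 2 * P.M * y := by exact_mod_cast (not_le.1 hm).le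
    have h2 : (m : ℝ) * (P.s * t') ≤ 2 * P.M * y * (P.s * t') :=
      mul_le_mul_of_nonneg_right h1 (by positivity)
    push_cast
    linarith

lemma src_pairF [DecidableEq L] {t' m : ℕ} {Q : Fin k ⊕ L → Finset V} (hQ : HostF P E E' Q)
    (hc : ∀ i, #(Q (Sum.inl i)) = P.a i * (t' * m)) (hd : ∀ l, #(Q (Sum.inr l)) = t' * m)
    (i i' : Fin k) (hi : i ≠ i') :
    Src P E E' t' (univ.biUnion Q) (P.s * (t' * m : ℕ)) P.M (Q (Sum.inl i))
      (Q (Sum.inl i')) := by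
  refine ⟨subset_biUnion_of_mem _ (mem_univ _), subset_biUnion_of_mem _ (mem_univ _),
    P.M * (P.M - 1), ?_, Or.inr (hQ.1 _ _ fun h => hi (Sum.inl_injective h)),
    fun y K₁ K₂ h1 h2 c1 c2 => ?_⟩
  · rw [Patt.N, mul_assoc]; omega
  have hN : P.N - P.M * (P.M - 1) = P.M * (P.M - 1) := by
    rw [Patt.N, mul_assoc]; omega
  by_cases hm : P.M * y ≤ m
  · obtain ⟨p, rfl⟩ := Nat.exists_eq_add_of_le hm
    refine (ach_sdiff_hostF (p := p) (q := 0) hQ (K₁ ∪ K₂) (fun j => ?_) fun l => ?_).mono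
      Subset.rfl ?_
    · refine (Nat.add_le_add_left (card_inter_union_le hQ.1 h1 h2 _) _).trans ?_
      rw [c1, c2, hc, hN, mul_zero, add_zero]
      have h3 : P.M - 1 ≤ P.a j := by have := P.le_a j; omega
      have h4 := Nat.mul_le_mul_right (P.M * y * t') h3
      have e1 : P.a j * (t' * (P.M * y + p)) = P.a j * t' * p + P.a j * (P.M * y * t') := by ring
      have e2 : y * (P.M * (P.M - 1)) * t' = (P.M - 1) * (P.M * y * t') := by ring
      rw [e1, e2]
      split_ifs with h3 h4
      · exact absurd (Sum.inl_injective (h3.symm.trans h4)) hi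
      all_goals omega
    · refine (Nat.add_le_add_left (card_inter_union_le hQ.1 h1 h2 _) _).trans ?_
      simp only [reduceCtorEq, if_false, hd]
      exact Nat.mul_le_mul_left _ (by omega)
    · push_cast
      linarith
  · apply Ach.nil
    have h1 : (m : ℝ) ≤ P.M * y := by exact_mod_cast (not_le.1 hm).le
    have h2 : (m : ℝ) * (P.s * t') ≤ P.M * y * (P.s * t') :=
      mul_le_mul_of_nonneg_right h1 (by positivity)
    push_cast
    linarith

lemma src_pendF [DecidableEq L] {t' m : ℕ} (ht' : 0 < t') {Q : Fin k ⊕ L → Finset V}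
    (hQ : HostF P E E' Q)
    (hc : ∀ i, #(Q (Sum.inl i)) = P.a i * (t' * m)) (hd : ∀ l, #(Q (Sum.inr l)) = t' * m)
    (l l' : L) (hl : l ≠ l') :
    Src P E E' t' (univ.biUnion Q) (P.s * (t' * m : ℕ)) ((P.M - 1) * (2 * P.M + 3) / 5)
      (Q (Sum.inr l)) (Q (Sum.inr l')) := by
  refine ⟨subset_biUnion_of_mem _ (mem_univ _), subset_biUnion_of_mem _ (mem_univ _),
    P.M * (P.M - 1), ?_, Or.inr (hQ.1 _ _ fun h => hl (Sum.inr_injective h)),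
    fun y K₁ K₂ h1 h2 c1 c2 => ?_⟩
  · rw [Patt.N, mul_assoc]; omega
  have hN : P.N - P.M * (P.M - 1) = P.M * (P.M - 1) := by
    rw [Patt.N, mul_assoc]; omega
  have hm : P.M * (P.M - 1) * y ≤ m := by
    have := card_le_card h1
    rw [c1, hd] at this
    refine Nat.le_of_mul_le_mul_left (le_trans (le_of_eq ?_) this) ht'
    ring
  obtain ⟨p, rfl⟩ := Nat.exists_eq_add_of_le hm
  refine (ach_sdiff_hostF (p := p) (q := y * (P.M - 1) ^ 2) hQ (K₁ ∪ K₂) (fun j => ?_)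
    fun j => ?_).mono Subset.rfl ?_
  · refine (Nat.add_le_add_left (card_inter_union_le hQ.1 h1 h2 _) _).trans ?_
    simp only [reduceCtorEq, if_false, hc]
    have h3 : P.M - 1 ≤ P.a j := by have := P.le_a j; omega
    have h4 := Nat.mul_le_mul_right (P.M * (P.M - 1) * y * t') h3
    have e1 : P.a j * (t' * (P.M * (P.M - 1) * y + p)) =
      P.a j * t' * p + P.a j * (P.M * (P.M - 1) * y * t') := by ring
    have e2 : P.M * t' * (y * (P.M - 1) ^ 2) = (P.M - 1) * (P.M * (P.M - 1) * y * t') := by ring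
    rw [e1, e2]
    omega
  · refine (Nat.add_le_add_left (card_inter_union_le hQ.1 h1 h2 _) _).trans ?_
    rw [c1, c2, hd, hN]
    have e1 : t' * (P.M * (P.M - 1) * y + p) = t' * p + y * (P.M * (P.M - 1)) * t' := by ring
    rw [e1]
    split_ifs with h3 h4
    · exact absurd (Sum.inr_injective (h3.symm.trans h4)) hl
    all_goals omega
  · have := P.M_ge
    push_cast [Nat.cast_sub (by omega : 1 ≤ P.M)]
    apply le_of_eq
    ring

end Sources

lemma exists_pair {C : Type} [Fintype C] [DecidableEq C] (w m : C → ℝ) (T η : ℝ) (hT : 0 ≤ T)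
    (hη : 0 ≤ η) (hm : ∀ c, 0 ≤ m c) (hw : ∀ c, w c ≤ T) (h : T + η * ∑ c, m c < ∑ c, w c) :
    ∃ c c', c ≠ c' ∧ η * m c ≤ w c ∧ η * m c' ≤ w c' := by
  by_contra! hcon
  by_cases h0 : ∃ c₀, η * m c₀ ≤ w c₀
  · obtain ⟨c₀, hc₀⟩ := h0
    rw [← add_sum_erase univ w (mem_univ c₀), ← add_sum_erase univ m (mem_univ c₀)] at h
    have h1 : ∑ c ∈ univ.erase c₀, w c ≤ ∑ c ∈ univ.erase c₀, η * m c :=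
      sum_le_sum fun c hc => (hcon c₀ c (ne_of_mem_erase hc).symm hc₀).le
    rw [← mul_sum] at h1
    have := hw c₀
    have := mul_nonneg hη (hm c₀)
    linarith
  · push Not at h0
    have h1 : ∑ c, w c ≤ ∑ c, η * m c := sum_le_sum fun c _ => (h0 c).le
    rw [← mul_sum] at h1
    linarith

lemma card_inter_biUnion {C V : Type} [Fintype C] [DecidableEq V] (W : Finset V)
    (Q : C → Finset V) (hQ : ∀ c c', c ≠ c' → Disjoint (Q c) (Q c')) :
    #(W ∩ univ.biUnion Q) = ∑ c, #(W ∩ Q c) := by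
  rw [inter_biUnion, card_biUnion]
  exact fun c _ c' _ hc => disjoint_of_subset_left inter_subset_right
    (disjoint_of_subset_right inter_subset_right (hQ c c' hc))

lemma exists_dense_cell {C V Ω : Type} [Fintype C] [DecidableEq V] (Ωs : Finset Ω)
    (W : Ω → Finset V) (Q : C → Finset V) (δ : ℝ) (hC : Nonempty C)
    (h : δ * (∑ c, (#(Q c) : ℝ)) * #Ωs ≤ ∑ ω ∈ Ωs, ∑ c, (#(W ω ∩ Q c) : ℝ)) :
    ∃ c, δ * #(Q c) * #Ωs ≤ ∑ ω ∈ Ωs, (#(W ω ∩ Q c) : ℝ) := by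
  rw [sum_comm, mul_sum, sum_mul] at h
  obtain ⟨c, -, hc⟩ := exists_le_of_sum_le univ_nonempty h
  exact ⟨c, hc⟩

lemma exists_common_pair {C Ω : Type} [Fintype C] [DecidableEq C] (Ωs : Finset Ω)
    (hne : Ωs.Nonempty) (r : Ω → C → Prop)
    (h : ∀ ω ∈ Ωs, ∃ c c', c ≠ c' ∧ r ω c ∧ r ω c') :
    ∃ c c', c ≠ c' ∧ ∃ Ω₁ ⊆ Ωs, (#Ωs : ℝ) / (Fintype.card C) ^ 2 ≤ #Ω₁ ∧
      ∀ ω ∈ Ω₁, r ω c ∧ r ω c' := by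
  classical
  obtain ⟨ω₀, hω₀⟩ := hne
  obtain ⟨c₀, c₀', -⟩ := h ω₀ hω₀
  have hch : ∀ ω, ∃ z : C × C, ω ∈ Ωs → z.1 ≠ z.2 ∧ r ω z.1 ∧ r ω z.2 := fun ω => by
    by_cases hω : ω ∈ Ωs
    · obtain ⟨c, c', h'⟩ := h ω hω
      exact ⟨(c, c'), fun _ => h'⟩
    · exact ⟨(c₀, c₀'), fun h' => absurd h' hω⟩
  choose z hz using hch
  obtain ⟨⟨c, c'⟩, -, hcc⟩ := pigeonhole Ωs univ z (fun _ _ => mem_univ _) ⟨ω₀, hω₀⟩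
  rw [card_univ, Fintype.card_prod, Nat.cast_mul, ← sq] at hcc
  by_cases he : {ω ∈ Ωs | z ω = (c, c')}.Nonempty
  · obtain ⟨ω₁, h₁⟩ := he
    have h2 := mem_filter.1 h₁
    have h3 := (hz ω₁ h2.1).1
    rw [h2.2] at h3
    refine ⟨c, c', h3, _, filter_subset _ _, hcc, fun ω hω => ?_⟩
    have h4 := mem_filter.1 hω
    have h5 := (hz ω h4.1).2
    rwa [h4.2] at h5
  · rw [not_nonempty_iff_eq_empty] at he
    rw [he] at hcc
    have h1 : (0 : ℝ) < #Ωs := by exact_mod_cast card_pos.2 ⟨ω₀, hω₀⟩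
    have h2 : (0 : ℝ) < Fintype.card C := by exact_mod_cast Fintype.card_pos_iff.2 ⟨c₀⟩
    have : (0 : ℝ) < #Ωs / (Fintype.card C) ^ 2 := by positivity
    simp at hcc
    linarith

/-- Some part outside `X` meets the sets `W ω` in more than their average density. -/
lemma exists_dense_part {V κ Ω : Type} [Fintype V] [DecidableEq V] [Fintype κ] [DecidableEq κ]
    (reg : κ → Finset V) (hdis : ∀ A A', A ≠ A' → Disjoint (reg A) (reg A')) (t : ℕ)
    (hcov : Fintype.card V ≤ ∑ A, #(reg A) + t) (X : Finset κ) (Ωs : Finset Ω)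
    (hne : Ωs.Nonempty)
    (W : Ω → Finset V) (β γ : ℝ) (hβ : 0 ≤ β) (hγ : 0 < γ) (hV : 0 < Fintype.card V)
    (hX : ∑ A ∈ X, (#(reg A) : ℝ) + t ≤ γ / 2 * Fintype.card V)
    (hW : ∀ ω ∈ Ωs, (β + γ) * Fintype.card V ≤ #(W ω)) :
    ∃ A ∉ X, (β + γ / 2) * #(reg A) * #Ωs ≤ ∑ ω ∈ Ωs, (#(W ω ∩ reg A) : ℝ) := by
  have hΩ : (0 : ℝ) < #Ωs := by exact_mod_cast card_pos.2 hne
  have hVr : (0 : ℝ) < Fintype.card V := by exact_mod_cast hV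
  have hbi : ∀ Y : Finset κ, #(Y.biUnion reg) = ∑ A ∈ Y, #(reg A) := fun Y =>
    card_biUnion fun A _ A' _ h => hdis A A' h
  have key : ∀ ω ∈ Ωs, (β + γ / 2) * Fintype.card V ≤ ∑ A ∈ Xᶜ, (#(W ω ∩ reg A) : ℝ) := by
    intro ω hω
    have h1 : #(W ω) ≤ ∑ A ∈ Xᶜ, #(W ω ∩ reg A) + #((Xᶜ.biUnion reg)ᶜ) := by
      have : ∑ A ∈ Xᶜ, #(W ω ∩ reg A) = #(W ω ∩ Xᶜ.biUnion reg) := by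
        rw [inter_biUnion, card_biUnion]
        exact fun c _ c' _ hc => disjoint_of_subset_left inter_subset_right
          (disjoint_of_subset_right inter_subset_right (hdis c c' hc))
      rw [this]
      refine le_trans (card_le_card ?_) (card_union_le _ _)
      intro v hv
      by_cases h : v ∈ Xᶜ.biUnion reg
      · exact mem_union_left _ (mem_inter.2 ⟨hv, h⟩)
      · exact mem_union_right _ (mem_compl.2 h)
    have h2 : #((Xᶜ.biUnion reg)ᶜ) ≤ ∑ A ∈ X, #(reg A) + t := by
      have h3 := sum_add_sum_compl X fun A => #(reg A)
      rw [card_compl, hbi]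
      omega
    have h3 : (#(W ω) : ℝ) ≤ ∑ A ∈ Xᶜ, (#(W ω ∩ reg A) : ℝ) + (∑ A ∈ X, (#(reg A) : ℝ) + t) := by
      exact_mod_cast h1.trans (Nat.add_le_add_left h2 _)
    have := hW ω hω
    linarith
  by_contra! hcon
  have h1 : (β + γ / 2) * Fintype.card V * #Ωs ≤ ∑ A ∈ Xᶜ, ∑ ω ∈ Ωs, (#(W ω ∩ reg A) : ℝ) := by
    rw [sum_comm]
    have := card_nsmul_le_sum Ωs _ _ key
    rw [nsmul_eq_mul] at this
    linarith
  have h2 : ∑ A ∈ Xᶜ, ∑ ω ∈ Ωs, (#(W ω ∩ reg A) : ℝ) ≤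
      ∑ A ∈ Xᶜ, (β + γ / 2) * #(reg A) * #Ωs :=
    sum_le_sum fun A hA => (hcon A (mem_compl.1 hA)).le
  have h3 : ∑ A ∈ Xᶜ, (#(reg A) : ℝ) ≤ Fintype.card V := by
    have := hbi Xᶜ
    have h4 := card_le_univ (Xᶜ.biUnion reg)
    rw [this] at h4
    exact_mod_cast h4
  rcases Xᶜ.eq_empty_or_nonempty with he | hn
  · rw [he, sum_empty] at h1
    have : 0 < (β + γ / 2) * Fintype.card V * #Ωs := by positivity
    linarith
  · have h2' : ∑ A ∈ Xᶜ, ∑ ω ∈ Ωs, (#(W ω ∩ reg A) : ℝ) <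
      ∑ A ∈ Xᶜ, (β + γ / 2) * #(reg A) * #Ωs :=
      sum_lt_sum_of_nonempty hn fun A hA => hcon A (mem_compl.1 hA)
    rw [← sum_mul, ← mul_sum] at h2'
    have : (β + γ / 2) * (∑ A ∈ Xᶜ, (#(reg A) : ℝ)) * #Ωs ≤
        (β + γ / 2) * Fintype.card V * #Ωs := by gcongr
    linarith

section Select

variable {k : ℕ} {L : Type} [Fintype L] (P : Patt k L) {V : Type} [DecidableEq V]
  (E E' : Finset (Finset V))

/-- On a proportion `c` of the tuples in `Ωs`, the sets `W ω` have density at least `ε` in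
two cells of a source inside the part `S`. -/
def Sel {Ω : Type} (t' t : ℕ) (S : Finset V) (v : ℝ) (Ωs : Finset Ω) (W : Ω → Finset V)
    (ε c cost : ℝ) : Prop :=
  ∃ P₁ P₂, Src P E E' t' S v cost P₁ P₂ ∧ t ≤ #P₁ ∧ t ≤ #P₂ ∧ ∃ Ω₁ ⊆ Ωs, c * #Ωs ≤ #Ω₁ ∧
    ∀ ω ∈ Ω₁, ε * #P₁ ≤ #(W ω ∩ P₁) ∧ ε * #P₂ ≤ #(W ω ∩ P₂)

variable {P E E'} {Ω : Type} {Ωs : Finset Ω} {W : Ω → Finset V} {γ : ℝ}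

lemma sel_of_cell {t' t : ℕ} {S P₁ : Finset V} {v cost : ℝ} (ht : 0 < t) (hγ : 0 < γ)
    (hs : Src P E E' t' S v cost P₁ P₁) (hP : t ≤ #P₁)
    (h : γ / 4 * #P₁ * #Ωs ≤ ∑ ω ∈ Ωs, (#(W ω ∩ P₁) : ℝ)) :
    Sel P E E' t' t S v Ωs W (γ / 8) (γ / (8 * k ^ 2)) cost := by
  have h1 := markov Ωs (fun ω => (#(W ω ∩ P₁) : ℝ)) (#P₁) (γ / 8) (γ / 8)
    (by exact_mod_cast lt_of_lt_of_le ht hP) (by positivity)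
    (fun ω _ => by exact_mod_cast card_le_card inter_subset_right) (by
      rw [← add_halves (γ / 4)] at h
      convert h using 4 <;> ring)
  refine ⟨P₁, P₁, hs, hP, hP, _, filter_subset _ _, le_trans ?_ h1, fun ω hω =>
    ⟨(mem_filter.1 hω).2, (mem_filter.1 hω).2⟩⟩
  gcongr
  have := P.hk
  have hk1 : (1 : ℝ) ≤ k ^ 2 := by
    exact_mod_cast Nat.one_le_pow _ _ (by omega)
  linarith

lemma patt_frac (P : Patt k L) : (1 : ℝ) ≤ (k : ℝ) ^ 2 := by
  have := P.hk
  exact_mod_cast Nat.one_le_pow _ _ (by omega)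

lemma a_pos (P : Patt k L) (i : Fin k) : 1 ≤ P.a i := by
  have := P.le_a i; have := P.M_ge; omega

lemma sel_coreE {t' m : ℕ} {B : Fin k → Finset V} (ht : 0 < t' * m) (hγ : 0 < γ)
    (hB : HostE E' B) (hc : ∀ i, #(B i) = P.M * (t' * m))
    (h : γ / 4 * #(univ.biUnion B) * #Ωs ≤ ∑ ω ∈ Ωs, (#(W ω ∩ univ.biUnion B) : ℝ)) :
    Sel P E E' t' (t' * m) (univ.biUnion B) (3 / 5 * (P.s * (t' * m : ℕ))) Ωs W (γ / 8)
      (γ / (8 * k ^ 2)) (2 * P.M) := by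
  have hk := P.hk
  rw [card_biUnion fun c _ c' _ hc => hB.1 c c' hc] at h
  simp only [card_inter_biUnion _ B hB.1] at h
  push_cast at h
  obtain ⟨i, hi⟩ := exists_dense_cell Ωs W B (γ / 4) ⟨⟨0, by omega⟩⟩ h
  exact sel_of_cell ht hγ (src_classE hB hc i)
    (by rw [hc]; exact Nat.le_mul_of_pos_left _ (by have := P.M_ge; omega)) hi

lemma sel_coreF [DecidableEq L] {t' m : ℕ} {Q : Fin k ⊕ L → Finset V} (ht : 0 < t' * m) (hγ : 0 < γ)
    (hQ : HostF P E E' Q)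
    (hc : ∀ i, #(Q (Sum.inl i)) = P.a i * (t' * m)) (hd : ∀ l, #(Q (Sum.inr l)) = t' * m)
    (h : γ / 4 * (∑ i, (#(Q (Sum.inl i)) : ℝ)) * #Ωs ≤
      ∑ ω ∈ Ωs, ∑ i, (#(W ω ∩ Q (Sum.inl i)) : ℝ)) :
    Sel P E E' t' (t' * m) (univ.biUnion Q) (P.s * (t' * m : ℕ)) Ωs W (γ / 8)
      (γ / (8 * k ^ 2)) (2 * P.M) := by
  have hk := P.hk
  obtain ⟨i, hi⟩ := exists_dense_cell Ωs W (fun i => Q (Sum.inl i)) (γ / 4) ⟨⟨0, by omega⟩⟩ h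
  exact sel_of_cell ht hγ (src_coreF hQ hc hd i)
    (by rw [hc]; exact Nat.le_mul_of_pos_left _ (a_pos P i)) hi

lemma Sel.mono_cost {t' t : ℕ} {S : Finset V} {v ε c x x' : ℝ}
    (h : Sel P E E' t' t S v Ωs W ε c x) (hx : x ≤ x') : Sel P E E' t' t S v Ωs W ε c x' := by
  obtain ⟨P₁, P₂, h1, h2⟩ := h
  exact ⟨P₁, P₂, h1.mono_cost hx, h2⟩

lemma sel_of_pair {C : Type} [Fintype C] [DecidableEq C] {t' t : ℕ} {S : Finset V} {v cost : ℝ}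
    (Q : C → Finset V) (hQ : ∀ c, t ≤ #(Q c)) (hγ : 0 < γ) (hCk : Fintype.card C ≤ k)
    (hsrc : ∀ c c', c ≠ c' → Src P E E' t' S v cost (Q c) (Q c')) {Ω₂ : Finset Ω} (h2 : Ω₂ ⊆ Ωs)
    (hne : Ωs.Nonempty) (hc : γ / 8 * #Ωs ≤ #Ω₂) (T : ℝ) (hT : 0 ≤ T) (hQT : ∀ c, (#(Q c) : ℝ) ≤ T)
    (hW : ∀ ω ∈ Ω₂, T + γ / 8 * ∑ c, (#(Q c) : ℝ) < ∑ c, (#(W ω ∩ Q c) : ℝ)) :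
    Sel P E E' t' t S v Ωs W (γ / 8) (γ / (8 * k ^ 2)) cost := by
  have hΩ : (0 : ℝ) < #Ωs := by exact_mod_cast card_pos.2 hne
  have hne2 : Ω₂.Nonempty := by
    have : (0 : ℝ) < #Ω₂ := lt_of_lt_of_le (by positivity) hc
    exact card_pos.1 (by exact_mod_cast this)
  obtain ⟨c, c', hcc, Ω₁, h3, h4, h5⟩ := exists_common_pair Ω₂ hne2
    (fun ω c => γ / 8 * #(Q c) ≤ #(W ω ∩ Q c)) fun ω hω =>
      exists_pair (fun c => (#(W ω ∩ Q c) : ℝ)) (fun c => (#(Q c) : ℝ)) T (γ / 8) hT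
        (by positivity) (fun _ => by positivity)
        (fun c => le_trans (by exact_mod_cast card_le_card inter_subset_right) (hQT c)) (hW ω hω)
  refine ⟨Q c, Q c', hsrc c c' hcc, hQ _, hQ _, Ω₁, h3.trans h2, le_trans ?_ h4, h5⟩
  have hk := patt_frac P
  have hC : (0 : ℝ) < Fintype.card C := by exact_mod_cast Fintype.card_pos_iff.2 ⟨c⟩
  have hC2 : (Fintype.card C : ℝ) ^ 2 ≤ (k : ℝ) ^ 2 := by
    have : (Fintype.card C : ℝ) ≤ k := by exact_mod_cast hCk
    gcongr
  have h8 : γ / (8 * (k : ℝ) ^ 2) * (#Ωs : ℝ) = (γ / 8 * #Ωs) / (k : ℝ) ^ 2 := by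
    rw [← div_div]; ring
  rw [h8]
  refine le_trans (div_le_div_of_nonneg_right hc (by positivity)) ?_
  exact div_le_div_of_nonneg_left (by positivity) (by positivity) hC2

end Select

section SelectPart

variable {k : ℕ} {L : Type} [Fintype L] {P : Patt k L} {V : Type} [DecidableEq V]
  {E E' : Finset (Finset V)} {Ω : Type} {Ωs : Finset Ω} {W : Ω → Finset V} {γ : ℝ} {t' m : ℕ}
  {S : Finset V} {v : ℝ}

lemma two_mul_le_pend_cost (P : Patt k L) :
    2 * (P.M : ℝ) ≤ (P.M - 1) * (2 * P.M + 3) / 5 := by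
  have : (15 : ℝ) ≤ P.M := by exact_mod_cast P.M_ge
  nlinarith

lemma sum_core_pend {t : ℕ} {Q : Fin k ⊕ L → Finset V} (hQ : HostF P E E' Q)
    (hc : ∀ i, #(Q (Sum.inl i)) = P.a i * t) (hd : ∀ l, #(Q (Sum.inr l)) = t) :
    ((#(univ.biUnion Q) : ℝ) = P.s * t) ∧
    (∀ w : Finset V, (#(w ∩ univ.biUnion Q) : ℝ) =
      ∑ i, (#(w ∩ Q (Sum.inl i)) : ℝ) + ∑ l, (#(w ∩ Q (Sum.inr l)) : ℝ)) ∧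
    (∀ w : Finset V, ∑ l, (#(w ∩ Q (Sum.inr l)) : ℝ) ≤ Fintype.card L * t) ∧
    ∑ i, (#(Q (Sum.inl i)) : ℝ) ≤ P.s * t := by
  refine ⟨?_, fun w => ?_, fun w => ?_, ?_⟩
  · exact_mod_cast TileF.card_eq (P := P) (E := E) (E' := E') ⟨Q, hQ, hc, hd, rfl⟩
  · rw [card_inter_biUnion w Q hQ.1, Fintype.sum_sum_type]
    push_cast
    rfl
  · have := sum_le_card_nsmul univ (fun l => (#(w ∩ Q (Sum.inr l)) : ℝ)) t fun l _ => by
      rw [← hd l]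
      exact_mod_cast card_le_card inter_subset_right
    simpa using this
  · have h := P.hs
    simp only [hc]
    rw [h]
    push_cast
    rw [← sum_mul]
    gcongr
    have : (0 : ℝ) ≤ Fintype.card L := by positivity
    linarith

lemma sel_good [DecidableEq L] (ht : 0 < t' * m) (hγ : 0 < γ) (hp : Part P E E' (t' * m) S v)
    (h : (((k : ℝ) - 1) / P.s + γ / 2) * #S * #Ωs ≤ ∑ ω ∈ Ωs, (#(W ω ∩ S) : ℝ)) :
    Sel P E E' t' (t' * m) S v Ωs W (γ / 8) (γ / (8 * k ^ 2)) (2 * P.M) := by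
  have hk : (3 : ℝ) ≤ k := by exact_mod_cast P.hk
  have hs : (0 : ℝ) < P.s := by exact_mod_cast P.s_pos
  have h4 : γ / 4 * #S * #Ωs ≤ ∑ ω ∈ Ωs, (#(W ω ∩ S) : ℝ) := by
    refine le_trans ?_ h
    gcongr
    have : 0 ≤ ((k : ℝ) - 1) / P.s := div_nonneg (by linarith) hs.le
    linarith
  rcases hp with (⟨⟨Q, hQ, hc, hd, rfl⟩, rfl⟩ | ⟨⟨B, hB, hc, rfl⟩, rfl⟩) | ⟨hS, rfl⟩
  · obtain ⟨h1, h2, h3, h5⟩ := sum_core_pend hQ hc hd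
    refine sel_coreF ht hγ hQ hc hd ?_
    rw [h1] at h
    simp only [h2] at h
    rw [sum_add_distrib] at h
    have h6 : ∑ ω ∈ Ωs, ∑ l, (#(W ω ∩ Q (Sum.inr l)) : ℝ) ≤
        ((k : ℝ) - 1) * (t' * m : ℕ) * #Ωs := by
      have h7 := sum_le_card_nsmul Ωs _ _ fun ω _ => h3 (W ω)
      rw [nsmul_eq_mul] at h7
      have h8 : (Fintype.card L : ℝ) ≤ (k : ℝ) - 1 := by
        have := P.hL
        have hk := P.hk
        have : Fintype.card L + 1 ≤ k := by omega
        have : (Fintype.card L : ℝ) + 1 ≤ k := by exact_mod_cast this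
        linarith
      calc _ ≤ _ := h7
        _ = Fintype.card L * ((t' * m : ℕ) : ℝ) * #Ωs := by ring
        _ ≤ _ := by gcongr
    have h9 : (((k : ℝ) - 1) / P.s + γ / 2) * (P.s * (t' * m : ℕ)) * #Ωs =
        ((k : ℝ) - 1) * (t' * m : ℕ) * #Ωs + γ / 2 * (P.s * (t' * m : ℕ)) * #Ωs := by
      rw [add_mul, ← mul_assoc (_ / _), div_mul_cancel₀ _ hs.ne', add_mul]
    have h10 : γ / 4 * (∑ i, (#(Q (Sum.inl i)) : ℝ)) * #Ωs ≤
        γ / 2 * (P.s * (t' * m : ℕ)) * #Ωs :=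
      mul_le_mul_of_nonneg_right (mul_le_mul (by linarith) h5 (sum_nonneg fun _ _ => by simp)
        (by linarith)) (Nat.cast_nonneg _)
    linarith
  · exact sel_coreE ht hγ hB hc h4
  · refine Sel.mono_cost (sel_of_cell ht hγ (src_cluster t' S) hS.ge h4) (by positivity)

lemma sel_bad [DecidableEq L] (ht : 0 < t' * m) (hγ : 0 < γ) (hne : Ωs.Nonempty) (hp : Part P E E' (t' * m) S v)
    (h : (1 / (P.s : ℝ) + γ / 2) * #S * #Ωs ≤ ∑ ω ∈ Ωs, (#(W ω ∩ S) : ℝ)) :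
    Sel P E E' t' (t' * m) S v Ωs W (γ / 8) (γ / (8 * k ^ 2))
      ((P.M - 1) * (2 * P.M + 3) / 5) := by
  have hs : (0 : ℝ) < P.s := by exact_mod_cast P.s_pos
  have ht0 : (0 : ℝ) < (t' * m : ℕ) := by exact_mod_cast ht
  have hΩ : (0 : ℝ) < #Ωs := by exact_mod_cast card_pos.2 hne
  have h4 : γ / 4 * #S * #Ωs ≤ ∑ ω ∈ Ωs, (#(W ω ∩ S) : ℝ) := by
    refine le_trans ?_ h
    gcongr
    have : 0 ≤ 1 / (P.s : ℝ) := by positivity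
    linarith
  rcases hp with (⟨⟨Q, hQ, hc, hd, rfl⟩, rfl⟩ | ⟨⟨B, hB, hc, rfl⟩, rfl⟩) | ⟨hS, rfl⟩
  · obtain ⟨h1, h2, h3, h5⟩ := sum_core_pend hQ hc hd
    by_cases hcore : γ / 4 * (∑ i, (#(Q (Sum.inl i)) : ℝ)) * #Ωs ≤
        ∑ ω ∈ Ωs, ∑ i, (#(W ω ∩ Q (Sum.inl i)) : ℝ)
    · exact (sel_coreF ht hγ hQ hc hd hcore).mono_cost (two_mul_le_pend_cost P)
    push Not at hcore
    rw [h1] at h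
    simp only [h2] at h
    rw [sum_add_distrib] at h
    have h10 : γ / 4 * (∑ i, (#(Q (Sum.inl i)) : ℝ)) * #Ωs ≤
        γ / 4 * (P.s * (t' * m : ℕ)) * #Ωs := by gcongr
    have h9 : (1 / (P.s : ℝ) + γ / 2) * (P.s * (t' * m : ℕ)) * #Ωs =
        (t' * m : ℕ) * #Ωs + γ / 2 * (P.s * (t' * m : ℕ)) * #Ωs := by
      rw [add_mul, ← mul_assoc (_ / _), div_mul_cancel₀ _ hs.ne', add_mul, one_mul]
    have hpend : ((t' * m : ℕ) + γ / 4 * (P.s * (t' * m : ℕ))) * #Ωs ≤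
        ∑ ω ∈ Ωs, ∑ l, (#(W ω ∩ Q (Sum.inr l)) : ℝ) := by linarith
    have hL : 0 < Fintype.card L := by
      by_contra h0
      have : IsEmpty L := Fintype.card_eq_zero_iff.1 (by omega)
      simp only [univ_eq_empty, sum_empty, sum_const_zero] at hpend
      have : 0 < ((t' * m : ℕ) + γ / 4 * (P.s * (t' * m : ℕ))) * (#Ωs : ℝ) := by positivity
      linarith
    have hL0 : (0 : ℝ) < Fintype.card L := by exact_mod_cast hL
    have hLs : Fintype.card L < P.s := by
      have := P.le_s
      have : 1 ≤ k * (P.M - 1) :=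
        Nat.mul_pos (by have := P.hk; omega) (by have := P.M_ge; omega)
      omega
    have hLs' : (Fintype.card L : ℝ) < P.s := by exact_mod_cast hLs
    have hmk := markov Ωs (fun ω => ∑ l, (#(W ω ∩ Q (Sum.inr l)) : ℝ))
      (Fintype.card L * (t' * m : ℕ)) ((1 + γ * P.s / 8) / Fintype.card L)
      (γ * P.s / 8 / Fintype.card L) (by positivity) (by positivity) (fun ω _ => h3 _) (by
        refine le_trans (le_of_eq ?_) hpend
        field_simp
        ring)
    refine sel_of_pair (fun l => Q (Sum.inr l)) (fun l => (hd l).ge) hγ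
      (by have := P.hL; omega) (fun l l' hl => src_pendF (Nat.pos_of_mul_pos_right ht) hQ hc hd l l' hl)
      (filter_subset _ _) hne (le_trans ?_ hmk) (t' * m : ℕ) ht0.le (fun l => by rw [hd]) ?_
    · refine mul_le_mul_of_nonneg_right ?_ hΩ.le
      rw [le_div_iff₀ hL0]
      have := mul_le_mul_of_nonneg_left hLs'.le hγ.le
      linarith
    · intro ω hω
      refine lt_of_lt_of_le ?_ (mem_filter.1 hω).2
      simp only [hd, sum_const, card_univ, nsmul_eq_mul]
      rw [← mul_assoc, ← mul_assoc, div_mul_cancel₀ _ hL0.ne']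
      have : γ * Fintype.card L * ((t' * m : ℕ) : ℝ) < γ * P.s * (t' * m : ℕ) := by gcongr
      linarith
  · exact (sel_coreE ht hγ hB hc h4).mono_cost (two_mul_le_pend_cost P)
  · refine Sel.mono_cost (sel_of_cell ht hγ (src_cluster t' S) hS.ge h4)
      (le_trans (by positivity) (two_mul_le_pend_cost P))

lemma sel_pair [DecidableEq L] (ht : 0 < t' * m) (hγ : 0 < γ) (hne : Ωs.Nonempty) (hp : Part P E E' (t' * m) S v)
    (h : (1 / 2 + γ / 2) * #S * #Ωs ≤ ∑ ω ∈ Ωs, (#(W ω ∩ S) : ℝ)) :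
    Sel P E E' t' (t' * m) S v Ωs W (γ / 8) (γ / (8 * k ^ 2)) P.M := by
  have hs : (0 : ℝ) < P.s := by exact_mod_cast P.s_pos
  have hM : (0 : ℝ) < P.M := by have := P.M_ge; exact_mod_cast (by omega : 0 < P.M)
  have ht0 : (0 : ℝ) < (t' * m : ℕ) := by exact_mod_cast ht
  have hk : (3 : ℝ) ≤ k := by exact_mod_cast P.hk
  have h4 : γ / 4 * #S * #Ωs ≤ ∑ ω ∈ Ωs, (#(W ω ∩ S) : ℝ) := by
    refine le_trans ?_ h
    gcongr
    linarith
  rcases hp with (⟨⟨Q, hQ, hc, hd, rfl⟩, rfl⟩ | ⟨⟨B, hB, hc, rfl⟩, rfl⟩) | ⟨hS, rfl⟩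
  · obtain ⟨h1, h2, h3, h5⟩ := sum_core_pend hQ hc hd
    have hmk := markov Ωs (fun ω => (#(W ω ∩ univ.biUnion Q) : ℝ))
      (P.s * (t' * m : ℕ)) (1 / 2 + γ / 4) (γ / 4) (by positivity) (by positivity)
      (fun ω _ => by rw [← h1]; exact_mod_cast card_le_card inter_subset_right) (by
        refine le_trans (le_of_eq ?_) h
        rw [h1]
        ring)
    refine sel_of_pair (fun i => Q (Sum.inl i)) (fun i => ?_) hγ (by simp)
      (fun i i' hi => src_pairF hQ hc hd i i' hi)
      (filter_subset _ _) hne (le_trans ?_ hmk) (P.M * (t' * m : ℕ)) (by positivity) (fun i => ?_) ?_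
    · rw [hc]; exact Nat.le_mul_of_pos_left _ (a_pos P i)
    · gcongr
      norm_num
    · rw [hc]; exact_mod_cast Nat.mul_le_mul_right _ (P.a_le i)
    · intro ω hω
      have h6 := (mem_filter.1 hω).2
      rw [h2] at h6
      have h7 := h3 (W ω)
      have h8 : 2 * (P.M + Fintype.card L) ≤ P.s := by
        refine le_trans ?_ P.le_s
        have hk := P.hk
        have hM := P.hM
        have hL := P.hL
        obtain ⟨j, rfl⟩ := Nat.exists_eq_add_of_le hk
        obtain ⟨M, hM'⟩ : ∃ M, P.M = M + 1 := ⟨P.M - 1, by omega⟩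
        rw [hM', Nat.add_sub_cancel]
        have h1 : 14 + 5 * j ≤ M := by omega
        have h2 : (3 + j) * M = 2 * M + M + j * M := by ring
        have h3 : 0 ≤ j * M := Nat.zero_le _
        omega
      have h9 : 2 * ((P.M : ℝ) + Fintype.card L) ≤ P.s := by exact_mod_cast h8
      have h10 : γ / 8 * ∑ i, (#(Q (Sum.inl i)) : ℝ) ≤ γ / 8 * (P.s * (t' * m : ℕ)) := by gcongr
      have h11 : 0 < γ * (P.s * (t' * m : ℕ)) := by positivity
      have h12 := mul_le_mul_of_nonneg_right h9 ht0.le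
      linarith
  · have h1 : (#(univ.biUnion B) : ℝ) = k * P.M * (t' * m : ℕ) := by
      exact_mod_cast TileE.card_eq (P := P) (E' := E') ⟨B, hB, hc, rfl⟩
    have h2 : ∑ i, (#(B i) : ℝ) = k * P.M * (t' * m : ℕ) := by
      simp only [hc, sum_const, card_univ, nsmul_eq_mul, Fintype.card_fin]
      push_cast
      ring
    have hmk := markov Ωs (fun ω => (#(W ω ∩ univ.biUnion B) : ℝ))
      (k * P.M * (t' * m : ℕ)) (1 / 2 + γ / 4) (γ / 4) (by positivity) (by positivity)
      (fun ω _ => by rw [← h1]; exact_mod_cast card_le_card inter_subset_right) (by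
        refine le_trans (le_of_eq ?_) h
        rw [h1]
        ring)
    refine sel_of_pair B (fun i => ?_) hγ (by simp)
      (fun i i' hi => src_pairE hB hc i i' hi)
      (filter_subset _ _) hne (le_trans ?_ hmk) (P.M * (t' * m : ℕ)) (by positivity) (fun i => ?_) ?_
    · rw [hc]; exact Nat.le_mul_of_pos_left _ (by exact_mod_cast hM)
    · gcongr
      norm_num
    · rw [hc]; exact_mod_cast le_rfl
    · intro ω hω
      have h6 := (mem_filter.1 hω).2
      rw [card_inter_biUnion _ B hB.1] at h6
      push_cast at h6 ⊢
      push_cast at h2 ht0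
      rw [h2]
      have h7 : 0 < (P.M : ℝ) * (t' * m) := by positivity
      have h8 : 3 * ((P.M : ℝ) * (t' * m)) ≤ k * (P.M * (t' * m)) := by gcongr
      have h9 : 0 < γ * (k * (P.M * (t' * m))) := by positivity
      linarith
  · refine Sel.mono_cost (sel_of_cell ht hγ (src_cluster t' S) hS.ge h4) (by positivity)

end SelectPart

section Exchange

variable {k : ℕ} {L : Type} [Fintype L] {P : Patt k L} {V : Type} [DecidableEq V]
  {E E' : Finset (Finset V)} {t' : ℕ}

lemma take_source {S P₁ P₂ : Finset V} {v cost : ℝ} (hs : Src P E E' t' S v cost P₁ P₂) (y : ℕ)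
    (K₁ K₂ : ℕ → Finset V) (h1 : ∀ j < y, K₁ j ⊆ P₁) (h2 : ∀ j < y, K₂ j ⊆ P₂)
    (c1 : ∀ j < y, P.N * t' ≤ #(K₁ j)) (c2 : ∀ j < y, P.N * t' ≤ #(K₂ j))
    (d1 : ∀ j < y, ∀ j' < y, j ≠ j' → Disjoint (K₁ j) (K₁ j'))
    (d2 : ∀ j < y, ∀ j' < y, j ≠ j' → Disjoint (K₂ j) (K₂ j')) :
    ∃ D : ℕ → Finset V, (∀ j < y, D j ⊆ K₁ j ∪ K₂ j) ∧ (∀ j < y, #(D j) = P.N * t') ∧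
      (∀ j < y, ∀ j' < y, j ≠ j' → Disjoint (D j) (D j')) ∧
      Ach P E E' t' (S \ (range y).biUnion D) (v - cost * (P.s * t') * y) := by
  obtain ⟨hS1, hS2, h, hN, hor, hA⟩ := hs
  have e1 : ∀ j, ∃ T, j < y → T ⊆ K₁ j ∧ #T = h * t' := fun j => by
    by_cases hj : j < y
    · obtain ⟨T, hT⟩ := exists_subset_card_eq ((Nat.mul_le_mul_right t' hN).trans (c1 j hj))
      exact ⟨T, fun _ => hT⟩
    · exact ⟨∅, fun h => absurd h hj⟩
  have e2 : ∀ j, ∃ T, j < y → T ⊆ K₂ j ∧ #T = (P.N - h) * t' := fun j => by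
    by_cases hj : j < y
    · obtain ⟨T, hT⟩ := exists_subset_card_eq
        ((Nat.mul_le_mul_right t' (Nat.sub_le P.N h)).trans (c2 j hj))
      exact ⟨T, fun _ => hT⟩
    · exact ⟨∅, fun h => absurd h hj⟩
  choose T₁ hT₁ using e1
  choose T₂ hT₂ using e2
  have cross : ∀ j < y, ∀ j' < y, Disjoint (T₁ j) (T₂ j') := by
    intro j hj j' hj'
    rcases hor with rfl | hd
    · have : T₂ j' = ∅ := by
        rw [← card_eq_zero, (hT₂ j' hj').2]
        simp
      rw [this]
      exact disjoint_empty_right _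
    · exact disjoint_of_subset_left ((hT₁ j hj).1.trans (h1 j hj))
        (disjoint_of_subset_right ((hT₂ j' hj').1.trans (h2 j' hj')) hd)
  refine ⟨fun j => T₁ j ∪ T₂ j, fun j hj => union_subset_union (hT₁ j hj).1 (hT₂ j hj).1,
    fun j hj => ?_, fun j hj j' hj' hne => ?_, ?_⟩
  · rw [card_union_of_disjoint (cross j hj j hj), (hT₁ j hj).2, (hT₂ j hj).2, ← add_mul]
    congr 1
    omega
  · rw [disjoint_union_left, disjoint_union_right, disjoint_union_right]
    exact ⟨⟨disjoint_of_subset_left (hT₁ j hj).1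
      (disjoint_of_subset_right (hT₁ j' hj').1 (d1 j hj j' hj' hne)), cross j hj j' hj'⟩,
      (cross j' hj' j hj).symm, disjoint_of_subset_left (hT₂ j hj).1
      (disjoint_of_subset_right (hT₂ j' hj').1 (d2 j hj j' hj' hne))⟩
  · have hU : (range y).biUnion (fun j => T₁ j ∪ T₂ j) =
        (range y).biUnion T₁ ∪ (range y).biUnion T₂ := by
      ext w
      simp only [mem_biUnion, mem_union]
      constructor
      · rintro ⟨j, hj, h | h⟩
        · exact Or.inl ⟨j, hj, h⟩
        · exact Or.inr ⟨j, hj, h⟩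
      · rintro (⟨j, hj, h⟩ | ⟨j, hj, h⟩)
        · exact ⟨j, hj, Or.inl h⟩
        · exact ⟨j, hj, Or.inr h⟩
    rw [hU]
    refine hA y _ _ (biUnion_subset.2 fun j hj => ?_) (biUnion_subset.2 fun j hj => ?_) ?_ ?_
    · have hj := mem_range.1 hj
      exact (hT₁ j hj).1.trans (h1 j hj)
    · have hj := mem_range.1 hj
      exact (hT₂ j hj).1.trans (h2 j hj)
    · rw [card_biUnion fun j hj j' hj' hne => disjoint_of_subset_left (hT₁ j (mem_range.1 hj)).1
        (disjoint_of_subset_right (hT₁ j' (mem_range.1 hj')).1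
          (d1 j (mem_range.1 hj) j' (mem_range.1 hj') hne)),
        sum_congr rfl fun j hj => (hT₁ j (mem_range.1 hj)).2]
      simp [mul_assoc]
    · rw [card_biUnion fun j hj j' hj' hne => disjoint_of_subset_left (hT₂ j (mem_range.1 hj)).1
        (disjoint_of_subset_right (hT₂ j' (mem_range.1 hj')).1
          (d2 j (mem_range.1 hj) j' (mem_range.1 hj') hne)),
        sum_congr rfl fun j hj => (hT₂ j (mem_range.1 hj)).2]
      simp [mul_assoc]

lemma take_sources {J κ : Type} [Fintype J] [DecidableEq J] [DecidableEq κ] {reg : κ → Finset V}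
    {val : κ → ℝ} (hdis : ∀ A A', A ≠ A' → Disjoint (reg A) (reg A')) (A : J → κ)
    (hA : Function.Injective A) (Pc : J → Fin 2 → Finset V) (cost : J → ℝ)
    (hs : ∀ l, Src P E E' t' (reg (A l)) (val (A l)) (cost l) (Pc l 0) (Pc l 1)) (y : ℕ)
    (K : ℕ → J × Fin 2 → Finset V) (h1 : ∀ j < y, ∀ b, K j b ⊆ Pc b.1 b.2)
    (c1 : ∀ j < y, ∀ b, P.N * t' ≤ #(K j b))
    (d1 : ∀ j < y, ∀ j' < y, j ≠ j' → ∀ b, Disjoint (K j b) (K j' b)) :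
    ∃ D : ℕ → J → Finset V, (∀ j < y, ∀ l, D j l ⊆ K j (l, 0) ∪ K j (l, 1)) ∧
      (∀ j < y, ∀ l, D j l ⊆ reg (A l)) ∧
      (∀ j < y, ∀ l, #(D j l) = P.N * t') ∧
      (∀ j < y, ∀ j' < y, j ≠ j' → ∀ l, Disjoint (D j l) (D j' l)) ∧
      Ach P E E' t' ((univ : Finset J).biUnion fun l => reg (A l) \ (range y).biUnion fun j => D j l)
        (∑ l, val (A l) - (∑ l, cost l) * (P.s * t') * y) := by
  have := fun l => take_source (hs l) y (fun j => K j (l, 0)) (fun j => K j (l, 1))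
    (fun j hj => h1 j hj _) (fun j hj => h1 j hj _) (fun j hj => c1 j hj _) (fun j hj => c1 j hj _)
    (fun j hj j' hj' hne => d1 j hj j' hj' hne _) (fun j hj j' hj' hne => d1 j hj j' hj' hne _)
  choose D hD1 hD2 hD3 hD4 using this
  refine ⟨fun j l => D l j, fun j hj l => hD1 l j hj, fun j hj l => ?_, fun j hj l => hD2 l j hj,
    fun j hj j' hj' hne l => hD3 l j hj j' hj' hne, ?_⟩
  · exact (hD1 l j hj).trans (union_subset ((h1 j hj _).trans (hs l).1)
      ((h1 j hj _).trans (hs l).2.1))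
  · refine (Ach.biUnion univ _ _ (fun l _ => hD4 l) fun i _ j _ hij => ?_).mono Subset.rfl ?_
    · exact disjoint_of_subset_left sdiff_subset (disjoint_of_subset_right sdiff_subset
        (hdis _ _ fun h => hij (hA h)))
    · rw [sum_sub_distrib, ← sum_mul, ← sum_mul]

end Exchange

section Config

variable {k : ℕ} {L : Type} [Fintype L] (P : Patt k L) {V : Type} [DecidableEq V]
  (E E' : Finset (Finset V)) (t' m : ℕ) {κ : Type} [Fintype κ]

/-- A partition of almost all of `V` into parts of scale `t' * m`. -/
structure IsCfg [Fintype V] (reg : κ → Finset V) (val : κ → ℝ) : Prop where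
  part : ∀ A, Part P E E' (t' * m) (reg A) (val A)
  disj : ∀ A A', A ≠ A' → Disjoint (reg A) (reg A')
  cover : Fintype.card V ≤ ∑ A, #(reg A) + t' * m

variable {P E E' t' m} {reg : κ → Finset V} {val : κ → ℝ}

lemma Part.card_le {t : ℕ} {S : Finset V} {v : ℝ} (h : Part P E E' t S v) :
    #S ≤ 2 * k * P.M * t := by
  rcases h with (⟨h, -⟩ | ⟨h, -⟩) | ⟨h, -⟩
  · rw [h.card_eq]
    exact Nat.mul_le_mul_right _ P.s_le
  · rw [h.card_eq]
    exact Nat.mul_le_mul_right _ (by rw [mul_assoc 2]; omega)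
  · rw [h]
    refine Nat.le_mul_of_pos_left _ (Nat.mul_pos ?_ ?_)
    · have := P.hk; omega
    · have := P.M_ge; omega

/-- Sources for all indices in `J`, in distinct parts outside `X`, usable simultaneously on a
positive proportion of the tuples. -/
lemma select_seq [Fintype V] [DecidableEq κ] {J Ω : Type} [DecidableEq J] (hcfg : IsCfg P E E' t' m reg val)
    (W : J → Ω → Finset V) (cost : J → ℝ) {n ε c : ℝ} (hc : 0 < c) (r : ℕ)
    (Ω₀ : Finset Ω) (hne : Ω₀.Nonempty)
    (hsel : ∀ l (X : Finset κ), ∑ A ∈ X, (#(reg A) : ℝ) + (t' * m : ℕ) ≤ n →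
      ∀ Ωs ⊆ Ω₀, Ωs.Nonempty → ∃ A ∉ X,
        Sel P E E' t' (t' * m) (reg A) (val A) Ωs (W l) ε c (cost l))
    (X : Finset κ)
    (hX : ∑ A ∈ X, (#(reg A) : ℝ) + (r * (2 * k * P.M) + 1) * (t' * m : ℕ) ≤ n)
    (T : Finset J) (hT : #T ≤ r) :
    ∃ (A : J → κ) (Pc : J → Fin 2 → Finset V), (∀ l ∈ T, ∀ l' ∈ T, A l = A l' → l = l') ∧
      (∀ l ∈ T, A l ∉ X) ∧
      (∀ l ∈ T, Src P E E' t' (reg (A l)) (val (A l)) (cost l) (Pc l 0) (Pc l 1)) ∧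
      (∀ l ∈ T, ∀ i, t' * m ≤ #(Pc l i)) ∧
      ∃ Ω₁ ⊆ Ω₀, c ^ #T * #Ω₀ ≤ #Ω₁ ∧
        ∀ ω ∈ Ω₁, ∀ l ∈ T, ∀ i, ε * #(Pc l i) ≤ #(W l ω ∩ Pc l i) := by
  induction T using Finset.induction_on with
  | empty =>
    obtain ⟨A₀⟩ : Nonempty κ ∨ IsEmpty J := by
      by_cases h : IsEmpty J
      · exact Or.inr h
      · rw [not_isEmpty_iff] at h
        obtain ⟨l⟩ := h
        obtain ⟨A, -⟩ := hsel l X (le_trans (by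
          gcongr
          have : (0 : ℝ) ≤ (r * (2 * k * P.M)) * (t' * m : ℕ) := by positivity
          linarith) hX) Ω₀ Subset.rfl hne
        exact Or.inl ⟨A⟩
    · exact ⟨fun _ => A₀.some, fun _ _ => ∅, by simp, by simp, by simp, by simp, Ω₀, Subset.rfl,
        by simp, by simp⟩
    · exact ⟨fun l => isEmptyElim l, fun _ _ => ∅, by simp, by simp, by simp, by simp, Ω₀,
        Subset.rfl, by simp, by simp⟩
  | insert l T hl ih =>
    rw [card_insert_of_notMem hl] at hT ⊢
    obtain ⟨A, Pc, h1, h2, h3, h4, Ω₁, h5, h6, h7⟩ := ih (by omega)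
    have hΩ : (0 : ℝ) < #Ω₀ := by exact_mod_cast card_pos.2 hne
    have hΩ₁ : Ω₁.Nonempty := by
      have : (0 : ℝ) < #Ω₁ := lt_of_lt_of_le (by positivity) h6
      exact card_pos.1 (by exact_mod_cast this)
    have hX' : ∑ A ∈ X ∪ T.image A, (#(reg A) : ℝ) + (t' * m : ℕ) ≤ n := by
      have h8 : ∑ A ∈ X ∪ T.image A, #(reg A) ≤ ∑ A ∈ X, #(reg A) + ∑ A ∈ T.image A, #(reg A) := by
        rw [← sum_union_inter]; omega
      have h9 : ∑ A ∈ T.image A, #(reg A) ≤ r * (2 * k * P.M * (t' * m)) := by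
        refine (sum_le_card_nsmul _ _ _ fun A _ => (hcfg.part A).card_le).trans ?_
        rw [smul_eq_mul]
        exact Nat.mul_le_mul_right _ (card_image_le.trans (by omega))
      have h10 : ∑ A ∈ X ∪ T.image A, (#(reg A) : ℝ) ≤
          ∑ A ∈ X, (#(reg A) : ℝ) + r * (2 * k * P.M * (t' * m : ℕ)) := by
        exact_mod_cast h8.trans (Nat.add_le_add_left h9 _)
      linarith
    obtain ⟨A₁, hA₁, P₁, P₂, hsrc, hP₁, hP₂, Ω₂, hΩ₂, hc₂, hd₂⟩ := hsel l _ hX' Ω₁ h5 hΩ₁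
    rw [mem_union, mem_image, not_or] at hA₁
    have hne' : ∀ l' ∈ T, l' ≠ l := fun l' h h' => hl (h' ▸ h)
    refine ⟨Function.update A l A₁, Function.update Pc l ![P₁, P₂], ?_, ?_, ?_, ?_, Ω₂,
      hΩ₂.trans h5, ?_, ?_⟩
    · intro i hi j hj hij
      rcases mem_insert.1 hi with rfl | hi' <;> rcases mem_insert.1 hj with rfl | hj'
      · rfl
      · rw [Function.update_self, Function.update_of_ne (hne' _ hj')] at hij
        exact absurd ⟨j, hj', hij.symm⟩ hA₁.2
      · rw [Function.update_self, Function.update_of_ne (hne' _ hi')] at hij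
        exact absurd ⟨i, hi', hij⟩ hA₁.2
      · rw [Function.update_of_ne (hne' _ hi'), Function.update_of_ne (hne' _ hj')] at hij
        exact h1 i hi' j hj' hij
    · intro i hi
      rcases mem_insert.1 hi with rfl | hi'
      · rw [Function.update_self]; exact hA₁.1
      · rw [Function.update_of_ne (hne' _ hi')]; exact h2 i hi'
    · intro i hi
      rcases mem_insert.1 hi with rfl | hi'
      · simp only [Function.update_self]
        exact hsrc
      · simpa only [Function.update_of_ne (hne' _ hi')] using h3 i hi'
    · intro i hi
      rcases mem_insert.1 hi with rfl | hi'
      · simp only [Function.update_self]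
        intro j
        fin_cases j
        · exact hP₁
        · exact hP₂
      · simpa only [Function.update_of_ne (hne' _ hi')] using h4 i hi'
    · calc c ^ (#T + 1) * #Ω₀ = c * (c ^ #T * #Ω₀) := by ring
        _ ≤ c * #Ω₁ := by gcongr
        _ ≤ _ := hc₂
    · intro ω hω i hi
      rcases mem_insert.1 hi with rfl | hi'
      · simp only [Function.update_self]
        intro j
        fin_cases j
        · exact (hd₂ ω hω).1
        · exact (hd₂ ω hω).2
      · simpa only [Function.update_of_ne (hne' _ hi')] using h7 ω (hΩ₂ hω) i hi'

end Config

lemma exists_dependent_boxes (α β : Type) [Fintype α] [Fintype β] [DecidableEq α] [DecidableEq β]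
    [Nonempty α] (b : ℕ) (hb : 0 < b) (ε d : ℝ) (hε : 0 < ε) (hε1 : ε ≤ 1) (hd : 0 < d)
    (hd1 : d ≤ 1) :
    ∃ n₀ : ℕ, ∀ {V : Type} [DecidableEq V] (PA : α → Finset V) (PB : β → Finset V)
    (Ω : Finset (α → V)) (W : (α → V) → β → Finset V), Ω ⊆ Fintype.piFinset PA →
    d * ∏ i, (#(PA i) : ℝ) ≤ #Ω → (∀ v ∈ Ω, ∀ b, ε * #(PB b) ≤ #(W v b ∩ PB b)) →
    ∀ t : ℕ, n₀ ≤ t → (∀ i, t ≤ #(PA i)) → (∀ b, t ≤ #(PB b)) →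
    ∀ y : ℕ, (y * b : ℝ) ≤ ε ^ Fintype.card β * d / (2 * Fintype.card (α ⊕ β)) * t →
    ∃ K : ℕ → α ⊕ β → Finset V, (∀ j < y, ∀ i, K j (Sum.inl i) ⊆ PA i) ∧
      (∀ j < y, ∀ i, K j (Sum.inr i) ⊆ PB i) ∧ (∀ j < y, ∀ i, #(K j i) = b) ∧
      (∀ j < y, ∀ j' < y, j ≠ j' → ∀ i, Disjoint (K j i) (K j' i)) ∧
      ∀ j < y, ∀ x : α → V, (∀ i, x i ∈ K j (Sum.inl i)) →
        x ∈ Ω ∧ ∀ b, ∀ w ∈ K j (Sum.inr b), w ∈ W x b := by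
  have hd' : ε ^ Fintype.card β * d ≤ 1 :=
    mul_le_one₀ (pow_le_one₀ hε.le hε1) hd.le hd1
  obtain ⟨n₀, h⟩ := exists_boxes (α ⊕ β) b (ε ^ Fintype.card β * d) (by positivity) hd'
  refine ⟨n₀, fun {V} _ PA PB Ω W hΩ hdΩ hW t ht hA hB y hy => ?_⟩
  have hR := card_dependent Ω PB W ε hε.le hW PA hΩ
  obtain ⟨K, h1, h2, h3, h4⟩ := h (Sum.elim PA PB) _ (by
      rintro (i | i)
      · exact ht.trans (hA i)
      · exact ht.trans (hB i)) (filter_subset _ _) (by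
      refine le_trans ?_ hR
      rw [Fintype.prod_sum_type, mul_assoc, ← mul_assoc d]
      simp only [Sum.elim_inl, Sum.elim_inr]
      gcongr) y (by
      intro i
      refine hy.trans ?_
      gcongr
      rcases i with i | i
      · exact hA i
      · exact hB i)
  refine ⟨K, fun j hj i => h1 j hj (Sum.inl i), fun j hj i => h1 j hj (Sum.inr i), h2, h3,
    fun j hj x hx => ?_⟩
  have hch : ∀ c, ∃ w, w ∈ K j c := fun c => card_pos.1 (by rw [h2 j hj c]; exact hb)
  choose z hz using hch
  have key : ∀ u : β → V, (∀ c, u c ∈ K j (Sum.inr c)) → x ∈ Ω ∧ ∀ c, u c ∈ W x c := by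
    intro u hu
    have := h4 j hj (Sum.elim x u) (by
      rintro (i | i)
      · exact hx i
      · exact hu i)
    exact (mem_filter.1 this).2
  refine ⟨(key (fun c => z (Sum.inr c)) fun c => hz _).1, fun c w hw => ?_⟩
  have := (key (Function.update (fun c => z (Sum.inr c)) c w) fun c' => by
    by_cases h : c' = c
    · subst h; simpa using hw
    · simpa [h] using hz _).2 c
  simpa using this

section Neighbourhoods

variable {k : ℕ} {V : Type} [Fintype V] [DecidableEq V] (E : Finset (Finset V))

/-- The vertices extending the tuple `x` without its `i`-th entry to an edge. -/
def nb (x : Fin k → V) (i : Fin k) : Finset V :=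
  univ.filter fun w => insert w ((univ.erase i).image x) ∈ E

variable {E}

lemma mem_nb {x : Fin k → V} {i : Fin k} {w : V} :
    w ∈ nb E x i ↔ insert w ((univ.erase i).image x) ∈ E := by simp [nb]

lemma nb_comp (x : Fin k → V) (σ : Fin k ≃ Fin k) (i : Fin k) :
    nb E (x ∘ σ) i = nb E x (σ i) := by
  ext w
  rw [mem_nb, mem_nb, ← image_image]
  congr! 3
  ext j
  simp only [mem_image, mem_erase, mem_univ, and_true]
  constructor
  · rintro ⟨j', h, rfl⟩
    exact fun h' => h (σ.injective h')
  · exact fun h => ⟨σ.symm j, fun h' => h (by rw [← h']; simp), by simp⟩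

lemma card_inter_ge (A B : Finset V) {μ : ℝ} (hA : μ * Fintype.card V ≤ #A)
    (hB : μ * Fintype.card V ≤ #B) : (2 * μ - 1) * Fintype.card V ≤ #(A ∩ B) := by
  have h1 := card_union_add_card_inter A B
  have h2 := card_le_univ (A ∪ B)
  have h3 : (#A : ℝ) + #B ≤ Fintype.card V + #(A ∩ B) := by exact_mod_cast (by omega)
  linarith

lemma card_three_le (A B C : Finset V) :
    #A + #B + #C ≤ Fintype.card V + (#(A ∩ B) + #(B ∩ C) + #(A ∩ C)) := by
  have h1 := card_union_add_card_inter A B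
  have h2 := card_union_add_card_inter (A ∪ B) C
  have h3 := card_le_univ (A ∪ B ∪ C)
  have h4 : #((A ∪ B) ∩ C) ≤ #(A ∩ C) + #(B ∩ C) := by
    rw [union_inter_distrib_right]
    exact card_union_le _ _
  omega

lemma exists_pair_inter (A B C : Finset V) {μ ν : ℝ} (hA : μ * Fintype.card V ≤ #A)
    (hB : μ * Fintype.card V ≤ #B) (hC : μ * Fintype.card V ≤ #C) (hν : 3 * ν ≤ 3 * μ - 1) :
    ν * Fintype.card V ≤ #(A ∩ B) ∨ ν * Fintype.card V ≤ #(B ∩ C) ∨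
      ν * Fintype.card V ≤ #(A ∩ C) := by
  by_contra! h
  have h1 : (#A : ℝ) + #B + #C ≤ Fintype.card V + (#(A ∩ B) + #(B ∩ C) + #(A ∩ C)) := by
    exact_mod_cast card_three_le A B C
  have h2 := mul_le_mul_of_nonneg_right hν (Nat.cast_nonneg (α := ℝ) (Fintype.card V))
  linarith

end Neighbourhoods

section Colour

variable {k : ℕ} {L : Type} [Fintype L] (P : Patt k L) {V : Type} [Fintype V]
  [DecidableEq V] {E E' : Finset (Finset V)} {γ : ℝ}

lemma good_threshold (γ : ℝ) :
    3 * (((k : ℝ) - 1) / P.s + γ) ≤ 3 * (1 / 2 + 1 / (2 * P.s) + γ) - 1 := by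
  have hs : (0 : ℝ) < P.s := by exact_mod_cast P.s_pos
  have h1 : 6 * k ≤ P.s := by
    refine le_trans ?_ P.le_s
    have := P.hM; have := P.hk
    have : k * 6 ≤ k * (P.M - 1) := Nat.mul_le_mul_left _ (by omega)
    omega
  have h2 : 6 * (k : ℝ) ≤ P.s := by exact_mod_cast h1
  have h3 : ((k : ℝ) - 1) / P.s ≤ 1 / 6 := by
    rw [div_le_div_iff₀ hs (by norm_num)]
    linarith
  have h4 : 0 < 1 / (2 * (P.s : ℝ)) := by positivity
  linarith

lemma exists_colour [DecidableEq L]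
    (hN : ∀ x : Fin k → V, univ.image x ∈ E' → ∀ i,
      (1 / 2 + 1 / (2 * (P.s : ℝ)) + γ) * Fintype.card V ≤ #(nb E x i))
    {B : Fin k → Finset V} (hB : HostE E' B) (hne : ∀ i, (B i).Nonempty) :
    ∃ (σ : Fin k ≃ Fin k) (o : Option L) (Ω : Finset (Fin k → V)),
      Ω ⊆ Fintype.piFinset (fun i => B (σ i)) ∧
      (1 / Fintype.card ((Fin k ≃ Fin k) × Option L) : ℝ) * ∏ i, (#(B (σ i)) : ℝ) ≤ #Ω ∧
      ∀ x ∈ Ω, ∀ l, some l ≠ o →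
        (((k : ℝ) - 1) / P.s + γ) * Fintype.card V ≤ #(nb E x (P.p l) ∩ nb E x (P.q l)) := by
  have hcol : ∀ x : Fin k → V, ∃ z : (Fin k ≃ Fin k) × Option L, x ∈ Fintype.piFinset B →
      ∀ l, some l ≠ z.2 → (((k : ℝ) - 1) / P.s + γ) * Fintype.card V ≤
        #(nb E x (z.1 (P.p l)) ∩ nb E x (z.1 (P.q l))) := by
    intro x
    by_cases hx : x ∈ Fintype.piFinset B
    · have hx' := hN x (hB.2 x (Fintype.mem_piFinset.1 hx))
      obtain ⟨σ, o, h⟩ := P.exists_assignment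
        (fun i j => (((k : ℝ) - 1) / P.s + γ) * Fintype.card V ≤ #(nb E x i ∩ nb E x j))
        (fun i j h => by rwa [inter_comm]) fun i j l _ _ _ =>
          exists_pair_inter _ _ _ (hx' i) (hx' j) (hx' l) (good_threshold P γ)
      exact ⟨(σ, o), fun _ => h⟩
    · exact ⟨(Equiv.refl _, none), fun h => absurd h hx⟩
  choose col hcol using hcol
  obtain ⟨⟨σ, o⟩, -, hc⟩ := pigeonhole (Fintype.piFinset B) univ col (fun _ _ => mem_univ _)
    (Fintype.piFinset_nonempty.2 hne)
  refine ⟨σ, o, {x ∈ Fintype.piFinset B | col x = (σ, o)}.image fun x => x ∘ σ, ?_, ?_, ?_⟩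
  · intro x hx
    obtain ⟨x', hx', rfl⟩ := mem_image.1 hx
    have := Fintype.mem_piFinset.1 (mem_filter.1 hx').1
    exact Fintype.mem_piFinset.2 fun i => this (σ i)
  · rw [card_image_of_injective _ fun x y h => by
      ext i
      have := congrFun h (σ.symm i)
      simpa using this]
    refine le_trans (le_of_eq ?_) hc
    rw [Equiv.prod_comp σ fun i => (#(B i) : ℝ), Fintype.card_piFinset, card_univ]
    push_cast
    ring
  · intro x hx l hl
    obtain ⟨x', hx', rfl⟩ := mem_image.1 hx
    have h1 := mem_filter.1 hx'
    have := hcol x' h1.1 l (by rw [h1.2]; exact hl)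
    rw [h1.2] at this
    rwa [nb_comp, nb_comp]

end Colour

section GadgetE

variable {k : ℕ} {L : Type} [Fintype L] [DecidableEq L] {P : Patt k L} {V : Type} [DecidableEq V]
  {E E' : Finset (Finset V)} {t' m : ℕ} {κ : Type} [DecidableEq κ]
  {reg : κ → Finset V} {val : κ → ℝ}

lemma exchangeE (hdis : ∀ A A', A ≠ A' → Disjoint (reg A) (reg A')) (ht' : 0 < t') {A₀ : κ}
    {B : Fin k → Finset V} (hB : HostE E' B) (hBc : ∀ i, #(B i) = P.M * (t' * m))
    (hreg : univ.biUnion B = reg A₀) (hval : val A₀ = 3 / 5 * (P.s * (t' * m : ℕ)))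
    (A : L → κ) (hA : Function.Injective A) (hA₀ : ∀ l, A l ≠ A₀) (Pc : L → Fin 2 → Finset V)
    (cost : L → ℝ)
    (hs : ∀ l, Src P E E' t' (reg (A l)) (val (A l)) (cost l) (Pc l 0) (Pc l 1)) (y : ℕ)
    (K : ℕ → Fin k ⊕ (L × Fin 2) → Finset V) (hK1 : ∀ j < y, ∀ i, K j (Sum.inl i) ⊆ B i)
    (hK2 : ∀ j < y, ∀ b, K j (Sum.inr b) ⊆ Pc b.1 b.2)
    (hK3 : ∀ j < y, ∀ i, #(K j i) = P.M * P.N * t')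
    (hK4 : ∀ j < y, ∀ j' < y, j ≠ j' → ∀ i, Disjoint (K j i) (K j' i))
    (hK5 : ∀ j < y, ∀ x : Fin k → V, (∀ i, x i ∈ K j (Sum.inl i)) → ∀ b, ∀ w ∈ K j (Sum.inr b),
      insert w ((univ.erase (P.p b.1)).image x) ∈ E ∧
        insert w ((univ.erase (P.q b.1)).image x) ∈ E) :
    Ach P E E' t' ((insert A₀ (univ.image A)).biUnion reg)
      (val A₀ + ∑ l, val (A l) + (2 / 5 * P.N - ∑ l, cost l) * (P.s * t') * y) := by
  have hM := P.M_ge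
  obtain ⟨D, hD1, hD2, hD3, hD4, hD5⟩ := take_sources hdis A hA Pc cost hs y
    (fun j b => K j (Sum.inr b)) hK2 (fun j hj b => by
      rw [hK3 j hj, mul_assoc]; exact Nat.le_mul_of_pos_left _ (by omega)) fun j hj j' hj' hne b =>
        hK4 j hj j' hj' hne _
  have hBA : ∀ i, B i ⊆ reg A₀ := fun i => hreg ▸ subset_biUnion_of_mem B (mem_univ i)
  have hBD : ∀ j < y, ∀ j' < y, ∀ i l, Disjoint (K j (Sum.inl i)) (D j' l) :=
    fun j hj j' hj' i l => disjoint_of_subset_left ((hK1 j hj i).trans (hBA i))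
      (disjoint_of_subset_right (hD2 j' hj' l) (hdis _ _ (hA₀ l).symm))
  set Q : ℕ → Fin k ⊕ L → Finset V := fun j => Sum.elim (fun i => K j (Sum.inl i)) (D j) with hQ
  have hQQ : ∀ j < y, ∀ j' < y, ∀ c c', (j ≠ j' ∨ c ≠ c') → Disjoint (Q j c) (Q j' c') := by
    rintro j hj j' hj' (i | l) (i' | l') h
    · by_cases hi : i = i'
      · subst hi
        exact hK4 j hj j' hj' (h.resolve_right fun h => h rfl) _
      · exact disjoint_of_subset_left (hK1 j hj i)
          (disjoint_of_subset_right (hK1 j' hj' i') (hB.1 i i' hi))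
    · exact hBD j hj j' hj' i l'
    · exact (hBD j' hj' j hj i' l).symm
    · by_cases hl : l = l'
      · subst hl
        exact hD4 j hj j' hj' (h.resolve_right fun h => h rfl) _
      · exact disjoint_of_subset_left (hD2 j hj l)
          (disjoint_of_subset_right (hD2 j' hj' l') (hdis _ _ fun h => hl (hA h)))
  have hbox : ∀ j ∈ range y, Ach P E E' t' (univ.biUnion (Q j)) ((P.s * t') * P.N) := by
    intro j hj
    have hj := mem_range.1 hj
    have hhost : HostF P E E' (Q j) := by
      refine ⟨fun c c' h => hQQ j hj j hj c c' (Or.inr h),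
        fun x hx => hB.2 x fun i => hK1 j hj i (hx i), fun l x w hx hw => ?_⟩
      rcases mem_union.1 (hD1 j hj l hw) with h | h
      · exact hK5 j hj x hx (l, 0) w h
      · exact hK5 j hj x hx (l, 1) w h
    refine (ach_hostF t' 0 P.N (Q j) hhost (fun i => ?_) fun l => ?_).mono Subset.rfl ?_
    · simp only [hQ, Sum.elim_inl, hK3 j hj, mul_zero, add_zero]
      have := Nat.mul_le_mul_right (t' * P.N) (P.a_le i)
      calc P.a i * t' * P.N = P.a i * (t' * P.N) := by ring
        _ ≤ P.M * (t' * P.N) := this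
        _ = P.M * P.N * t' := by ring
    · simp only [hQ, Sum.elim_inr, hD3 j hj]
      rw [mul_comm]
    · simp
  have hboxes := Ach.biUnion (range y) _ _ hbox fun j hj j' hj' hne => by
    rw [disjoint_biUnion_left]
    intro c _
    rw [disjoint_biUnion_right]
    exact fun c' _ => hQQ j (mem_range.1 hj) j' (mem_range.1 hj') c c' (Or.inl hne)
  set KB : Finset V := (range y).biUnion fun j => univ.biUnion fun i => K j (Sum.inl i) with hKB
  have hBK : ∀ i, #(B i ∩ KB) ≤ P.M * P.N * t' * y := by
    intro i
    have : B i ∩ KB ⊆ (range y).biUnion fun j => K j (Sum.inl i) := by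
      intro w hw
      obtain ⟨hw1, hw2⟩ := mem_inter.1 hw
      obtain ⟨j, hj, hw3⟩ := mem_biUnion.1 hw2
      obtain ⟨i', -, hw4⟩ := mem_biUnion.1 hw3
      by_cases hi : i = i'
      · subst hi
        exact mem_biUnion.2 ⟨j, hj, hw4⟩
      · exact absurd (hK1 j (mem_range.1 hj) i' hw4) (disjoint_left.1 (hB.1 i i' hi) hw1)
    refine (card_le_card this).trans (card_biUnion_le.trans ?_)
    rw [sum_congr rfl fun j hj => hK3 j (mem_range.1 hj) _]
    simp [mul_comm]
  have hrest : Ach P E E' t' (reg A₀ \ KB) (val A₀ - 3 / 5 * (P.s * t') * P.N * y) := by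
    by_cases hy : y * P.N ≤ m
    · obtain ⟨q, rfl⟩ := Nat.exists_eq_add_of_le hy
      rw [← hreg]
      refine (ach_sdiff_hostE (q := q) hB KB fun i => ?_).mono Subset.rfl ?_
      · refine (Nat.add_le_add_left (hBK i) _).trans (le_of_eq ?_)
        rw [hBc]
        ring
      · rw [hval]
        push_cast
        linarith
    · refine Ach.nil _ _ ?_
      have h1 : (m : ℝ) ≤ y * P.N := by exact_mod_cast (not_le.1 hy).le
      have h2 : (0 : ℝ) ≤ 3 / 5 * (P.s * t') := by positivity
      have := mul_le_mul_of_nonneg_left h1 h2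
      rw [hval]
      push_cast
      linarith
  refine ((hrest.union hD5 ?_).union hboxes ?_).mono ?_ ?_
  · rw [disjoint_biUnion_right]
    exact fun l _ => disjoint_of_subset_left sdiff_subset
      (disjoint_of_subset_right sdiff_subset (hdis _ _ (hA₀ l).symm))
  · rw [disjoint_biUnion_right]
    intro j hj
    rw [disjoint_biUnion_right]
    rintro (i | l) -
    · rw [disjoint_union_left, disjoint_biUnion_left]
      refine ⟨disjoint_of_subset_right ?_ sdiff_disjoint, fun l _ => ?_⟩
      · exact fun w hw => mem_biUnion.2 ⟨j, hj, mem_biUnion.2 ⟨i, mem_univ _, hw⟩⟩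
      · exact disjoint_of_subset_left sdiff_subset (disjoint_of_subset_right
          ((hK1 j (mem_range.1 hj) i).trans (hBA i)) (hdis _ _ (hA₀ l)))
    · rw [disjoint_union_left, disjoint_biUnion_left]
      refine ⟨disjoint_of_subset_left sdiff_subset (disjoint_of_subset_right
          (hD2 j (mem_range.1 hj) l) (hdis _ _ (hA₀ l).symm)), fun l' _ => ?_⟩
      by_cases hl : l' = l
      · subst hl
        refine disjoint_of_subset_right ?_ sdiff_disjoint
        exact fun w hw => mem_biUnion.2 ⟨j, hj, hw⟩
      · exact disjoint_of_subset_left sdiff_subset (disjoint_of_subset_right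
          (hD2 j (mem_range.1 hj) l) (hdis _ _ fun h => hl (hA h)))
  · have hAi : ∀ l, reg (A l) ⊆ (insert A₀ (univ.image A)).biUnion reg := fun l =>
      subset_biUnion_of_mem reg (mem_insert_of_mem (mem_image_of_mem A (mem_univ l)))
    have hA0i : reg A₀ ⊆ (insert A₀ (univ.image A)).biUnion reg :=
      subset_biUnion_of_mem reg (mem_insert_self _ _)
    refine union_subset (union_subset (sdiff_subset.trans hA0i) (biUnion_subset.2 fun l _ =>
      sdiff_subset.trans (hAi l))) (biUnion_subset.2 fun j hj => biUnion_subset.2 ?_)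
    rintro (i | l) -
    · exact ((hK1 j (mem_range.1 hj) i).trans (hBA i)).trans hA0i
    · exact (hD2 j (mem_range.1 hj) l).trans (hAi l)
  · rw [sum_const, card_range, nsmul_eq_mul]
    linarith

end GadgetE

lemma exchange_gain {k : ℕ} {L : Type} [Fintype L] [DecidableEq L] (P : Patt k L) (o : Option L) :
    1 ≤ 2 / 5 * (P.N : ℝ) -
      ∑ l, (if some l = o then ((P.M : ℝ) - 1) * (2 * P.M + 3) / 5 else 2 * (P.M : ℝ)) := by
  have hpend := two_mul_le_pend_cost P
  have hM : (15 : ℝ) ≤ P.M := by exact_mod_cast P.M_ge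
  have hMk : 5 * (k : ℝ) ≤ P.M := by exact_mod_cast P.hM
  have hL : (Fintype.card L : ℝ) ≤ k - 1 := by
    have := P.hL; have := P.hk
    rw [le_sub_iff_add_le]
    exact_mod_cast (by omega : Fintype.card L + 1 ≤ k)
  have hN : (P.N : ℝ) = 2 * P.M * (P.M - 1) := by
    have := P.M_ge
    rw [Patt.N]
    push_cast [Nat.cast_sub (by omega : 1 ≤ P.M)]
    ring
  set c : ℝ := ((P.M : ℝ) - 1) * (2 * P.M + 3) / 5 with hc
  have hsum : ∑ l, (if some l = o then c else 2 * (P.M : ℝ)) ≤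
      Fintype.card L * (2 * P.M) + (c - 2 * P.M) := by
    have h1 : ∀ l, (if some l = o then c else 2 * (P.M : ℝ)) =
        2 * P.M + if some l = o then c - 2 * P.M else 0 := by
      intro l; split_ifs <;> ring
    rw [sum_congr rfl fun l _ => h1 l, sum_add_distrib, sum_const, card_univ, nsmul_eq_mul]
    refine add_le_add_right ?_ _
    rcases o with _ | l
    · simpa using hpend
    · simp
  have h2 := mul_le_mul_of_nonneg_right hL (by linarith : (0 : ℝ) ≤ 2 * P.M)
  rw [hN]
  nlinarith

lemma exists_gadgetE {k : ℕ} {L : Type} [Fintype L] [DecidableEq L] (P : Patt k L) {γ : ℝ}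
    (hγ : 0 < γ) (hγ1 : γ ≤ 1) :
    ∃ g : ℝ, 0 < g ∧ ∀ t' : ℕ, 0 < t' → ∃ m₀ : ℕ, ∀ m, m₀ ≤ m →
    ∀ {V : Type} [Fintype V] [DecidableEq V] {κ : Type} [Fintype κ] [DecidableEq κ]
    {E E' : Finset (Finset V)} {reg : κ → Finset V} {val : κ → ℝ},
    IsCfg P E E' t' m reg val →
    (∀ x : Fin k → V, univ.image x ∈ E' → ∀ i,
      (1 / 2 + 1 / (2 * (P.s : ℝ)) + γ) * Fintype.card V ≤ #(nb E x i)) →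
    ∀ (X : Finset κ) (A₀ : κ), A₀ ∉ X → TileE P E' (t' * m) (reg A₀) →
    val A₀ = 3 / 5 * (P.s * (t' * m : ℕ)) →
    ∑ A ∈ X, (#(reg A) : ℝ) + ((k + 1) * (2 * k * P.M) + 1) * (t' * m : ℕ) ≤
      γ / 2 * Fintype.card V →
    ∃ Y : Finset κ, Disjoint Y X ∧ #Y ≤ k ∧ Y.Nonempty ∧
      Ach P E E' t' (Y.biUnion reg) (∑ A ∈ Y, val A + g * (t' * m : ℕ)) := by
  have hk := P.hk
  have hM := P.M_ge
  have hs0 : (0 : ℝ) < P.s := by exact_mod_cast P.s_pos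
  have hfrac := patt_frac P
  have : Nonempty (Fin k) := ⟨⟨0, by omega⟩⟩
  have hNpos : 0 < P.N := Nat.mul_pos (by omega) (by omega)
  obtain ⟨d0, hd0⟩ : ∃ d : ℝ, d = 1 / Fintype.card ((Fin k ≃ Fin k) × Option L) := ⟨_, rfl⟩
  have hcard : 0 < Fintype.card ((Fin k ≃ Fin k) × Option L) := Fintype.card_pos
  have hd0pos : 0 < d0 := by rw [hd0]; positivity
  have hd01 : d0 ≤ 1 := by
    rw [hd0]
    exact div_le_one_of_le₀ (by exact_mod_cast hcard) (by positivity)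
  have hc0 : 0 < γ / (8 * k ^ 2) := by positivity
  have hc1 : γ / (8 * k ^ 2) ≤ 1 := div_le_one_of_le₀ (by linarith) (by positivity)
  obtain ⟨d, hd⟩ : ∃ d : ℝ, d = (γ / (8 * k ^ 2)) ^ Fintype.card L * d0 := ⟨_, rfl⟩
  have hdpos : 0 < d := by rw [hd]; positivity
  have hd1 : d ≤ 1 := by
    rw [hd]
    exact mul_le_one₀ (pow_le_one₀ hc0.le hc1) hd0pos.le hd01
  obtain ⟨R, hR⟩ : ∃ R : ℝ, R = (γ / 8) ^ Fintype.card (L × Fin 2) * d /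
    (2 * Fintype.card (Fin k ⊕ (L × Fin 2))) := ⟨_, rfl⟩
  have hI : 0 < Fintype.card (Fin k ⊕ (L × Fin 2)) := Fintype.card_pos
  have hRpos : 0 < R := by rw [hR]; positivity
  obtain ⟨ρ, hρ⟩ : ∃ ρ : ℝ, ρ = R / (P.M * P.N) := ⟨_, rfl⟩
  have hMN : (0 : ℝ) < P.M * P.N := by
    exact_mod_cast Nat.mul_pos (by omega) hNpos
  have hρpos : 0 < ρ := by rw [hρ]; positivity
  refine ⟨P.s * ρ / 2, by positivity, fun t' ht' => ?_⟩
  obtain ⟨n₀, hbox⟩ := exists_dependent_boxes (Fin k) (L × Fin 2) (P.M * P.N * t')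
    (Nat.mul_pos (Nat.mul_pos (by omega) hNpos) ht') (γ / 8) d (by linarith) (by linarith) hdpos hd1
  refine ⟨max (max n₀ 1) ⌈2 / ρ⌉₊, ?_⟩
  intro m hm V _ _ κ _ _ E E' reg val hcfg hN X A₀ hA₀ hT hv hX
  have hm1 : n₀ ≤ m := (le_max_left _ _).trans ((le_max_left _ _).trans hm)
  have hm2 : 1 ≤ m := (le_max_right _ _).trans ((le_max_left _ _).trans hm)
  have hm3 : 2 / ρ ≤ m := Nat.ceil_le.1 ((le_max_right _ _).trans hm)
  have htm : 0 < t' * m := Nat.mul_pos ht' (by omega)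
  have htmm : m ≤ t' * m := Nat.le_mul_of_pos_left _ ht'
  obtain ⟨B, hB, hBc, hBreg⟩ := hT
  have hBne : ∀ i, (B i).Nonempty := fun i => card_pos.1 (by
    rw [hBc]; exact Nat.mul_pos (by omega) htm)
  obtain ⟨σ, o, Ω, hΩ1, hΩ2, hΩ3⟩ := exists_colour P hN hB hBne
  have hVpos : 0 < Fintype.card V := Fintype.card_pos_iff.2 ⟨(hBne ⟨0, by omega⟩).choose⟩
  have hB' : HostE E' fun i => B (σ i) := by
    refine ⟨fun c c' h => hB.1 _ _ fun h' => h (σ.injective h'), fun x hx => ?_⟩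
    have := hB.2 (x ∘ σ.symm) fun i => by simpa using hx (σ.symm i)
    rwa [← image_image, image_univ_equiv] at this
  have hB'reg : univ.biUnion (fun i => B (σ i)) = reg A₀ := by
    rw [← hBreg]
    ext v
    simp only [mem_biUnion, mem_univ, true_and]
    exact ⟨fun ⟨i, h⟩ => ⟨_, h⟩, fun ⟨i, h⟩ => ⟨σ.symm i, by simpa using h⟩⟩
  set W : L → (Fin k → V) → Finset V := fun l x => nb E x (P.p l) ∩ nb E x (P.q l) with hW
  set cost : L → ℝ := fun l =>
    if some l = o then ((P.M : ℝ) - 1) * (2 * P.M + 3) / 5 else 2 * (P.M : ℝ) with hcost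
  have hΩne : Ω.Nonempty := by
    rw [← card_pos]
    have : (0 : ℝ) < #Ω := lt_of_lt_of_le (mul_pos (by rw [← hd0]; exact hd0pos)
      (prod_pos fun i _ => by exact_mod_cast card_pos.2 (hBne _))) hΩ2
    exact_mod_cast this
  have hcov : Fintype.card V ≤ ∑ A, #(reg A) + t' * m := hcfg.cover
  have hsel : ∀ l (X : Finset κ), ∑ A ∈ X, (#(reg A) : ℝ) + (t' * m : ℕ) ≤ γ / 2 * Fintype.card V →
      ∀ Ωs ⊆ Ω, Ωs.Nonempty → ∃ A ∉ X,
        Sel P E E' t' (t' * m) (reg A) (val A) Ωs (W l) (γ / 8) (γ / (8 * k ^ 2)) (cost l) := by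
    intro l X hX Ωs hΩs hne
    by_cases hl : some l = o
    · obtain ⟨A, hA, h⟩ := exists_dense_part reg hcfg.disj (t' * m) hcov X Ωs hne (W l)
        (1 / (P.s : ℝ)) γ (by positivity) hγ hVpos hX fun x hx => by
          have hx' := hN x (hB'.2 x (Fintype.mem_piFinset.1 (hΩ1 (hΩs hx))))
          refine le_trans ?_ (card_inter_ge _ _ (hx' (P.p l)) (hx' (P.q l)))
          refine mul_le_mul_of_nonneg_right ?_ (Nat.cast_nonneg _)
          have : 2 * (1 / (2 * (P.s : ℝ))) = 1 / P.s := by field_simp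
          linarith
      refine ⟨A, hA, ?_⟩
      simp only [hcost, if_pos hl]
      exact sel_bad htm hγ hne (hcfg.part A) h
    · obtain ⟨A, hA, h⟩ := exists_dense_part reg hcfg.disj (t' * m) hcov X Ωs hne (W l)
        (((k : ℝ) - 1) / P.s) γ (div_nonneg (by
          rw [sub_nonneg]; exact_mod_cast (by omega : 1 ≤ k)) hs0.le) hγ hVpos hX fun x hx =>
            hΩ3 x (hΩs hx) l hl
      refine ⟨A, hA, ?_⟩
      simp only [hcost, if_neg hl]
      exact sel_good htm hγ (hcfg.part A) h
  obtain ⟨A, Pc, hA1, hA2, hA3, hA4, Ω₁, hΩ₁, hΩc, hΩ₁W⟩ := select_seq hcfg W cost hc0 k Ω hΩne hsel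
    (insert A₀ X) (by
      rw [sum_insert hA₀]
      have : (#(reg A₀) : ℝ) ≤ 2 * k * P.M * (t' * m : ℕ) := by
        exact_mod_cast (hcfg.part A₀).card_le
      linarith) univ (by have := P.hL; rw [card_univ]; omega)
  simp only [mem_univ, forall_const] at hA1 hA2 hA3 hA4 hΩ₁W
  obtain ⟨y, hy⟩ : ∃ y : ℕ, y = ⌊ρ * m⌋₊ := ⟨_, rfl⟩
  have hρm : 2 ≤ ρ * m := by
    have := (div_le_iff₀ hρpos).1 hm3
    linarith
  have hy1 : (y : ℝ) ≤ ρ * m := by rw [hy]; exact Nat.floor_le (by linarith)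
  have hy2 : ρ / 2 * m ≤ y := by
    have := Nat.lt_floor_add_one (ρ * m)
    rw [← hy] at this
    linarith
  obtain ⟨K, hK1, hK2, hK3, hK4, hK5⟩ := hbox (fun i => B (σ i)) (fun b : L × Fin 2 => Pc b.1 b.2) Ω₁
    (fun x b => W b.1 x) (hΩ₁.trans hΩ1) (by
      refine le_trans ?_ hΩc
      rw [hd, mul_assoc, card_univ, hd0]
      exact mul_le_mul_of_nonneg_left hΩ2 (by positivity))
    (fun x hx b => hΩ₁W x hx b.1 b.2) (t' * m) (by omega) (fun i => by
      rw [hBc]; exact Nat.le_mul_of_pos_left _ (by omega)) (fun b => hA4 b.1 b.2) y (by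
      rw [← hR]
      push_cast
      have h1 : (y : ℝ) * (P.M * P.N * t') ≤ ρ * m * (P.M * P.N * t') :=
        mul_le_mul_of_nonneg_right hy1 (by positivity)
      have h2 : ρ * (P.M * P.N) = R := by rw [hρ]; exact div_mul_cancel₀ _ hMN.ne'
      calc (y : ℝ) * (P.M * P.N * t') ≤ ρ * m * (P.M * P.N * t') := h1
        _ = ρ * (P.M * P.N) * (t' * m) := by ring
        _ = R * (t' * m) := by rw [h2])
  have hA₀' : ∀ l, A l ≠ A₀ := fun l h => hA2 l (h ▸ mem_insert_self _ _)
  have hinj : Function.Injective A := fun l l' h => hA1 l l' h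
  have hach := exchangeE hcfg.disj ht' hB' (fun i => hBc _) hB'reg hv A hinj hA₀' Pc cost hA3 y K
    hK1 hK2 hK3 hK4 fun j hj x hx b w hw => by
      have := (hK5 j hj x hx).2 b w hw
      simpa [hW, mem_nb] using this
  refine ⟨insert A₀ (univ.image A), ?_, ?_, insert_nonempty _ _, hach.mono Subset.rfl ?_⟩
  · rw [disjoint_insert_left]
    refine ⟨hA₀, disjoint_left.2 fun a ha => ?_⟩
    obtain ⟨l, -, rfl⟩ := mem_image.1 ha
    exact fun h => hA2 l (mem_insert_of_mem h)
  · refine (card_insert_le _ _).trans ?_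
    have := card_image_le (s := univ) (f := A)
    have := P.hL
    rw [card_univ] at *
    omega
  · rw [sum_insert (by simpa using hA₀'), sum_image fun l _ l' _ h => hinj h]
    have hgain := exchange_gain P o
    have h1 : (0 : ℝ) ≤ P.s * t' * y := by positivity
    have h2 := mul_le_mul_of_nonneg_right hgain h1
    have h3 : (P.s : ℝ) * t' * (ρ / 2 * m) ≤ P.s * t' * y :=
      mul_le_mul_of_nonneg_left hy2 (by positivity)
    push_cast
    nlinarith

section Extensions

variable {V : Type} [Fintype V] [DecidableEq V] (E : Finset (Finset V)) {α : Type} [Fintype α]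

/-- The vertices extending the tuple `x` to an edge. -/
def ext (x : α → V) : Finset V := univ.filter fun w => insert w (univ.image x) ∈ E

variable {E}

lemma mem_ext {x : α → V} {w : V} : w ∈ ext E x ↔ insert w (univ.image x) ∈ E := by simp [ext]

end Extensions

/-- Few bad tuples leave disjoint sets most of whose transversals are good. -/
lemma exists_good_transversals {V κ α : Type} [DecidableEq V] [DecidableEq κ] [Fintype α]
    [DecidableEq α] {reg : κ → Finset V}
    (hdis : ∀ A A', A ≠ A' → Disjoint (reg A) (reg A')) (U : Finset κ) (t : ℕ)
    (hU : ∀ A ∈ U, #(reg A) = t) (bad : Finset (α → V))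
    (h : (#bad : ℝ) < (((#U - Fintype.card α : ℕ) : ℝ) * t) ^ Fintype.card α / 2) :
    ∃ c : α → κ, Function.Injective c ∧ (∀ i, c i ∈ U) ∧
      (1 / 2 : ℝ) * t ^ Fintype.card α ≤ #(Fintype.piFinset (fun i => reg (c i)) \ bad) := by
  by_contra! hcon
  set Em : Finset (α ↪ U) := univ with hEm
  have hcardEm : (#U - Fintype.card α) ^ Fintype.card α ≤ #Em := by
    rw [hEm, card_univ, Fintype.card_embedding_eq, Fintype.card_coe]
    refine le_trans (Nat.pow_le_pow_left ?_ _) (Nat.pow_sub_le_descFactorial _ _)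
    omega
  have hbox : ∀ c : α ↪ U, #(Fintype.piFinset fun i => reg (c i)) = t ^ Fintype.card α := by
    intro c
    rw [Fintype.card_piFinset, prod_congr rfl fun i _ => hU _ (c i).2]
    simp
  have h1 : ∀ c ∈ Em, (1 / 2 : ℝ) * t ^ Fintype.card α ≤
      #(Fintype.piFinset (fun i => reg (c i)) ∩ bad) := by
    intro c _
    have h2 := hcon (fun i => c i) (fun i j h => c.injective (Subtype.ext h)) fun i => (c i).2
    have h3 := card_sdiff_add_card_inter (Fintype.piFinset fun i => reg (c i)) bad
    rw [hbox] at h3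
    have h4 : (#(Fintype.piFinset (fun i => reg (c i)) \ bad) : ℝ) +
      #(Fintype.piFinset (fun i => reg (c i)) ∩ bad) = t ^ Fintype.card α := by exact_mod_cast h3
    linarith
  have h5 : ∑ c ∈ Em, #(Fintype.piFinset (fun i => reg (c i)) ∩ bad) ≤ #bad := by
    rw [← card_biUnion]
    · exact card_le_card (biUnion_subset.2 fun c _ => inter_subset_right)
    · intro c _ c' _ hne
      refine disjoint_left.2 fun x hx hx' => hne ?_
      ext i
      by_contra hi
      have e1 := Fintype.mem_piFinset.1 (mem_inter.1 hx).1 i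
      have e2 := Fintype.mem_piFinset.1 (mem_inter.1 hx').1 i
      exact disjoint_left.1 (hdis _ _ hi) e1 e2
  have h6 := sum_le_sum h1
  rw [sum_const, nsmul_eq_mul] at h6
  have h7 : (∑ c ∈ Em, (#(Fintype.piFinset (fun i => reg (c i)) ∩ bad) : ℝ)) ≤ #bad := by
    exact_mod_cast h5
  have h8 : (((#U - Fintype.card α : ℕ) : ℝ)) ^ Fintype.card α ≤ #Em := by exact_mod_cast hcardEm
  have h9 := mul_le_mul_of_nonneg_right h8
    (by positivity : (0 : ℝ) ≤ 1 / 2 * t ^ Fintype.card α)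
  rw [mul_pow] at h
  linarith

section GadgetU

variable {k : ℕ} {L : Type} [Fintype L] {P : Patt k L} {V : Type} [Fintype V] [DecidableEq V]
  {E E' : Finset (Finset V)} {t' : ℕ} {κ : Type} [DecidableEq κ]
  {reg : κ → Finset V} {val : κ → ℝ}

lemma exchangeU (hdis : ∀ A A', A ≠ A' → Disjoint (reg A) (reg A')) (z : Fin k)
    (c : {i : Fin k // i ≠ z} → κ) (hc : Function.Injective c) (A : κ) (hA : ∀ i, c i ≠ A)
    {cost : ℝ} {P₁ P₂ : Finset V}
    (hs : Src P E E' t' (reg A) (val A) cost P₁ P₂) (y : ℕ)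
    (K : ℕ → {i : Fin k // i ≠ z} ⊕ (Unit × Fin 2) → Finset V)
    (hK1 : ∀ j < y, ∀ i, K j (Sum.inl i) ⊆ reg (c i))
    (hK2 : ∀ j < y, ∀ b : Unit × Fin 2, K j (Sum.inr b) ⊆ ![P₁, P₂] b.2)
    (hK3 : ∀ j < y, ∀ i, #(K j i) = P.N * t')
    (hK4 : ∀ j < y, ∀ j' < y, j ≠ j' → ∀ i, Disjoint (K j i) (K j' i))
    (hK5 : ∀ j < y, ∀ x : {i : Fin k // i ≠ z} → V, (∀ i, x i ∈ K j (Sum.inl i)) → ∀ b,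
      ∀ w ∈ K j (Sum.inr b), w ∈ ext E' x) :
    Ach P E E' t' ((insert A (univ.image c)).biUnion reg)
      (val A + (6 / 5 * (P.M - 1) - cost) * (P.s * t') * y) := by
  have hM := P.M_ge
  obtain ⟨D, hD1, hD2, hD3, hD4, hD5⟩ := take_sources hdis (fun _ : Unit => A)
    (fun _ _ _ => rfl) (fun _ => ![P₁, P₂]) (fun _ => cost) (fun _ => hs) y
    (fun j b => K j (Sum.inr b)) hK2 (fun j hj b => (hK3 j hj _).ge) fun j hj j' hj' hne b =>
      hK4 j hj j' hj' hne _
  set Q : ℕ → Fin k → Finset V := fun j i =>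
    if h : i ≠ z then K j (Sum.inl ⟨i, h⟩) else D j () with hQ
  have hQz : ∀ j, Q j z = D j () := fun j => by simp [hQ]
  have hQi : ∀ j i (h : i ≠ z), Q j i = K j (Sum.inl ⟨i, h⟩) := fun j i h => by simp [hQ, h]
  have hQQ : ∀ j < y, ∀ j' < y, ∀ i i', (j ≠ j' ∨ i ≠ i') → Disjoint (Q j i) (Q j' i') := by
    intro j hj j' hj' i i' h
    by_cases hi : i = z <;> by_cases hi' : i' = z
    · subst hi; subst hi'
      rw [hQz, hQz]
      exact hD4 j hj j' hj' (h.resolve_right fun h => h rfl) _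
    · subst hi
      rw [hQz, hQi j' i' hi']
      exact disjoint_of_subset_left (hD2 j hj _)
        (disjoint_of_subset_right (hK1 j' hj' _) (hdis _ _ (hA _).symm))
    · subst hi'
      rw [hQz, hQi j i hi]
      exact disjoint_of_subset_left (hK1 j hj _)
        (disjoint_of_subset_right (hD2 j' hj' _) (hdis _ _ (hA _)))
    · rw [hQi j i hi, hQi j' i' hi']
      by_cases hii : i = i'
      · subst hii
        exact hK4 j hj j' hj' (h.resolve_right fun h => h rfl) _
      · exact disjoint_of_subset_left (hK1 j hj _) (disjoint_of_subset_right (hK1 j' hj' _)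
          (hdis _ _ fun h => hii (congrArg Subtype.val (hc h))))
  have hbox : ∀ j ∈ range y, Ach P E E' t' (univ.biUnion (Q j))
      (6 / 5 * (P.M - 1) * (P.s * t')) := by
    intro j hj
    have hj := mem_range.1 hj
    have hhost : HostE E' (Q j) := by
      refine ⟨fun c c' h => hQQ j hj j hj c c' (Or.inr h), fun x hx => ?_⟩
      have hxz := hx z
      rw [hQz] at hxz
      have hx' : ∀ i : {i : Fin k // i ≠ z}, x i ∈ K j (Sum.inl i) := fun i => by
        have := hx i
        rwa [hQi j i i.2] at this
      have him : univ.image x = insert (x z) (univ.image fun i : {i : Fin k // i ≠ z} => x i) := by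
        ext w
        simp only [mem_image, mem_univ, true_and, mem_insert]
        constructor
        · rintro ⟨i, rfl⟩
          by_cases hi : i = z
          · exact Or.inl (by rw [hi])
          · exact Or.inr ⟨⟨i, hi⟩, rfl⟩
        · rintro (rfl | ⟨i, rfl⟩)
          · exact ⟨z, rfl⟩
          · exact ⟨i, rfl⟩
      rw [him, ← mem_ext]
      rcases mem_union.1 (hD1 j hj () hxz) with h | h
      · exact hK5 j hj _ hx' _ _ h
      · exact hK5 j hj _ hx' _ _ h
    have hcard : ∀ i, #(Q j i) = P.N * t' := by
      intro i
      by_cases hi : i = z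
      · subst hi; rw [hQz, hD3 j hj]
      · rw [hQi j i hi, hK3 j hj]
    refine (ach_hostE t' (2 * (P.M - 1)) (Q j) hhost fun i => ?_).mono Subset.rfl ?_
    · rw [hcard, Patt.N]
      exact le_of_eq (by ring)
    · push_cast [Nat.cast_sub (by omega : 1 ≤ P.M)]
      exact le_of_eq (by ring)
  have hboxes := Ach.biUnion (range y) _ _ hbox fun j hj j' hj' hne => by
    rw [disjoint_biUnion_left]
    intro c _
    rw [disjoint_biUnion_right]
    exact fun c' _ => hQQ j (mem_range.1 hj) j' (mem_range.1 hj') c c' (Or.inl hne)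
  refine (hD5.union hboxes ?_).mono ?_ ?_
  · rw [disjoint_biUnion_right]
    intro j hj
    rw [disjoint_biUnion_right]
    intro i _
    rw [disjoint_biUnion_left]
    intro u _
    by_cases hi : i = z
    · subst hi
      rw [hQz]
      refine disjoint_of_subset_right ?_ sdiff_disjoint
      exact fun w hw => mem_biUnion.2 ⟨j, hj, hw⟩
    · rw [hQi j i hi]
      exact disjoint_of_subset_left sdiff_subset (disjoint_of_subset_right
        (hK1 j (mem_range.1 hj) _) (hdis _ _ (hA _).symm))
  · have hAi : reg A ⊆ (insert A (univ.image c)).biUnion reg :=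
      subset_biUnion_of_mem reg (mem_insert_self _ _)
    refine union_subset (biUnion_subset.2 fun l _ => sdiff_subset.trans hAi)
      (biUnion_subset.2 fun j hj => biUnion_subset.2 fun i _ => ?_)
    by_cases hi : i = z
    · subst hi
      rw [hQz]
      exact (hD2 j (mem_range.1 hj) _).trans hAi
    · rw [hQi j i hi]
      exact (hK1 j (mem_range.1 hj) _).trans
        (subset_biUnion_of_mem reg (mem_insert_of_mem (mem_image_of_mem c (mem_univ _))))
  · simp only [sum_const, card_range, nsmul_eq_mul, univ_unique, card_singleton, Nat.cast_one,
      one_mul]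
    linarith

end GadgetU

lemma exists_gadgetU {k : ℕ} {L : Type} [Fintype L] [DecidableEq L] (P : Patt k L) {γ : ℝ}
    (hγ : 0 < γ) (hγ1 : γ ≤ 1) (z : Fin k) :
    ∃ g : ℝ, 0 < g ∧ ∀ t' : ℕ, 0 < t' → ∃ m₀ : ℕ, ∀ m, m₀ ≤ m →
    ∀ {V : Type} [Fintype V] [DecidableEq V] {κ : Type} [Fintype κ] [DecidableEq κ]
    {E E' : Finset (Finset V)} {reg : κ → Finset V} {val : κ → ℝ},
    IsCfg P E E' t' m reg val →
    ∀ (bad : Finset ({i : Fin k // i ≠ z} → V)),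
    (∀ x ∉ bad, Function.Injective x → (1 / 2 + γ / 2) * Fintype.card V ≤ #(ext E' x)) →
    ∀ (X U : Finset κ), Disjoint U X → (∀ A ∈ U, #(reg A) = t' * m ∧ val A = 0) →
    (#bad : ℝ) < (((#U - (k - 1) : ℕ) : ℝ) * (t' * m : ℕ)) ^ (k - 1) / 2 →
    ∑ A ∈ X, (#(reg A) : ℝ) + ((k + 1) * (2 * k * P.M) + 1) * (t' * m : ℕ) ≤
      γ / 4 * Fintype.card V →
    ∃ Y : Finset κ, Disjoint Y X ∧ #Y ≤ k ∧ Y.Nonempty ∧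
      Ach P E E' t' (Y.biUnion reg) (∑ A ∈ Y, val A + g * (t' * m : ℕ)) := by
  have hk := P.hk
  have hM := P.M_ge
  have hs0 : (0 : ℝ) < P.s := by exact_mod_cast P.s_pos
  have hfrac := patt_frac P
  have hα : Fintype.card {i : Fin k // i ≠ z} = k - 1 := by
    simp [Fintype.card_subtype_compl]
  have : Nonempty {i : Fin k // i ≠ z} := Fintype.card_pos_iff.1 (by omega)
  have hNpos : 0 < P.N := Nat.mul_pos (by omega) (by omega)
  have hc0 : 0 < γ / 2 / (8 * k ^ 2) := by positivity
  have hc1 : γ / 2 / (8 * k ^ 2) ≤ 1 := div_le_one_of_le₀ (by linarith) (by positivity)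
  obtain ⟨d, hd⟩ : ∃ d : ℝ, d = γ / 2 / (8 * k ^ 2) * (1 / 2) := ⟨_, rfl⟩
  have hdpos : 0 < d := by rw [hd]; positivity
  have hd1 : d ≤ 1 := by rw [hd]; linarith
  obtain ⟨R, hR⟩ : ∃ R : ℝ, R = (γ / 2 / 8) ^ Fintype.card (Unit × Fin 2) * d /
    (2 * Fintype.card ({i : Fin k // i ≠ z} ⊕ (Unit × Fin 2))) := ⟨_, rfl⟩
  have hI : 0 < Fintype.card ({i : Fin k // i ≠ z} ⊕ (Unit × Fin 2)) := Fintype.card_pos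
  have hRpos : 0 < R := by rw [hR]; positivity
  obtain ⟨ρ, hρ⟩ : ∃ ρ : ℝ, ρ = R / P.N := ⟨_, rfl⟩
  have hMN : (0 : ℝ) < P.N := by exact_mod_cast hNpos
  have hρpos : 0 < ρ := by rw [hρ]; positivity
  refine ⟨P.s * ρ / 2, by positivity, fun t' ht' => ?_⟩
  obtain ⟨n₀, hbox⟩ := exists_dependent_boxes {i : Fin k // i ≠ z} (Unit × Fin 2) (P.N * t')
    (Nat.mul_pos hNpos ht') (γ / 2 / 8) d (by linarith) (by linarith) hdpos hd1
  refine ⟨max (max n₀ 1) ⌈2 / ρ⌉₊, ?_⟩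
  intro m hm V _ _ κ _ _ E E' reg val hcfg bad hbad X U hUX hU hbadc hX
  have hm1 : n₀ ≤ m := (le_max_left _ _).trans ((le_max_left _ _).trans hm)
  have hm2 : 1 ≤ m := (le_max_right _ _).trans ((le_max_left _ _).trans hm)
  have hm3 : 2 / ρ ≤ m := Nat.ceil_le.1 ((le_max_right _ _).trans hm)
  have htm : 0 < t' * m := Nat.mul_pos ht' (by omega)
  have htmm : m ≤ t' * m := Nat.le_mul_of_pos_left _ ht'
  obtain ⟨c, hc, hcU, hΩ2⟩ := exists_good_transversals hcfg.disj U (t' * m) (fun A hA => (hU A hA).1)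
    bad (by rw [hα]; exact hbadc)
  set Ω := Fintype.piFinset (fun i => reg (c i)) \ bad with hΩ
  have hinjx : ∀ x ∈ Ω, (1 / 2 + γ / 2) * Fintype.card V ≤ #(ext E' x) := by
    intro x hx
    obtain ⟨hx1, hx2⟩ := mem_sdiff.1 hx
    refine hbad x hx2 fun i j hij => ?_
    by_contra hne
    have e1 := Fintype.mem_piFinset.1 hx1 i
    have e2 := Fintype.mem_piFinset.1 hx1 j
    rw [hij] at e1
    exact disjoint_left.1 (hcfg.disj _ _ fun h => hne (hc h)) e1 e2
  have hΩne : Ω.Nonempty := by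
    rw [← card_pos]
    have : (0 : ℝ) < #Ω := lt_of_lt_of_le (mul_pos (by norm_num)
      (pow_pos (by exact_mod_cast htm) _)) hΩ2
    exact_mod_cast this
  have hVpos : 0 < Fintype.card V := by
    obtain ⟨x, -⟩ := hΩne
    exact Fintype.card_pos_iff.2 ⟨x (Classical.arbitrary _)⟩
  have hsel : ∀ (l : Unit) (X : Finset κ), ∑ A ∈ X, (#(reg A) : ℝ) + (t' * m : ℕ) ≤
      γ / 4 * Fintype.card V → ∀ Ωs ⊆ Ω, Ωs.Nonempty → ∃ A ∉ X,
        Sel P E E' t' (t' * m) (reg A) (val A) Ωs (ext E') (γ / 2 / 8)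
          (γ / 2 / (8 * k ^ 2)) P.M := by
    intro _ X hX Ωs hΩs hne
    obtain ⟨A, hA, h⟩ := exists_dense_part reg hcfg.disj (t' * m) hcfg.cover X Ωs hne (ext E')
      (1 / 2) (γ / 2) (by norm_num) (by linarith) hVpos (by linarith) fun x hx => hinjx x (hΩs hx)
    exact ⟨A, hA, sel_pair htm (by linarith) hne (hcfg.part A) h⟩
  have hcX : Disjoint (univ.image c) X := disjoint_left.2 fun a ha => by
    obtain ⟨i, -, rfl⟩ := mem_image.1 ha
    exact disjoint_left.1 hUX (hcU i)
  obtain ⟨A, Pc, -, hA2, hA3, hA4, Ω₁, hΩ₁, hΩc, hΩ₁W⟩ := select_seq hcfg (fun _ : Unit => ext E')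
    (fun _ => (P.M : ℝ)) hc0 1 Ω hΩne hsel (univ.image c ∪ X) (by
      rw [sum_union hcX, sum_image fun i _ j _ h => hc h,
        sum_congr rfl fun i _ => by rw [(hU _ (hcU i)).1], sum_const, card_univ, hα, nsmul_eq_mul]
      have h1 : ((k - 1 : ℕ) : ℝ) * (t' * m : ℕ) ≤ k * (2 * k * P.M) * (t' * m : ℕ) := by
        refine mul_le_mul_of_nonneg_right ?_ (Nat.cast_nonneg _)
        have : k - 1 ≤ k * (2 * k * P.M) := (Nat.sub_le _ _).trans
          (Nat.le_mul_of_pos_right _ (by positivity))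
        exact_mod_cast this
      push_cast at h1 hX ⊢
      linarith) univ (by simp)
  simp only [mem_univ, forall_const] at hA2 hA3 hA4 hΩ₁W
  obtain ⟨y, hy⟩ : ∃ y : ℕ, y = ⌊ρ * m⌋₊ := ⟨_, rfl⟩
  have hρm : 2 ≤ ρ * m := by
    have := (div_le_iff₀ hρpos).1 hm3
    linarith
  have hy1 : (y : ℝ) ≤ ρ * m := by rw [hy]; exact Nat.floor_le (by linarith)
  have hy2 : ρ / 2 * m ≤ y := by
    have := Nat.lt_floor_add_one (ρ * m)
    rw [← hy] at this
    linarith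
  obtain ⟨K, hK1, hK2, hK3, hK4, hK5⟩ := hbox (fun i => reg (c i))
    (fun b : Unit × Fin 2 => Pc b.1 b.2) Ω₁
    (fun x _ => ext E' x) (hΩ₁.trans sdiff_subset) (by
      refine le_trans ?_ hΩc
      rw [card_univ, Fintype.card_unit, pow_one, prod_congr rfl fun i _ => by rw [(hU _ (hcU i)).1],
        prod_const, card_univ, hd, mul_assoc]
      exact mul_le_mul_of_nonneg_left hΩ2 hc0.le)
    (fun x hx b => hΩ₁W x hx b.1 b.2) (t' * m) (by omega) (fun i => (hU _ (hcU i)).1.ge)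
    (fun b => hA4 b.1 b.2) y (by
      rw [← hR]
      push_cast
      have h1 : (y : ℝ) * (P.N * t') ≤ ρ * m * (P.N * t') :=
        mul_le_mul_of_nonneg_right hy1 (by positivity)
      have h2 : ρ * P.N = R := by rw [hρ]; exact div_mul_cancel₀ _ hMN.ne'
      calc (y : ℝ) * (P.N * t') ≤ ρ * m * (P.N * t') := h1
        _ = ρ * P.N * (t' * m) := by ring
        _ = R * (t' * m) := by rw [h2])
  have hcA : ∀ i, c i ≠ A () := fun i h =>
    hA2 () (h ▸ mem_union_left _ (mem_image_of_mem c (mem_univ i)))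
  have hach := exchangeU hcfg.disj z c hc (A ()) hcA (hA3 ()) y K hK1 (fun j hj b => by
      refine (hK2 j hj b).trans ?_
      obtain ⟨_, b⟩ := b
      fin_cases b <;> exact Subset.rfl) hK3 hK4 fun j hj x hx b w hw => (hK5 j hj x hx).2 b w hw
  refine ⟨insert (A ()) (univ.image c), ?_, ?_, insert_nonempty _ _, hach.mono Subset.rfl ?_⟩
  · rw [disjoint_insert_left]
    exact ⟨fun h => hA2 () (mem_union_right _ h), hcX⟩
  · refine (card_insert_le _ _).trans ?_
    have := card_image_le (s := univ) (f := c)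
    rw [card_univ, hα] at this
    omega
  · rw [sum_insert (by simpa using hcA), sum_image fun l _ l' _ h => hc h,
      sum_congr rfl fun i _ => (hU _ (hcU i)).2, sum_const_zero, add_zero]
    have hgain : (1 : ℝ) ≤ 6 / 5 * (P.M - 1) - P.M := by
      have : (15 : ℝ) ≤ P.M := by exact_mod_cast hM
      linarith
    have h1 : (0 : ℝ) ≤ P.s * t' * y := by positivity
    have h2 := mul_le_mul_of_nonneg_right hgain h1
    have h3 : (P.s : ℝ) * t' * (ρ / 2 * m) ≤ P.s * t' * y :=
      mul_le_mul_of_nonneg_left hy2 (by positivity)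
    push_cast
    nlinarith

section Greedy

variable {k : ℕ} {L : Type} [Fintype L] {P : Patt k L} {V : Type} [DecidableEq V]
  {E E' : Finset (Finset V)} {t' m : ℕ} {κ : Type} [Fintype κ] [DecidableEq κ]
  {reg : κ → Finset V} {val : κ → ℝ}

lemma Part.split {S : Finset V} {v : ℝ} (h : Part P E E' (t' * m) S v) : Ach P E E' t' S v := by
  rcases h with (⟨h, rfl⟩ | ⟨h, rfl⟩) | ⟨-, rfl⟩
  · exact h.split
  · exact h.split
  · exact Ach.nil _ _ le_rfl

/-- Disjoint gadgets can be chosen greedily. -/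
lemma greedy [Fintype V] (hdis : ∀ A A', A ≠ A' → Disjoint (reg A) (reg A'))
    (hsplit : ∀ A, Ach P E E' t' (reg A) (val A)) (G : ℝ) (D : ℕ)
    (hg : ∀ X : Finset κ, #X ≤ k * D → ∃ Y, Disjoint Y X ∧ #Y ≤ k ∧
      Ach P E E' t' (Y.biUnion reg) (∑ A ∈ Y, val A + G)) :
    Ach P E E' t' univ (∑ A, val A + D * G) := by
  have key : ∀ r ≤ D, ∃ X : Finset κ, #X ≤ k * r ∧
      Ach P E E' t' (X.biUnion reg) (∑ A ∈ X, val A + r * G) := by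
    intro r
    induction r with
    | zero => exact fun _ => ⟨∅, by simp, Ach.nil _ _ (by simp)⟩
    | succ r ih =>
      intro hr
      obtain ⟨X, hX, hA⟩ := ih (by omega)
      obtain ⟨Y, hYX, hY, hA'⟩ := hg X (hX.trans (Nat.mul_le_mul_left _ (by omega)))
      refine ⟨X ∪ Y, (card_union_le _ _).trans (by rw [Nat.mul_succ]; omega), ?_⟩
      rw [union_biUnion, sum_union hYX.symm]
      refine (hA.union hA' ?_).mono Subset.rfl (by push_cast; linarith)
      simp only [disjoint_biUnion_left, disjoint_biUnion_right]
      exact fun a ha b hb => hdis _ _ fun h => disjoint_left.1 hYX ha (by rwa [h] at hb)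
  obtain ⟨X, -, hX⟩ := key D le_rfl
  have h2 := Ach.biUnion Xᶜ reg val (fun A _ => hsplit A) fun A _ A' _ h => hdis A A' h
  refine (hX.union h2 ?_).mono (subset_univ _) ?_
  · simp only [disjoint_biUnion_left, disjoint_biUnion_right]
    exact fun a ha b hb => hdis _ _ fun h => mem_compl.1 ha (h ▸ hb)
  · rw [← sum_add_sum_compl X val]
    linarith

end Greedy

lemma exists_clusters {V : Type} [DecidableEq V] (t q : ℕ) : ∀ R : Finset V, q * t ≤ #R →
    ∃ cl : ℕ → Finset V, (∀ i < q, #(cl i) = t ∧ cl i ⊆ R) ∧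
      ∀ i < q, ∀ j < q, i ≠ j → Disjoint (cl i) (cl j) := by
  induction q with
  | zero => exact fun R _ => ⟨fun _ => ∅, by simp, by simp⟩
  | succ q ih =>
    intro R hR
    obtain ⟨T, hT, hTc⟩ := exists_subset_card_eq (s := R) (n := t) (by
      rw [Nat.succ_mul] at hR; omega)
    obtain ⟨cl, h1, h2⟩ := ih (R \ T) (by
      rw [card_sdiff_of_subset hT]; rw [Nat.succ_mul] at hR; omega)
    have hd : ∀ i < q, Disjoint (cl i) T := fun i hi =>
      disjoint_of_subset_left (h1 i hi).2 sdiff_disjoint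
    refine ⟨fun i => if i = q then T else cl i, fun i hi => ?_, fun i hi j hj hij => ?_⟩
    · by_cases h : i = q
      · simp [h, hT, hTc]
      · simp only [if_neg h]
        exact ⟨(h1 i (by omega)).1, (h1 i (by omega)).2.trans sdiff_subset⟩
    · by_cases h : i = q <;> by_cases h' : j = q
      · omega
      · simp only [if_pos h, if_neg h']
        exact (hd j (by omega)).symm
      · simp only [if_neg h, if_pos h']
        exact hd i (by omega)
      · simp only [if_neg h, if_neg h']
        exact h2 i (by omega) j (by omega) hij

section Step

variable {k : ℕ} {L : Type} [Fintype L] {P : Patt k L} {V : Type} [Fintype V]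
  [DecidableEq V] {E E' : Finset (Finset V)} {t' m : ℕ}

/-- A tiling is completed to a configuration by cutting the uncovered vertices into clusters. -/
lemma exists_cfg (ht : 0 < t' * m) {x : ℝ} (h : Ach P E E' (t' * m) univ x) :
    ∃ (ι : Type) (_ : Fintype ι) (q : ℕ) (reg : ι ⊕ Fin q → Finset V) (val : ι ⊕ Fin q → ℝ),
      IsCfg P E E' t' m reg val ∧ (∀ i, Tile P E E' (t' * m) (reg (Sum.inl i)) (val (Sum.inl i))) ∧
      (∀ j, #(reg (Sum.inr j)) = t' * m ∧ val (Sum.inr j) = 0) ∧ x ≤ ∑ i, val i := by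
  obtain ⟨ι, _, reg, val, h1, h2, -, h4⟩ := h
  have hcov : #(univ.biUnion reg) = ∑ i, #(reg i) := card_biUnion fun i _ j _ hij => h2 i j hij
  obtain ⟨cl, hcl, hcld⟩ := exists_clusters (t' * m) (#(univ.biUnion reg)ᶜ / (t' * m))
    (univ.biUnion reg)ᶜ (Nat.div_mul_le_self _ _)
  have hd : ∀ i, ∀ j < #(univ.biUnion reg)ᶜ / (t' * m), Disjoint (reg i) (cl j) := fun i j hj =>
    disjoint_of_subset_left (subset_biUnion_of_mem reg (mem_univ i))
      (disjoint_of_subset_right (hcl j hj).2 disjoint_compl_right)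
  refine ⟨ι, inferInstance, #(univ.biUnion reg)ᶜ / (t' * m), Sum.elim reg fun j => cl j,
    Sum.elim val fun _ => 0, ⟨?_, ?_, ?_⟩, h1, fun j => ⟨(hcl j j.2).1, rfl⟩, ?_⟩
  · rintro (i | j)
    · exact Or.inl (h1 i)
    · exact Or.inr ⟨(hcl j j.2).1, rfl⟩
  · rintro (i | i) (j | j) hij
    · exact h2 i j fun h => hij (by rw [h])
    · exact hd i j j.2
    · exact (hd j i i.2).symm
    · exact hcld i i.2 j j.2 fun h => hij (by rw [Fin.ext h])
  · rw [Fintype.sum_sum_type]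
    simp only [Sum.elim_inl, Sum.elim_inr]
    rw [sum_congr rfl fun (j : Fin _) _ => (hcl j j.2).1, sum_const, card_univ, Fintype.card_fin,
      ← hcov, smul_eq_mul]
    have h3 := card_add_card_compl (univ.biUnion reg)
    have h5 := Nat.div_add_mod' (#(univ.biUnion reg)ᶜ) (t' * m)
    have h6 := Nat.mod_lt (#(univ.biUnion reg)ᶜ) ht
    omega
  · rw [Fintype.sum_sum_type]
    simpa using h4

/-- A configuration of small weight has many tiles of type `E` or many clusters. -/
lemma cfg_alternative {ι : Type} [Fintype ι] {q : ℕ} {reg : ι ⊕ Fin q → Finset V}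
    {val : ι ⊕ Fin q → ℝ} (hcfg : IsCfg P E E' t' m reg val)
    (h1 : ∀ i, Tile P E E' (t' * m) (reg (Sum.inl i)) (val (Sum.inl i)))
    (h2 : ∀ j, #(reg (Sum.inr j)) = t' * m ∧ val (Sum.inr j) = 0) :
    ∃ Z : Finset ι, (∀ i ∈ Z, TileE P E' (t' * m) (reg (Sum.inl i)) ∧
      val (Sum.inl i) = 3 / 5 * (P.s * (t' * m : ℕ))) ∧
      (Fintype.card V : ℝ) ≤ ∑ i, val i + #Z * (k * P.M * (t' * m : ℕ)) +
        (q + 1) * (t' * m : ℕ) := by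
  classical
  refine ⟨univ.filter fun i => TileE P E' (t' * m) (reg (Sum.inl i)) ∧
      val (Sum.inl i) = 3 / 5 * (P.s * (t' * m : ℕ)), fun i hi => (mem_filter.1 hi).2, ?_⟩
  have hcov : (Fintype.card V : ℝ) ≤ ∑ A, (#(reg A) : ℝ) + (t' * m : ℕ) := by
    exact_mod_cast hcfg.cover
  rw [Fintype.sum_sum_type] at hcov
  rw [Fintype.sum_sum_type]
  have h3 : ∑ j : Fin q, (#(reg (Sum.inr j)) : ℝ) = q * (t' * m : ℕ) := by
    rw [sum_congr rfl fun j _ => by rw [(h2 j).1]]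
    simp
  have h4 : ∑ j : Fin q, val (Sum.inr j) = 0 := sum_eq_zero fun j _ => (h2 j).2
  have h5 : ∑ i, (#(reg (Sum.inl i)) : ℝ) ≤ ∑ i, (val (Sum.inl i) +
      if TileE P E' (t' * m) (reg (Sum.inl i)) ∧
        val (Sum.inl i) = 3 / 5 * (P.s * (t' * m : ℕ)) then (k * P.M * (t' * m : ℕ) : ℝ) else 0) := by
    refine sum_le_sum fun i _ => ?_
    rcases h1 i with ⟨hF, hv⟩ | ⟨hE, hv⟩
    · rw [hF.card_eq, hv]
      push_cast
      have : (0 : ℝ) ≤ if TileE P E' (t' * m) (reg (Sum.inl i)) ∧ (P.s * (t' * m) : ℝ) =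
          3 / 5 * (P.s * (t' * m)) then (k * P.M * (t' * m) : ℝ) else 0 := by
        split_ifs <;> positivity
      linarith
    · rw [if_pos ⟨hE, hv⟩, hE.card_eq, hv]
      have : (0 : ℝ) ≤ 3 / 5 * (P.s * (t' * m : ℕ)) := by positivity
      push_cast at this ⊢
      linarith
  rw [sum_add_distrib, ← sum_filter, sum_const, nsmul_eq_mul] at h5
  linarith

end Step

section Step

variable {k : ℕ} {L : Type} [Fintype L] [DecidableEq L] (P : Patt k L) (z : Fin k)
  {V : Type} [Fintype V] [DecidableEq V]

/-- The degree properties of a dense `k`-graph `E` with well-behaved subgraph `E'`. -/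
structure IsHost (E E' : Finset (Finset V)) (γ η : ℝ) : Prop where
  edge : ∀ x : Fin k → V, univ.image x ∈ E' → ∀ i,
    (1 / 2 + 1 / (2 * (P.s : ℝ)) + γ) * Fintype.card V ≤ #(nb E x i)
  tuple : ∃ bad : Finset ({i : Fin k // i ≠ z} → V),
    (#bad : ℝ) < (η * Fintype.card V) ^ (k - 1) / 2 ∧
    ∀ x ∉ bad, Function.Injective x → (1 / 2 + γ / 2) * Fintype.card V ≤ #(ext E' x)

set_option maxHeartbeats 1000000 in
lemma step {γ α₀ : ℝ} (hγ : 0 < γ) (hγ1 : γ ≤ 1) (hα₀ : 0 < α₀) :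
    ∃ ν : ℝ, 0 < ν ∧ ∀ t' : ℕ, 0 < t' → ∃ t : ℕ, 0 < t ∧ ∃ n₀ : ℕ,
    ∀ {V : Type} [Fintype V] [DecidableEq V] {E E' : Finset (Finset V)},
    n₀ ≤ Fintype.card V → IsHost P z E E' γ (α₀ / 4) → ∀ α : ℝ,
    Ach P E E' t univ ((1 - α) * Fintype.card V) →
    Ach P E E' t' univ ((1 - max α₀ (α - ν)) * Fintype.card V) := by
  classical
  have hk := P.hk
  have hM := P.M_ge
  have hkr : (3 : ℝ) ≤ k := by exact_mod_cast hk
  have hMr : (15 : ℝ) ≤ P.M := by exact_mod_cast hM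
  obtain ⟨g₁, hg₁, hE⟩ := exists_gadgetE P hγ hγ1
  obtain ⟨g₂, hg₂, hU⟩ := exists_gadgetU P hγ hγ1 z
  obtain ⟨g, hg⟩ : ∃ g : ℝ, g = min g₁ g₂ := ⟨_, rfl⟩
  have hgpos : 0 < g := by rw [hg]; exact lt_min hg₁ hg₂
  have hgg₁ : g ≤ g₁ := hg ▸ min_le_left _ _
  have hgg₂ : g ≤ g₂ := hg ▸ min_le_right _ _
  obtain ⟨δ, hδ⟩ : ∃ δ : ℝ, δ = min γ α₀ / (32 * k ^ 2 * P.M) := ⟨_, rfl⟩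
  have hk2 : (0 : ℝ) < 32 * k ^ 2 * P.M := by positivity
  have hδpos : 0 < δ := by rw [hδ]; exact div_pos (lt_min hγ hα₀) hk2
  have hδm : δ * (32 * k ^ 2 * P.M) = min γ α₀ := by rw [hδ]; exact div_mul_cancel₀ _ hk2.ne'
  have hδγ : δ * (32 * k ^ 2 * P.M) ≤ γ := hδm.le.trans (min_le_left _ _)
  have hδα : δ * (32 * k ^ 2 * P.M) ≤ α₀ := hδm.le.trans (min_le_right _ _)
  obtain ⟨K₀, hK₀⟩ : ∃ K : ℝ, K = (k + 1) * (2 * k * P.M) + 1 := ⟨_, rfl⟩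
  have hK₀pos : 0 < K₀ := by rw [hK₀]; positivity
  refine ⟨δ * g / 2, by positivity, fun t' ht' => ?_⟩
  obtain ⟨m₁, hE⟩ := hE t' ht'
  obtain ⟨m₂, hU⟩ := hU t' ht'
  obtain ⟨m, hm⟩ : ∃ m : ℕ, m = max (max m₁ m₂) 1 := ⟨_, rfl⟩
  have hm1 : m₁ ≤ m := by omega
  have hm2 : m₂ ≤ m := by omega
  have htm : 0 < t' * m := Nat.mul_pos ht' (by omega)
  obtain ⟨t, ht⟩ : ∃ t : ℝ, t = (t' * m : ℕ) := ⟨_, rfl⟩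
  have htpos : 0 < t := by rw [ht]; exact_mod_cast htm
  obtain ⟨n₀, hn₀⟩ := exists_nat_ge (t * (8 * K₀ / γ + 8 * (k + 1) / α₀ + 2 / δ + 1))
  refine ⟨t' * m, htm, n₀, ?_⟩
  intro V _ _ E E' hn hhost α hach
  obtain ⟨n, hnV⟩ : ∃ n : ℝ, n = Fintype.card V := ⟨_, rfl⟩
  have hn : t * (8 * K₀ / γ + 8 * (k + 1) / α₀ + 2 / δ + 1) ≤ n := by
    rw [hnV]; exact hn₀.trans (by exact_mod_cast hn)
  have e1 : 0 ≤ t * (8 * K₀ / γ) := by positivity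
  have e2 : 0 ≤ t * (8 * (k + 1) / α₀) := by positivity
  have e3 : 0 ≤ t * (2 / δ) := by positivity
  have hn1 : K₀ * t ≤ γ / 8 * n := by
    have : t * (8 * K₀ / γ) ≤ n := by linarith
    have := mul_le_mul_of_nonneg_left this (by positivity : 0 ≤ γ / 8)
    have e : γ / 8 * (t * (8 * K₀ / γ)) = K₀ * t := by field_simp
    linarith
  have hn2 : (k + 1) * t ≤ α₀ / 8 * n := by
    have : t * (8 * (k + 1) / α₀) ≤ n := by linarith
    have := mul_le_mul_of_nonneg_left this (by positivity : 0 ≤ α₀ / 8)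
    have e : α₀ / 8 * (t * (8 * (k + 1) / α₀)) = (k + 1) * t := by field_simp
    linarith
  have hn3 : t ≤ δ / 2 * n := by
    have : t * (2 / δ) ≤ n := by linarith
    have := mul_le_mul_of_nonneg_left this (by positivity : 0 ≤ δ / 2)
    have e : δ / 2 * (t * (2 / δ)) = t := by field_simp
    linarith
  have hnpos : 0 < n := by linarith
  obtain ⟨ι, _, q, reg, val, hcfg, h1, h2, h3⟩ := exists_cfg htm hach
  rw [← hnV] at h3 ⊢
  have hsplit : ∀ A, Ach P E E' t' (reg A) (val A) := fun A => (hcfg.part A).split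
  have hmaxα : (1 - max α₀ (α - δ * g / 2)) * n ≤ (1 - α₀) * n :=
    mul_le_mul_of_nonneg_right (by linarith [le_max_left α₀ (α - δ * g / 2)]) hnpos.le
  have hmaxν : (1 - max α₀ (α - δ * g / 2)) * n ≤ (1 - (α - δ * g / 2)) * n :=
    mul_le_mul_of_nonneg_right (by linarith [le_max_right α₀ (α - δ * g / 2)]) hnpos.le
  by_cases hval : (1 - α₀) * n ≤ ∑ A, val A
  · refine (greedy hcfg.disj hsplit 0 0 fun X _ => ⟨∅, disjoint_empty_left _, by simp,
      Ach.nil _ _ (by simp)⟩).mono Subset.rfl ?_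
    linarith
  push Not at hval
  obtain ⟨D, hD⟩ : ∃ D : ℕ, D = ⌊δ * n / t⌋₊ := ⟨_, rfl⟩
  have hD1 : D * t ≤ δ * n := by
    rw [← le_div_iff₀ htpos, hD]
    exact Nat.floor_le (by positivity)
  have hD2 : δ * n - t ≤ D * t := by
    have := Nat.lt_floor_add_one (δ * n / t)
    rw [← hD, div_lt_iff₀ htpos] at this
    linarith
  have hkD : k * (D * t) ≤ k * (δ * n) := mul_le_mul_of_nonneg_left hD1 (by positivity)
  have hXb : ∀ X : Finset (ι ⊕ Fin q), #X ≤ k * D →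
      ∑ A ∈ X, (#(reg A) : ℝ) + ((k + 1) * (2 * k * P.M) + 1) * (t' * m : ℕ) ≤ γ / 4 * n := by
    intro X hX
    rw [← hK₀, ← ht]
    have hX' : (#X : ℝ) ≤ k * D := by exact_mod_cast hX
    have a1 : ∑ A ∈ X, (#(reg A) : ℝ) ≤ #X * (2 * k * P.M * t) := by
      rw [← nsmul_eq_mul]
      refine sum_le_card_nsmul _ _ _ fun A _ => ?_
      rw [ht]
      exact_mod_cast (hcfg.part A).card_le
    have a2 : (#X : ℝ) * (2 * k * P.M * t) ≤ k * D * (2 * k * P.M * t) :=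
      mul_le_mul_of_nonneg_right hX' (by positivity)
    have a3 : (k : ℝ) * D * (2 * k * P.M * t) = 2 * k ^ 2 * P.M * (D * t) := by ring
    have a4 : 2 * (k : ℝ) ^ 2 * P.M * (D * t) ≤ 2 * k ^ 2 * P.M * (δ * n) :=
      mul_le_mul_of_nonneg_left hD1 (by positivity)
    have a5 : δ * (32 * k ^ 2 * P.M) * n ≤ γ * n := mul_le_mul_of_nonneg_right hδγ hnpos.le
    have a6 : 0 < γ * n := mul_pos hγ hnpos
    linarith
  obtain ⟨Z, hZ, hZn⟩ := cfg_alternative hcfg h1 h2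
  rw [← hnV, ← ht] at hZn
  refine (greedy hcfg.disj hsplit (g * t) D fun X hX => ?_).mono Subset.rfl ?_
  · have hX' : (#X : ℝ) ≤ k * D := by exact_mod_cast hX
    have hXt : (#X : ℝ) * t ≤ k * (δ * n) := by
      have := mul_le_mul_of_nonneg_right hX' htpos.le
      linarith
    have hδαn : δ * (32 * k ^ 2 * P.M) * n ≤ α₀ * n := mul_le_mul_of_nonneg_right hδα hnpos.le
    by_cases hcase : α₀ / 2 * n < #Z * (k * P.M * t)
    · have hlt : #X < #(Z.image (Sum.inl : ι → ι ⊕ Fin q)) := by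
        rw [card_image_of_injective _ Sum.inl_injective]
        by_contra! hcon
        have b1 : (#Z : ℝ) * t ≤ #X * t :=
          mul_le_mul_of_nonneg_right (by exact_mod_cast hcon) htpos.le
        have b2 := mul_le_mul_of_nonneg_left (b1.trans hXt)
          (by positivity : (0 : ℝ) ≤ k * P.M)
        have b3 : 0 < δ * n * (k ^ 2 * P.M) := by positivity
        linarith
      obtain ⟨A₀, hA₀, hA₀X⟩ := exists_mem_notMem_of_card_lt_card hlt
      obtain ⟨i, hi, rfl⟩ := mem_image.1 hA₀
      obtain ⟨Y, hY1, hY2, -, hY4⟩ := hE m hm1 hcfg hhost.edge X (Sum.inl i) hA₀X (hZ i hi).1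
        (hZ i hi).2 (by
          rw [← hnV]
          refine (hXb X hX).trans ?_
          have : 0 < γ * n := by positivity
          linarith)
      refine ⟨Y, hY1, hY2, hY4.mono Subset.rfl ?_⟩
      rw [← ht]
      have := mul_le_mul_of_nonneg_right hgg₁ htpos.le
      linarith
    · push Not at hcase
      obtain ⟨bad, hbad1, hbad2⟩ := hhost.tuple
      obtain ⟨Y, hY1, hY2, -, hY4⟩ := hU m hm2 hcfg bad hbad2 X
        (univ.image (Sum.inr : Fin q → ι ⊕ Fin q) \ X) sdiff_disjoint (fun A hA => by
          obtain ⟨j, -, rfl⟩ := mem_image.1 (mem_sdiff.1 hA).1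
          exact h2 j) (by
          refine hbad1.trans_le ?_
          rw [← hnV, ← ht]
          have c1 : q ≤ #(univ.image (Sum.inr : Fin q → ι ⊕ Fin q) \ X) - (k - 1) + k + #X := by
            have := le_card_sdiff X (univ.image (Sum.inr : Fin q → ι ⊕ Fin q))
            rw [card_image_of_injective _ Sum.inr_injective, card_univ, Fintype.card_fin] at this
            omega
          have c2 : (q : ℝ) ≤ (#(univ.image (Sum.inr : Fin q → ι ⊕ Fin q) \ X) - (k - 1) : ℕ) +
            k + #X := by exact_mod_cast c1
          have c3 := mul_le_mul_of_nonneg_right c2 htpos.le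
          have c4 : δ * n * (k * 1) ≤ δ * n * (k * (k * P.M)) := by
            refine mul_le_mul_of_nonneg_left (mul_le_mul_of_nonneg_left ?_ (by positivity))
              (by positivity)
            nlinarith
          have c5 : 0 < α₀ * n := by positivity
          refine div_le_div_of_nonneg_right (pow_le_pow_left₀ (by positivity) ?_ _) (by norm_num)
          linarith) (by rw [← hnV]; exact hXb X hX)
      refine ⟨Y, hY1, hY2, hY4.mono Subset.rfl ?_⟩
      rw [← ht]
      have := mul_le_mul_of_nonneg_right hgg₂ htpos.le
      linarith
  · have d1 : g * (δ / 2 * n) ≤ g * (D * t) := mul_le_mul_of_nonneg_left (by linarith) hgpos.le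
    linarith

/-- Iterating `step` gives an almost perfect tiling. -/
lemma exists_ach {γ α₀ : ℝ} (hγ : 0 < γ) (hγ1 : γ ≤ 1) (hα₀ : 0 < α₀) :
    ∃ n₀ : ℕ, ∀ {V : Type} [Fintype V] [DecidableEq V] {E E' : Finset (Finset V)},
    n₀ ≤ Fintype.card V → IsHost P z E E' γ (α₀ / 4) →
    Ach P E E' 1 univ ((1 - α₀) * Fintype.card V) := by
  obtain ⟨ν, hν, hstep⟩ := step P z hγ hγ1 hα₀
  have key : ∀ j t' : ℕ, 0 < t' → ∃ n₀ : ℕ,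
      ∀ {V : Type} [Fintype V] [DecidableEq V] {E E' : Finset (Finset V)},
      n₀ ≤ Fintype.card V → IsHost P z E E' γ (α₀ / 4) →
      Ach P E E' t' univ ((1 - max α₀ (1 - j * ν)) * Fintype.card V) := by
    intro j
    induction j with
    | zero =>
      refine fun t' _ => ⟨0, ?_⟩
      intro V _ _ E E' _ _
      refine Ach.nil _ _ (mul_nonpos_of_nonpos_of_nonneg ?_ (Nat.cast_nonneg _))
      have := le_max_right α₀ (1 - (0 : ℕ) * ν)
      simp only [Nat.cast_zero, zero_mul, sub_zero] at this ⊢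
      linarith
    | succ j ih =>
      intro t' ht'
      obtain ⟨t, ht, n₁, h1⟩ := hstep t' ht'
      obtain ⟨n₂, h2⟩ := ih t ht
      refine ⟨max n₁ n₂, ?_⟩
      intro V _ _ E E' hn hhost
      refine (h1 ((le_max_left _ _).trans hn) hhost _
        (h2 ((le_max_right _ _).trans hn) hhost)).mono Subset.rfl ?_
      refine mul_le_mul_of_nonneg_right ?_ (Nat.cast_nonneg _)
      have : max α₀ (max α₀ (1 - j * ν) - ν) ≤ max α₀ (1 - (j + 1 : ℕ) * ν) := by
        refine max_le (le_max_left _ _) ?_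
        rw [sub_le_iff_le_add]
        refine max_le ((le_max_left _ _).trans (by linarith)) ?_
        have := le_max_right α₀ (1 - (j + 1 : ℕ) * ν)
        push_cast at this ⊢
        linarith
      linarith
  obtain ⟨j, hj⟩ := exists_nat_ge (1 / ν)
  obtain ⟨n₀, h⟩ := key j 1 one_pos
  refine ⟨n₀, ?_⟩
  intro V _ _ E E' hn hhost
  have := h hn hhost
  rwa [max_eq_left] at this
  rw [div_le_iff₀ hν] at hj
  linarith

end Step

section Dense

variable {k : ℕ} {V : Type} [Fintype V] [DecidableEq V]

lemma degS_le_card_insert {E : Finset (Finset V)} (hE : IsKGraph k E) (hk : 0 < k)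
    {T : Finset V} (hT : #T = k - 1) : degS E T ≤ #{w | insert w T ∈ E} := by
  refine (card_le_card fun e he => ?_).trans
    (card_image_le (f := fun w => insert w T) (s := {w | insert w T ∈ E}))
  obtain ⟨heE, hTe⟩ := mem_filter.1 he
  have hc : #(e \ T) = 1 := by
    rw [card_sdiff_of_subset hTe, hE e heE, hT]
    omega
  obtain ⟨w, hw⟩ := card_eq_one.1 hc
  have heq : insert w T = e := by
    rw [insert_eq, ← hw, sdiff_union_of_subset hTe]
  exact mem_image.2 ⟨w, by simpa [heq] using heE, heq⟩

/-- Few tuples span a given set. -/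
lemma card_tuples_le {J : Type} [Fintype J] [DecidableEq J] {𝒮 : Finset (Finset V)} {r : ℕ}
    (h𝒮 : ∀ S ∈ 𝒮, #S = r) :
    #{y : J → V | univ.image y ∈ 𝒮} ≤ #𝒮 * r ^ Fintype.card J := by
  have hsub : ({y : J → V | univ.image y ∈ 𝒮} : Finset (J → V)) ⊆
      𝒮.biUnion fun S => Fintype.piFinset fun _ => S := fun y hy => by
    refine mem_biUnion.2 ⟨_, (mem_filter.1 hy).2, ?_⟩
    exact Fintype.mem_piFinset.2 fun j => mem_image_of_mem _ (mem_univ j)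
  refine (card_le_card hsub).trans (card_biUnion_le_card_mul _ _ _ fun S hS => ?_)
  simp [h𝒮 S hS]

/-- Changing one coordinate rarely leads into a small set of tuples. -/
lemma sum_card_update_le {J : Type} [Fintype J] [DecidableEq J] (Y : Finset (J → V)) :
    ∑ x : J → V, #{w : V | ∃ j, Function.update x j w ∈ Y} ≤
      Fintype.card J * (#Y * Fintype.card V) := by
  have h1 : ∀ x : J → V, #{w : V | ∃ j, Function.update x j w ∈ Y} ≤
      ∑ j, #{w : V | Function.update x j w ∈ Y} := fun x => by
    refine (card_le_card (t := univ.biUnion fun j =>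
      {w : V | Function.update x j w ∈ Y}) fun w hw => ?_).trans card_biUnion_le
    simpa using hw
  refine (sum_le_sum fun x _ => h1 x).trans ?_
  rw [sum_comm, ← smul_eq_mul, ← card_univ]
  refine sum_le_card_nsmul _ _ _ fun j _ => ?_
  rw [← card_sigma, ← card_univ, ← card_product]
  refine card_le_card_of_injOn (fun p => (Function.update p.1 j p.2, p.1 j)) ?_ ?_
  · rintro ⟨x, w⟩ h
    simpa using h
  · rintro ⟨x, w⟩ - ⟨x', w'⟩ - h
    simp only [Prod.mk.injEq] at h
    have hw : w = w' := by simpa using congrFun h.1 j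
    have hx : x = x' := by
      funext i
      by_cases hi : i = j
      · rw [hi, h.2]
      · simpa [hi] using congrFun h.1 i
    rw [hw, hx]

lemma insert_mem_or_update {J : Type} [Fintype J] [DecidableEq J] {E 𝒮 : Finset (Finset V)}
    {x : J → V} (hx : Function.Injective x) (hx𝒮 : univ.image x ∉ 𝒮)
    (h𝒮 : ∀ S ∈ 𝒮, #S = Fintype.card J) {w : V} (hw : insert w (univ.image x) ∈ E)
    (hE : ∀ e ∈ E, #e = Fintype.card J + 1) :
    insert w (univ.image x) ∈ E.filter (fun e => ∀ S ∈ 𝒮, ¬ S ⊆ e) ∨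
      ∃ j, univ.image (Function.update x j w) ∈ 𝒮 := by
  by_contra! hcon
  obtain ⟨h1, h2⟩ := hcon
  simp only [mem_filter, hw, true_and] at h1
  push Not at h1
  obtain ⟨S, hS, hSe⟩ := h1
  have hT : #(univ.image x) = Fintype.card J := by rw [card_image_of_injective _ hx, card_univ]
  have hwT : w ∉ univ.image x := fun h => by
    have := hE _ hw
    rw [insert_eq_of_mem h, hT] at this
    omega
  have hwS : w ∈ S := by
    by_contra h
    have : S = univ.image x := eq_of_subset_of_card_le ((subset_insert_iff_of_notMem h).1 hSe)
      (by rw [hT, h𝒮 S hS])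
    exact hx𝒮 (this ▸ hS)
  obtain ⟨u, hu⟩ : ∃ u, u ∈ univ.image x \ S := by
    by_contra! h
    have h3 : insert w (univ.image x) ⊆ S := insert_subset hwS fun v hv => by
      by_contra hvS
      exact h v (mem_sdiff.2 ⟨hv, hvS⟩)
    have := card_le_card h3
    rw [card_insert_of_notMem hwT, hT, h𝒮 S hS] at this
    omega
  obtain ⟨huT, huS⟩ := mem_sdiff.1 hu
  obtain ⟨j, -, rfl⟩ := mem_image.1 huT
  refine h2 j ?_
  suffices S = univ.image (Function.update x j w) from this ▸ hS
  refine eq_of_subset_of_card_le (fun v hv => ?_) ?_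
  · rcases mem_insert.1 (hSe hv) with rfl | h
    · exact mem_image.2 ⟨j, mem_univ _, by simp⟩
    · obtain ⟨i, -, rfl⟩ := mem_image.1 h
      have hij : i ≠ j := by rintro rfl; exact huS hv
      exact mem_image.2 ⟨i, mem_univ _, by simp [hij]⟩
  · rw [h𝒮 S hS, ← card_univ]
    exact card_image_le

end Dense

lemma exists_isHost {k : ℕ} {L : Type} [Fintype L] (P : Patt k L) (z : Fin k) {γ η : ℝ}
    (hγ : 0 < γ) (hη : 0 < η) :
    ∃ θ₀ : ℝ, 0 < θ₀ ∧ ∃ n₀ : ℕ, ∀ {V : Type} [Fintype V] [DecidableEq V]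
    {E : Finset (Finset V)} {μ θ : ℝ}, n₀ ≤ Fintype.card V → θ ≤ θ₀ →
    1 / 2 + 1 / (2 * (P.s : ℝ)) + 2 * γ ≤ μ → IsKGraph k E → IsDense k μ θ E →
    ∃ E' ⊆ E, IsHost P z E E' γ η := by
  have hk := P.hk
  have hkpos : (0 : ℝ) < k := by exact_mod_cast (by omega : 0 < k)
  obtain ⟨C, hC⟩ : ∃ C : ℝ, C = 1 + 2 * k / γ := ⟨_, rfl⟩
  have hCpos : 0 < C := by rw [hC]; positivity
  obtain ⟨c, hc⟩ : ∃ c : ℝ, c = 1 / 2 + 1 / (2 * (P.s : ℝ)) := ⟨_, rfl⟩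
  have hcs : 1 / 2 ≤ c := by
    have : 0 ≤ 1 / (2 * (P.s : ℝ)) := by positivity
    linarith
  obtain ⟨D, hD⟩ : ∃ D : ℝ, D = 4 * C * k ^ (k - 1) := ⟨_, rfl⟩
  have hDpos : 0 < D := by rw [hD]; positivity
  obtain ⟨n₁, hn₁⟩ := exists_nat_ge ((c + 2 * γ) * k / γ)
  refine ⟨η ^ (k - 1) / D, by positivity, max n₁ k, ?_⟩
  intro V _ _ E μ θ hn hθ hμ hE ⟨𝒮, h𝒮, h𝒮card, hdeg⟩
  rw [← hc] at hμ
  obtain ⟨n, hnV⟩ : ∃ n : ℝ, n = Fintype.card V := ⟨_, rfl⟩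
  have hnk : (k : ℝ) ≤ n := by
    rw [hnV]; exact_mod_cast (le_max_right _ _).trans hn
  have hnpos : 0 < n := hkpos.trans_le hnk
  have hn1 : (c + 2 * γ) * k ≤ γ * n := by
    rw [div_le_iff₀ hγ] at hn₁
    have : (n₁ : ℝ) ≤ n := by rw [hnV]; exact_mod_cast (le_max_left _ _).trans hn
    have := mul_le_mul_of_nonneg_right this hγ.le
    linarith
  have hdeg' : ∀ T : Finset V, #T = k - 1 → T ∉ 𝒮 →
      (c + γ) * n ≤ #{w | insert w T ∈ E} := by
    intro T hT hT𝒮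
    have h1 := hdeg T hT hT𝒮
    rw [← hnV] at h1
    have h2 : (degS E T : ℝ) ≤ #{w | insert w T ∈ E} := by
      exact_mod_cast degS_le_card_insert hE (by omega) hT
    have h3 : (c + 2 * γ) * (n - k + 1) ≤ μ * (n - k + 1) :=
      mul_le_mul_of_nonneg_right hμ (by linarith)
    linarith
  have hJ : Fintype.card {i : Fin k // i ≠ z} = k - 1 := by simp
  refine ⟨E.filter fun e => ∀ S ∈ 𝒮, ¬ S ⊆ e, filter_subset _ _, fun x hx i => ?_, ?_⟩
  · rw [← hc, ← hnV]
    obtain ⟨hxE, hx𝒮⟩ := mem_filter.1 hx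
    have hinj : Set.InjOn x (univ : Finset (Fin k)) := by
      rw [← card_image_iff, hE _ hxE, card_univ, Fintype.card_fin]
    refine hdeg' _ ?_ fun h => hx𝒮 _ h (image_subset_image (erase_subset _ _))
    rw [card_image_of_injOn (hinj.mono (by simp)), card_erase_of_mem (mem_univ i), card_univ,
      Fintype.card_fin]
  obtain ⟨Y, hY⟩ : ∃ Y : Finset ({i : Fin k // i ≠ z} → V),
      Y = univ.filter fun y => univ.image y ∈ 𝒮 := ⟨_, rfl⟩
  obtain ⟨f, hf⟩ : ∃ f : ({i : Fin k // i ≠ z} → V) → ℕ,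
      f = fun x => #{w : V | ∃ j, Function.update x j w ∈ Y} := ⟨_, rfl⟩
  have hsum : ((∑ x, f x : ℕ) : ℝ) ≤ k * (#Y * n) := by
    have h1 : ∑ x, f x ≤ k * (#Y * Fintype.card V) := by
      rw [hf]
      refine (sum_card_update_le Y).trans (Nat.mul_le_mul_right _ ?_)
      omega
    rw [hnV]
    exact_mod_cast h1
  obtain ⟨B, hB⟩ : ∃ B : Finset ({i : Fin k // i ≠ z} → V),
      B = univ.filter fun x => γ / 2 * n < f x := ⟨_, rfl⟩
  have hBcard : (#B : ℝ) ≤ 2 * k / γ * #Y := by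
    have h1 : #B • (γ / 2 * n) ≤ ∑ x ∈ B, (f x : ℝ) :=
      card_nsmul_le_sum _ _ _ fun x hx => by
        rw [hB] at hx
        exact (mem_filter.1 hx).2.le
    have h2 : ∑ x ∈ B, (f x : ℝ) ≤ ∑ x, (f x : ℝ) :=
      sum_le_sum_of_subset_of_nonneg (subset_univ _) fun _ _ _ => Nat.cast_nonneg _
    rw [nsmul_eq_mul] at h1
    push_cast at hsum
    have h3 : #B * (γ / 2) * n ≤ k * #Y * n := by linarith
    have h4 := le_of_mul_le_mul_right h3 hnpos
    rw [div_mul_eq_mul_div, le_div_iff₀ hγ]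
    linarith
  have hYcard : (#Y : ℝ) ≤ η ^ (k - 1) / D * n ^ (k - 1) * k ^ (k - 1) := by
    have h1 : #Y ≤ #𝒮 * (k - 1) ^ (k - 1) := by
      rw [hY]
      have := card_tuples_le (J := {i : Fin k // i ≠ z}) h𝒮
      rwa [hJ] at this
    have h2 : #Y ≤ #𝒮 * k ^ (k - 1) :=
      h1.trans (Nat.mul_le_mul_left _ (Nat.pow_le_pow_left (by omega) _))
    have h3 : (#Y : ℝ) ≤ #𝒮 * (k : ℝ) ^ (k - 1) := by exact_mod_cast h2
    have h4 : ((Fintype.card V).choose (k - 1) : ℝ) ≤ n ^ (k - 1) := by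
      rw [hnV]
      exact_mod_cast Nat.choose_le_pow _ _
    have h5 : (#𝒮 : ℝ) ≤ η ^ (k - 1) / D * n ^ (k - 1) :=
      h𝒮card.trans ((mul_le_mul_of_nonneg_right hθ (Nat.cast_nonneg _)).trans
        (mul_le_mul_of_nonneg_left h4 (by positivity)))
    exact h3.trans (mul_le_mul_of_nonneg_right h5 (by positivity))
  refine ⟨Y ∪ B, ?_, fun x hx hinj => ?_⟩
  · rw [← hnV, mul_pow]
    have h1 : (#(Y ∪ B) : ℝ) ≤ #Y + #B := by exact_mod_cast card_union_le _ _
    have h2 : (#Y : ℝ) + #B ≤ C * #Y := by rw [hC]; linarith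
    have h3 := mul_le_mul_of_nonneg_left hYcard hCpos.le
    have h4 : C * (η ^ (k - 1) / D * n ^ (k - 1) * k ^ (k - 1)) =
        η ^ (k - 1) * n ^ (k - 1) / 4 := by
      rw [hD]
      have : (k : ℝ) ^ (k - 1) ≠ 0 := by positivity
      field_simp
    have h5 : 0 < η ^ (k - 1) * n ^ (k - 1) := by positivity
    linarith
  · rw [mem_union, not_or] at hx
    obtain ⟨hxY, hxB⟩ := hx
    have hxY' : univ.image x ∉ 𝒮 := by simpa [hY] using hxY
    have hfx : (f x : ℝ) ≤ γ / 2 * n := by simpa [hB] using hxB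
    have h1 := hdeg' (univ.image x) (by rw [card_image_of_injective _ hinj, card_univ, hJ]) hxY'
    have h2 : #{w | insert w (univ.image x) ∈ E} ≤
        #(ext (E.filter fun e => ∀ S ∈ 𝒮, ¬ S ⊆ e) x) + f x := by
      rw [hf]
      refine (card_le_card fun w hw => ?_).trans (card_union_le _ _)
      have := insert_mem_or_update hinj hxY' (by simpa [hJ] using h𝒮) (mem_filter.1 hw).2
        (fun e he => by rw [hE e he, hJ]; omega)
      rw [mem_union, mem_ext, hY]
      exact this.imp id fun ⟨j, hj⟩ => mem_filter.2 ⟨mem_univ _, j, mem_filter.2 ⟨mem_univ _, hj⟩⟩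
    have h3 : (#{w | insert w (univ.image x) ∈ E} : ℝ) ≤
        #(ext (E.filter fun e => ∀ S ∈ 𝒮, ¬ S ⊆ e) x) + f x := by exact_mod_cast h2
    rw [← hnV]
    have h4 : (1 / 2 + γ) * n ≤ (c + γ) * n :=
      mul_le_mul_of_nonneg_right (by linarith) hnpos.le
    linarith

section Copies

variable {k : ℕ} {V : Type} [DecidableEq V] {E E' : Finset (Finset V)}

lemma TileE.spans {L : Type} [Fintype L] {P : Patt k L} {S : Finset V}
    (h : TileE P E' 1 S) (hE : E' ⊆ E) : SpansEsCopy k P.M E S := by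
  obtain ⟨B, hB, hc, rfl⟩ := h
  have e := fun i => (B i).equivFinOfCardEq ((hc i).trans (mul_one _))
  refine ⟨fun x => (e x.1).symm x.2, ?_, ?_, fun g => hE (hB.2 _ fun i => coe_mem _)⟩
  · rintro ⟨i, x⟩ ⟨j, y⟩ hxy
    dsimp only at hxy
    obtain rfl : i = j := by
      by_contra hij
      exact disjoint_left.1 (hB.1 i j hij) ((e i).symm x).2 (hxy ▸ ((e j).symm y).2)
    rw [(e i).symm.injective (Subtype.ext hxy)]
  · ext v
    simp only [mem_image, mem_univ, true_and, mem_biUnion, Prod.exists]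
    refine exists_congr fun i => ⟨?_, fun hv => ⟨e i ⟨v, hv⟩, by simp⟩⟩
    rintro ⟨x, rfl⟩
    exact coe_mem _

lemma TileF.spans {G : SimpleGraph (Fin k)} [Fintype G.edgeSet] {P : Patt k G.edgeSet}
    (hpq : ∀ e : G.edgeSet, (e : Sym2 (Fin k)) = s(P.p e, P.q e)) {S : Finset V}
    (h : TileF P E E' 1 S) (hE : E' ⊆ E) : SpansFsCopy k P.a G E S := by
  classical
  obtain ⟨Q, hQ, hc, hd, rfl⟩ := h
  have e := fun i => (Q (Sum.inl i)).equivFinOfCardEq ((hc i).trans (mul_one _))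
  choose w hw using fun l => card_eq_one.1 (hd l)
  have hwQ : ∀ l, w l ∈ Q (Sum.inr l) := fun l => by simp [hw l]
  have i₀ : Fin k := ⟨0, by have := P.hk; omega⟩
  obtain ⟨v₀, -⟩ : (Q (Sum.inl i₀)).Nonempty := by
    rw [← card_pos, hc]
    have := P.le_a i₀
    have := P.hM
    have := P.hk
    omega
  obtain ⟨f, hf⟩ : ∃ f : ((Σ i : Fin k, Fin (P.a i)) ⊕ Sym2 (Fin k)) → V,
      f = Sum.elim (fun x => (e x.1).symm x.2)
        fun x => if h : x ∈ G.edgeSet then w ⟨x, h⟩ else v₀ := ⟨_, rfl⟩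
  have hfl : ∀ i x, f (Sum.inl ⟨i, x⟩) = (e i).symm x := fun i x => by rw [hf]; rfl
  have hfr : ∀ l : G.edgeSet, f (Sum.inr l) = w l := fun l => by
    rw [hf]
    exact dif_pos l.2
  have hflQ : ∀ i x, f (Sum.inl ⟨i, x⟩) ∈ Q (Sum.inl i) := fun i x => by
    rw [hfl]; exact coe_mem _
  refine ⟨f, ?_, ?_, ?_⟩
  · rintro _ (⟨⟨i, x⟩, rfl⟩ | ⟨l, hl, rfl⟩) _ (⟨⟨j, y⟩, rfl⟩ | ⟨l', hl', rfl⟩) hxy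
    · obtain rfl : i = j := by
        by_contra hij
        exact disjoint_left.1 (hQ.1 _ _ fun h => hij (Sum.inl_injective h)) (hflQ i x)
          (hxy ▸ hflQ j y)
      rw [hfl, hfl] at hxy
      rw [(e i).symm.injective (Subtype.ext hxy)]
    · rw [hfr ⟨l', hl'⟩] at hxy
      exact (disjoint_left.1 (hQ.1 _ _ Sum.inl_ne_inr) (hflQ i x) (hxy ▸ hwQ ⟨l', hl'⟩)).elim
    · rw [hfr ⟨l, hl⟩] at hxy
      exact (disjoint_left.1 (hQ.1 _ _ Sum.inl_ne_inr) (hflQ j y) (hxy ▸ hwQ ⟨l, hl⟩)).elim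
    · rw [hfr ⟨l, hl⟩, hfr ⟨l', hl'⟩] at hxy
      by_contra hll
      have hne : (⟨l, hl⟩ : G.edgeSet) ≠ ⟨l', hl'⟩ := fun h => hll (by rw [Subtype.mk.inj h])
      exact disjoint_left.1 (hQ.1 _ _ fun h => hne (Sum.inr_injective h)) (hwQ _) (hxy ▸ hwQ _)
  · ext v
    simp only [coe_biUnion, Set.mem_iUnion]
    constructor
    · rintro ⟨_, ⟨⟨i, x⟩, rfl⟩ | ⟨l, hl, rfl⟩, rfl⟩
      · exact ⟨Sum.inl i, by simp, hflQ i x⟩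
      · rw [hfr ⟨l, hl⟩]
        exact ⟨Sum.inr ⟨l, hl⟩, by simp, hwQ _⟩
    · rintro ⟨i | l, -, hv⟩
      · exact ⟨_, Or.inl ⟨⟨i, e i ⟨v, hv⟩⟩, rfl⟩, by rw [hfl]; simp⟩
      · refine ⟨_, Or.inr ⟨l, l.2, rfl⟩, ?_⟩
        rw [hfr l]
        rw [hw l] at hv
        exact (mem_singleton.1 hv).symm
  · rintro _ (⟨g, rfl⟩ | ⟨i, j, hij, g, rfl⟩)
    · rw [image_image]
      exact hE (hQ.2.1 _ fun i => hflQ i (g i))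
    · rw [image_insert, image_image, hfr ⟨s(i, j), hij⟩]
      have hT := hQ.2.2 ⟨s(i, j), hij⟩ (fun i => f (Sum.inl ⟨i, g i⟩)) _ (fun i => hflQ i (g i))
        (hwQ _)
      rcases Sym2.eq_iff.1 (hpq ⟨s(i, j), hij⟩) with ⟨h, -⟩ | ⟨h, -⟩
      · rw [← h] at hT
        exact hT.1
      · rw [← h] at hT
        exact hT.2

/-- A tiling of scale one is an `{F_s, E_s}`-tiling. -/
lemma Ach.exists_tiling [Fintype V] {G : SimpleGraph (Fin k)} [Fintype G.edgeSet]
    {P : Patt k G.edgeSet} (hM : P.M = univ.sup P.a)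
    (hpq : ∀ e : G.edgeSet, (e : Sym2 (Fin k)) = s(P.p e, P.q e)) (hE : E' ⊆ E) {α : ℝ}
    (h : Ach P E E' 1 univ ((1 - α) * Fintype.card V)) (hV : 0 < Fintype.card V) :
    ∃ TF TE : Finset (Finset V), IsFETiling k P.a G E TF TE ∧ phiTiling P.s TF TE ≤ α := by
  classical
  obtain ⟨ι, _, reg, val, h1, h2, -, h4⟩ := h
  have hk := P.hk
  have hpos : ∀ i, 0 < #(reg i) := fun i => by
    rcases h1 i with h | h
    · rw [h.1.card_eq, mul_one]
      exact P.s_pos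
    · rw [h.1.card_eq, mul_one]
      have := P.hM
      exact Nat.mul_pos (by omega) (by omega)
  have hinj : Function.Injective reg := fun i j hij => by
    by_contra hne
    have := h2 i j hne
    rw [hij, disjoint_self_iff_empty] at this
    exact (hpos j).ne' (by rw [this, card_empty])
  obtain ⟨I, hI⟩ : ∃ I : Finset ι, I = univ.filter fun i => TileF P E E' 1 (reg i) ∧
    val i = P.s * (1 : ℕ) := ⟨_, rfl⟩
  have hIE : ∀ i ∈ Iᶜ, TileE P E' 1 (reg i) ∧ val i = 3 / 5 * (P.s * (1 : ℕ)) := fun i hi => by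
    refine (h1 i).resolve_left fun h => mem_compl.1 hi ?_
    rw [hI]
    exact mem_filter.2 ⟨mem_univ _, h⟩
  have hIF : ∀ i ∈ I, TileF P E E' 1 (reg i) ∧ val i = P.s * (1 : ℕ) := fun i hi => by
    rw [hI] at hi
    exact (mem_filter.1 hi).2
  refine ⟨I.image reg, Iᶜ.image reg, ⟨?_, ?_, ?_⟩, ?_⟩
  · rw [← image_union, union_compl]
    intro A hA B hB hAB
    obtain ⟨i, -, rfl⟩ := mem_image.1 (mem_coe.1 hA)
    obtain ⟨j, -, rfl⟩ := mem_image.1 (mem_coe.1 hB)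
    exact h2 i j fun h => hAB (by rw [h])
  · intro A hA
    obtain ⟨i, hi, rfl⟩ := mem_image.1 hA
    exact (hIF i hi).1.spans hpq hE
  · intro A hA
    obtain ⟨i, hi, rfl⟩ := mem_image.1 hA
    rw [← hM]
    exact (hIE i hi).1.spans hE
  · have hs : ∑ i, val i = P.s * (#I + 3 / 5 * #Iᶜ) := by
      rw [← sum_add_sum_compl I, sum_congr rfl fun i hi => (hIF i hi).2,
        sum_congr rfl fun i hi => (hIE i hi).2]
      simp only [sum_const, nsmul_eq_mul, Nat.cast_one]
      ring
    rw [phiTiling, card_image_of_injective _ hinj, card_image_of_injective _ hinj, ← hs,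
      div_le_iff₀ (by exact_mod_cast hV)]
    linarith

end Copies

lemma PhiMax_le {k s n : ℕ} {a : Fin k → ℕ} {G : SimpleGraph (Fin k)} {μ θ α : ℝ} (hα : 0 ≤ α)
    (h : ∀ E : Finset (Finset (Fin n)), IsKGraph k E → IsDense k μ θ E →
      ∃ TF TE : Finset (Finset (Fin n)), IsFETiling k a G E TF TE ∧ phiTiling s TF TE ≤ α) :
    PhiMax k s a G n μ θ ≤ α := by
  refine Real.sSup_le ?_ hα
  rintro _ ⟨E, hE, hd, rfl⟩
  obtain ⟨TF, TE, h1, h2⟩ := h E hE hd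
  rw [phiMin]
  refine le_trans (csInf_le (Set.Finite.bddBelow ?_) ⟨TF, TE, h1, rfl⟩) h2
  refine (Set.finite_range fun p : Finset (Finset (Fin n)) × Finset (Finset (Fin n)) =>
    phiTiling s p.1 p.2).subset ?_
  rintro _ ⟨TF, TE, -, rfl⟩
  exact ⟨(TF, TE), rfl⟩

end PhiSmall

/-- `Φ(n, 1/2 + 1/(2s) + γ, θ) ≤ α` for all sufficiently small `θ ≥ 0` and
sufficiently large `n`; that is, every `(1/2 + 1/(2s) + γ, θ)`-dense `k`-graph on `n`
vertices has an `{F_s, E_s}`-tiling `𝒯` with `φ(𝒯) ≤ α`. -/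
theorem Phi_small (k s : ℕ) (hk : 3 ≤ k) (hs : 5 * k ^ 2 ≤ s) (hnd : ¬ k ∣ s)
    (G : SimpleGraph (Fin k)) (a : Fin k → ℕ) (ℓ : ℕ)
    (hG : IsUnionOfPaths k G) (hEG : G.edgeSet.ncard = ℓ) (hℓk : ℓ ≤ k - 1)
    (ha : ∀ i, 1 ≤ a i) (hab : ∀ i j, |(a i : ℤ) - (a j : ℤ)| ≤ 1)
    (hsum : ℓ + ∑ i, a i = s) (hFs : FsHasSpanningCs k s a G)
    (α γ : ℝ) (hα : 0 < α) (hγ : 0 < γ) :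
    ∃ (θ₀ : ℝ) (n₀ : ℕ), 0 < θ₀ ∧ ∀ θ : ℝ, 0 ≤ θ → θ ≤ θ₀ → ∀ n : ℕ, n₀ ≤ n →
      PhiMax k s a G n (1 / 2 + 1 / (2 * (s : ℝ)) + γ) θ ≤ α ∧
      ∀ E : Finset (Finset (Fin n)), IsKGraph k E →
        IsDense k (1 / 2 + 1 / (2 * (s : ℝ)) + γ) θ E →
        ∃ TF TE : Finset (Finset (Fin n)), IsFETiling k a G E TF TE ∧
          phiTiling s TF TE ≤ α := by
  classical
  obtain ⟨P, rfl, rfl, hM, hpq⟩ := PhiSmall.exists_patt k s hk hs G a ℓ hG hEG hℓk hab hsum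
  obtain ⟨c, hcpos, hc1, hcγ⟩ : ∃ c : ℝ, 0 < c ∧ c ≤ 1 ∧ 2 * c ≤ γ :=
    ⟨min 1 (γ / 2), lt_min one_pos (by linarith), min_le_left _ _,
      by linarith [min_le_right 1 (γ / 2)]⟩
  obtain ⟨θ₀, hθ₀, n₁, h1⟩ := PhiSmall.exists_isHost P ⟨0, by omega⟩ hcpos
    (by positivity : 0 < α / 4)
  obtain ⟨n₂, h2⟩ := PhiSmall.exists_ach P ⟨0, by omega⟩ hcpos hc1 hα
  refine ⟨θ₀, max (max n₁ n₂) 1, hθ₀, fun θ _ hθ n hn => ?_⟩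
  have key : ∀ E : Finset (Finset (Fin n)), IsKGraph k E →
      IsDense k (1 / 2 + 1 / (2 * (P.s : ℝ)) + γ) θ E →
      ∃ TF TE : Finset (Finset (Fin n)), IsFETiling k P.a G E TF TE ∧
        phiTiling P.s TF TE ≤ α := by
    intro E hE hd
    obtain ⟨E', hE', hhost⟩ := h1 (V := Fin n) (by rw [Fintype.card_fin]; omega) hθ
      (by linarith) hE hd
    exact (h2 (by rw [Fintype.card_fin]; omega) hhost).exists_tiling hM hpq hE'
      (by rw [Fintype.card_fin]; omega)
  exact ⟨PhiSmall.PhiMax_le hα.le key, key⟩
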